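/- Let \overline{H} : ℝⁿ → ℝ be the deterministic effective Hamiltonian (for P-a.e. ω, \overline{H}(p,ω) = \overline{H}(p) for all p), and assume the set argmin \overline{H} = {p : \overline{H}(p) = min \overline{H}} has empty interior. Let U ⊆ ℝⁿ be a bounded open set with smooth boundary and g : ∂U → ℝ continuous. For each ε > 0 and ω ∈ Ω let u^ε(·,ω) ∈ C(cl U) be an absolute minimizer for H^ε(p,x,ω) := H(p, x/ε, ω) in U with u^ε(·,ω) = g on ∂U, and assume that for each ω the family {u^ε(·,ω)}_{ε>0} is uniformly bounded and uniformly equicontinuous on cl U. Then there is a unique absolute minimizer u ∈ C(cl U) for \overline{H} in U satisfying u = g on ∂U, and almost surely in ω, u^ε(·,ω) → u uniformly on cl U as ε → 0. -/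

import Mathlib

open MeasureTheory Filter Metric Set
open scoped NNReal

noncomputable section

/-- ℝⁿ as a Euclidean space. -/
abbrev Ed (n : ℕ) := EuclideanSpace ℝ (Fin n)

/-- The admissible set of levels `μ` in the definition of the random effective Hamiltonian. -/
def effSetR {n : ℕ} {Ω : Type*} (H : Ed n → Ed n → Ω → ℝ) (ω : Ω) (p : Ed n) : Set ℝ :=
  {μ : ℝ | ∃ w : Ed n → ℝ,
    (∃ K : ℝ≥0, LipschitzWith K w) ∧
    Tendsto (fun y : Ed n => w y / ‖y‖) (cocompact (Ed n)) (nhds 0) ∧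
    ∀ᵐ y ∂(volume : Measure (Ed n)), H (p + gradient w y) y ω ≤ μ}

/-- The random effective Hamiltonian `H̄(p, ω)`. -/
def effHR {n : ℕ} {Ω : Type*} (H : Ed n → Ed n → Ω → ℝ) (ω : Ω) (p : Ed n) : ℝ :=
  sInf (effSetR H ω p)

/-- `u` is an absolute subminimizer for the Hamiltonian `G = G(p,x)` in the open set `U`. -/
def AbsSubmin {n : ℕ} (G : Ed n → Ed n → ℝ) (U : Set (Ed n)) (u : Ed n → ℝ) : Prop :=
  (∀ x ∈ U, ∃ K : ℝ≥0, ∃ t ∈ nhdsWithin x U, LipschitzOnWith K u t) ∧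
  ∀ V : Set (Ed n), IsOpen V → IsCompact (closure V) → closure V ⊆ U →
    ∀ v : Ed n → ℝ, (∃ K : ℝ≥0, LipschitzOnWith K v (closure V)) →
      (∀ x ∈ V, v x ≤ u x) → (∀ x ∈ frontier V, v x = u x) →
      essSup (fun x => ((G (gradient u x) x : ℝ) : EReal)) (volume.restrict V) ≤
        essSup (fun x => ((G (gradient v x) x : ℝ) : EReal)) (volume.restrict V)

/-- `u` is an absolute superminimizer for `G` in `U`. -/
def AbsSupermin {n : ℕ} (G : Ed n → Ed n → ℝ) (U : Set (Ed n)) (u : Ed n → ℝ) : Prop :=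
  (∀ x ∈ U, ∃ K : ℝ≥0, ∃ t ∈ nhdsWithin x U, LipschitzOnWith K u t) ∧
  ∀ V : Set (Ed n), IsOpen V → IsCompact (closure V) → closure V ⊆ U →
    ∀ v : Ed n → ℝ, (∃ K : ℝ≥0, LipschitzOnWith K v (closure V)) →
      (∀ x ∈ V, u x ≤ v x) → (∀ x ∈ frontier V, v x = u x) →
      essSup (fun x => ((G (gradient u x) x : ℝ) : EReal)) (volume.restrict V) ≤
        essSup (fun x => ((G (gradient v x) x : ℝ) : EReal)) (volume.restrict V)

/-- `u` is an absolute minimizer for `G` in `U`. -/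
def AbsMin {n : ℕ} (G : Ed n → Ed n → ℝ) (U : Set (Ed n)) (u : Ed n → ℝ) : Prop :=
  AbsSubmin G U u ∧ AbsSupermin G U u

/-- Averaging a Lipschitz function over small balls bounds an increment by an a.e. bound on the
directional derivative near the segment. -/
theorem lip_increment_le {n : ℕ} {w : Ed n → ℝ} {K : ℝ≥0} (hw : LipschitzWith K w)
    {x y : Ed n} {c r : ℝ} (hr : 0 < r)
    (h : ∀ᵐ z ∂(volume : Measure (Ed n)), (∃ s ∈ Icc (0 : ℝ) 1, dist z (x + s • (y - x)) < r) →
      fderiv ℝ w z (y - x) ≤ c) : w y - w x ≤ c := by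
  set d := y - x with hd
  have key : ∀ ρ : ℝ, 0 < ρ → ρ ≤ r → w y - w x ≤ c + 2 * K * ρ := by
    intro ρ hρ hρr
    set m : Measure (Ed n) := volume.restrict (ball 0 ρ) with hm
    have : IsFiniteMeasure m := ⟨by
      rw [hm, Measure.restrict_apply_univ]; exact measure_ball_lt_top⟩
    have h_int : ∀ a : Ed n, Integrable (fun z => w (a + z)) m := by
      intro a
      have hc : Continuous fun z => w (a + z) := hw.continuous.comp (by fun_prop)
      exact (hc.continuousOn.integrableOn_compact (isCompact_closedBall 0 ρ)).mono_set
        ball_subset_closedBall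
    have hder : ∀ s ∈ Icc (0 : ℝ) 1, HasDerivAt (fun s => ∫ z, w (x + s • d + z) ∂m)
        (∫ z, fderiv ℝ w (x + s • d + z) d ∂m) s ∧
        (∫ z, fderiv ℝ w (x + s • d + z) d ∂m) ≤ c * m.real univ := by
      intro s hs
      have hmp : ∀ a : Ed n, Measure.QuasiMeasurePreserving (fun z => a + z) m volume := fun a =>
        ((measurePreserving_add_left volume a).quasiMeasurePreserving).mono_left
          Measure.absolutelyContinuous_restrict
      have hdiff : ∀ᵐ z ∂m, DifferentiableAt ℝ w (x + s • d + z) :=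
        (hmp (x + s • d)).ae hw.ae_differentiableAt
      have hle : ∀ᵐ z ∂m, fderiv ℝ w (x + s • d + z) d ≤ c := by
        filter_upwards [(hmp (x + s • d)).ae h, ae_restrict_mem measurableSet_ball] with z hz hzb
        refine hz ⟨s, hs, ?_⟩
        rw [dist_eq_norm]
        simp only [mem_ball_zero_iff] at hzb
        have : x + s • d + z - (x + s • d) = z := by abel
        rw [this]; linarith
      have hmeas : Measurable fun z => fderiv ℝ w (x + s • d + z) d :=
        (measurable_fderiv_apply_const ℝ w d).comp (measurable_const_add _)
      have hH := hasDerivAt_integral_of_dominated_loc_of_lip (μ := m)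
        (F := fun s z => w (x + s • d + z)) (F' := fun z => fderiv ℝ w (x + s • d + z) d)
        (x₀ := s) (s := univ) (bound := fun _ => K * ‖d‖) univ_mem
        (Eventually.of_forall fun a => (h_int _).aestronglyMeasurable) (h_int _)
        hmeas.aestronglyMeasurable
        (Eventually.of_forall fun z => by
          refine LipschitzWith.lipschitzOnWith ?_
          refine LipschitzWith.of_dist_le_mul fun a b => ?_
          have h1 := hw.dist_le_mul (x + a • d + z) (x + b • d + z)
          refine h1.trans (le_of_eq ?_)
          have : dist (x + a • d + z) (x + b • d + z) = dist a b * ‖d‖ := by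
            rw [dist_eq_norm, dist_eq_norm, ← norm_smul]; congr 1; module
          rw [this]
          have : ((Real.nnabs (K * ‖d‖) : ℝ≥0) : ℝ) = K * ‖d‖ := by
            rw [Real.coe_nnabs, abs_of_nonneg (by positivity)]
          rw [this]; ring)
        (integrable_const _)
        (hdiff.mono fun z hz => by
          have h2 : HasDerivAt (fun t : ℝ => x + t • d + z) d s := by
            have := ((hasDerivAt_id s).smul_const d).const_add x |>.add_const z
            simpa using this
          exact hz.hasFDerivAt.comp_hasDerivAt s h2)
      refine ⟨hH.2, ?_⟩
      calc (∫ z, fderiv ℝ w (x + s • d + z) d ∂m) ≤ ∫ _z, c ∂m :=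
            integral_mono_ae hH.1 (integrable_const _) hle
        _ = c * m.real univ := by rw [integral_const, smul_eq_mul, mul_comm]
    have hmv := (convex_Icc (0 : ℝ) 1).image_sub_le_mul_sub_of_deriv_le
      (f := fun s => ∫ z, w (x + s • d + z) ∂m) (C := c * m.real univ)
      (fun s hs => ((hder s hs).1.continuousAt).continuousWithinAt)
      (fun s hs => ((hder s (interior_subset hs)).1.differentiableAt).differentiableWithinAt)
      (fun s hs => by
        rw [(hder s (interior_subset hs)).1.deriv]; exact (hder s (interior_subset hs)).2)
      0 (by simp) 1 (by simp) zero_le_one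
    have hpos : 0 < m.real univ := by
      rw [hm, measureReal_restrict_apply_univ]
      exact ENNReal.toReal_pos (measure_ball_pos _ _ hρ).ne' measure_ball_lt_top.ne
    have hlow : (w y - w x - 2 * K * ρ) * m.real univ ≤
        (∫ z, w (x + (1 : ℝ) • d + z) ∂m) - ∫ z, w (x + (0 : ℝ) • d + z) ∂m := by
      rw [← integral_sub (h_int _) (h_int _)]
      calc (w y - w x - 2 * K * ρ) * m.real univ = ∫ _z, (w y - w x - 2 * K * ρ) ∂m := by
            rw [integral_const, smul_eq_mul, mul_comm]
        _ ≤ _ := by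
            refine integral_mono_ae (integrable_const _) ((h_int _).sub (h_int _)) ?_
            filter_upwards [ae_restrict_mem measurableSet_ball] with z hzb
            simp only [mem_ball_zero_iff] at hzb
            have h1 := hw.dist_le_mul (y + z) y
            have h2 := hw.dist_le_mul (x + z) x
            simp only [dist_eq_norm, add_sub_cancel_left, Real.norm_eq_abs] at h1 h2
            have e1 : x + (1 : ℝ) • d + z = y + z := by rw [hd]; module
            have e2 : x + (0 : ℝ) • d + z = x + z := by module
            simp only [e1, e2]
            have hKz : (K : ℝ) * ‖z‖ ≤ K * ρ := by gcongr
            have := abs_le.1 h1; have := abs_le.1 h2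
            linarith
    have := hlow.trans hmv
    simp only [sub_zero, mul_one] at this
    have := le_of_mul_le_mul_right this hpos
    linarith
  by_contra! hlt
  set ρ := min r ((w y - w x - c) / (2 * (2 * K + 1))) with hρ
  have hρ0 : 0 < ρ := lt_min hr (by have : 0 < w y - w x - c := by linarith
                                    positivity)
  have h1 := key ρ hρ0 (min_le_left _ _)
  have h2 : ρ ≤ (w y - w x - c) / (2 * (2 * K + 1)) := min_le_right _ _
  have hK : (0 : ℝ) ≤ K := K.2
  rw [le_div_iff₀ (by positivity)] at h2
  nlinarith

section Subsolutions

/-- Lipschitz a.e. subsolutions of `G(∇w, y) ≤ μ`. -/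
def IsSub {n : ℕ} (G : Ed n → Ed n → ℝ) (μ : ℝ) (w : Ed n → ℝ) : Prop :=
  (∃ K : ℝ≥0, LipschitzWith K w) ∧ ∀ᵐ y ∂(volume : Measure (Ed n)), G (gradient w y) y ≤ μ

/-- The intrinsic distance attached to the level `μ`. -/
def met {n : ℕ} (G : Ed n → Ed n → ℝ) (μ : ℝ) (y x : Ed n) : ℝ :=
  sSup {a | ∃ w, IsSub G μ w ∧ a = w y - w x}

/-- Structural assumptions at the level `μ`. -/
structure Reg {n : ℕ} (G : Ed n → Ed n → ℝ) (μ j : ℝ) : Prop where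
  nonneg : 0 ≤ j
  conv : ∀ y, ConvexOn ℝ univ fun p => G p y
  cont : ∀ y, Continuous fun p => G p y
  coer : ∀ p y, j < ‖p‖ → μ + 1 ≤ G p y
  equi : ∀ δ > (0 : ℝ), ∃ r > (0 : ℝ), ∀ p y z, ‖p‖ ≤ j → dist y z < r → |G p y - G p z| ≤ δ

/-- `c` bounds the increment from `z` to `y` of affine functions with slope in the
sublevel set of `G(·, z)`. -/
def Edge {n : ℕ} (G : Ed n → Ed n → ℝ) (ν : ℝ) (z y : Ed n) (c : ℝ) : Prop :=
  ∀ p, G p z < ν → inner ℝ p (y - z) ≤ c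

variable {n : ℕ} {G : Ed n → Ed n → ℝ} {μ j : ℝ} {w : Ed n → ℝ}

theorem Reg.norm_le (hG : Reg G μ j) {p y : Ed n} (h : G p y < μ + 1) : ‖p‖ ≤ j := by
  by_contra! h'
  exact absurd (hG.coer p y h') (not_le.2 h)

theorem IsSub.le_norm (hG : Reg G μ j) (hw : IsSub G μ w) (y x : Ed n) :
    w y - w x ≤ j * ‖y - x‖ := by
  obtain ⟨⟨K, hK⟩, hw⟩ := hw
  refine lip_increment_le hK one_pos ?_
  filter_upwards [hw] with z hz _
  rw [← inner_gradient_left]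
  exact (real_inner_le_norm _ _).trans (by gcongr; exact hG.norm_le (y := z) (by linarith))

theorem lipschitz_of_le_norm (hj : 0 ≤ j) (h : ∀ y x, w y - w x ≤ j * ‖y - x‖) :
    LipschitzWith (Real.toNNReal j) w := by
  refine LipschitzWith.of_dist_le_mul fun x y => ?_
  rw [Real.dist_eq, dist_eq_norm, abs_le]
  have h1 := h x y
  have h2 := h y x
  rw [norm_sub_rev] at h2
  rw [Real.coe_toNNReal j hj]
  constructor <;> linarith

theorem IsSub.edge (hG : Reg G μ j) {δ r : ℝ} (hδ : 0 < δ)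
    (hr : ∀ p y z, ‖p‖ ≤ j → dist y z < r → |G p y - G p z| ≤ δ / 2)
    (hw : IsSub G μ w) {z y : Ed n} (hzy : dist y z < r) {c : ℝ} (hc : Edge G (μ + δ) z y c) :
    w y - w z ≤ c := by
  obtain ⟨⟨K, hK⟩, hw⟩ := hw
  refine lip_increment_le hK (r := r - dist y z) (by linarith) ?_
  filter_upwards [hw] with x hx ⟨s, hs, hsx⟩
  rw [← inner_gradient_left]
  have hp : ‖gradient w x‖ ≤ j := hG.norm_le (y := x) (by linarith)
  refine hc _ ?_
  have hd : dist x z < r := by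
    have h1 := dist_triangle x (z + s • (y - z)) z
    have h2 : dist (z + s • (y - z)) z ≤ dist y z := by
      rw [dist_eq_norm, dist_eq_norm, add_sub_cancel_left, norm_smul, Real.norm_eq_abs,
        abs_of_nonneg hs.1]
      exact mul_le_of_le_one_left (norm_nonneg _) hs.2
    linarith
  have := (abs_le.1 (hr _ x z hp hd)).1
  linarith

theorem isSub_of_edge (hG : Reg G μ j) {D : Set (Ed n)} (hD : Dense D)
    (hl : ∀ y x, w y - w x ≤ j * ‖y - x‖)
    (h : ∀ δ : ℝ, 0 < δ → ∃ r > (0 : ℝ), ∀ z ∈ D, ∀ y ∈ D, dist y z < r →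
      ∀ c, Edge G (μ + δ) z y c → w y - w z ≤ c) : IsSub G μ w := by
  have hL := lipschitz_of_le_norm hG.nonneg hl
  refine ⟨⟨_, hL⟩, ?_⟩
  filter_upwards [hL.ae_differentiableAt] with x hx
  by_contra! hlt
  set q := gradient w x with hq
  obtain ⟨δ, hδ0, hδ1, hδ⟩ : ∃ δ : ℝ, 0 < δ ∧ δ ≤ 1 / 2 ∧ μ + 2 * δ < G q x := by
    refine ⟨min (1 / 2) ((G q x - μ) / 4), lt_min (by norm_num) (by linarith), min_le_left _ _, ?_⟩
    have := min_le_right (1 / 2) ((G q x - μ) / 4)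
    linarith
  have hS1 : Convex ℝ {p | G p x ≤ μ + 2 * δ} := by
    simpa using (hG.conv x).convex_le (μ + 2 * δ)
  have hS2 : IsClosed {p | G p x ≤ μ + 2 * δ} := isClosed_le (hG.cont x) continuous_const
  obtain ⟨f, s, hf, hs⟩ := geometric_hahn_banach_closed_point hS1 hS2 (x := q)
    (by simpa using hδ)
  set v : Ed n := (InnerProductSpace.toDual ℝ (Ed n)).symm f with hv
  have hfv : ∀ p, f p = inner ℝ p v := fun p => by
    rw [real_inner_comm, hv, InnerProductSpace.toDual_symm_apply]
  obtain ⟨r, hr0, hr⟩ := h δ hδ0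
  obtain ⟨r', hr'0, hr'⟩ := hG.equi δ hδ0
  -- increments from `x` in the direction `v`
  have key : ∀ t : ℝ, 0 < t → t * ‖v‖ < r → w (x + t • v) - w x ≤ t * s := by
    intro t ht htv
    refine le_of_forall_pos_le_add fun e he => ?_
    set η := min (min (r' / 2) ((r - t * ‖v‖) / 4)) (e / (8 * (j + 1))) with hη
    have hj := hG.nonneg
    have hη0 : 0 < η := by
      refine lt_min (lt_min (by linarith) (by linarith)) (by positivity)
    have hη1 : η ≤ r' / 2 := (min_le_left _ _).trans (min_le_left _ _)
    have hη2 : η ≤ (r - t * ‖v‖) / 4 := (min_le_left _ _).trans (min_le_right _ _)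
    have hη3 : η * (8 * (j + 1)) ≤ e := by
      rw [← le_div_iff₀ (by positivity)]; exact min_le_right _ _
    obtain ⟨z, hzD, hz⟩ := hD.exists_dist_lt x hη0
    obtain ⟨y, hyD, hy⟩ := hD.exists_dist_lt (x + t • v) hη0
    rw [dist_comm, dist_eq_norm] at hz hy
    have hyz : y - z = t • v + ((y - (x + t • v)) - (z - x)) := by abel
    have hn : ‖(y - (x + t • v)) - (z - x)‖ ≤ 2 * η := (norm_sub_le _ _).trans (by linarith)
    have hdist : dist y z < r := by
      rw [dist_eq_norm, hyz]
      refine (norm_add_le _ _).trans_lt ?_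
      rw [norm_smul, Real.norm_eq_abs, abs_of_pos ht]
      linarith
    have hedge := hr z hzD y hyD hdist (t * s + j * (2 * η)) (by
      intro p hp
      have hpj : ‖p‖ ≤ j := hG.norm_le (y := z) (by linarith)
      have hpx : G p x ≤ μ + 2 * δ := by
        have := (abs_le.1 (hr' p x z hpj (by rw [dist_comm, dist_eq_norm]; linarith))).2
        linarith
      have h1 := (hf p hpx).le
      rw [hfv] at h1
      rw [hyz, inner_add_right, inner_smul_right]
      have h2 : inner ℝ p ((y - (x + t • v)) - (z - x)) ≤ j * (2 * η) :=
        (real_inner_le_norm _ _).trans (by gcongr)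
      have : t * inner ℝ p v ≤ t * s := by gcongr
      linarith)
    have h3 := hl (x + t • v) y
    have h4 := hl z x
    rw [norm_sub_rev] at h3
    have h5 : j * ‖y - (x + t • v)‖ ≤ j * η := by gcongr
    have h6 : j * ‖z - x‖ ≤ j * η := by gcongr
    nlinarith
  have hder : HasDerivAt (fun t : ℝ => w (x + t • v)) (fderiv ℝ w x v) 0 := by
    have h2 : HasDerivAt (fun t : ℝ => x + t • v) v 0 := by
      simpa using ((hasDerivAt_id (0 : ℝ)).smul_const v).const_add x
    have h3 : HasFDerivAt w (fderiv ℝ w x) (x + (0 : ℝ) • v) := by simpa using hx.hasFDerivAt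
    exact h3.comp_hasDerivAt 0 h2
  have hslope := hder.tendsto_slope_zero_right
  have hle : fderiv ℝ w x v ≤ s := by
    refine le_of_tendsto hslope ?_
    have hev : ∀ᶠ t : ℝ in nhdsWithin 0 (Ioi 0), t * ‖v‖ < r := by
      have : Tendsto (fun t : ℝ => t * ‖v‖) (nhdsWithin 0 (Ioi 0)) (nhds (0 * ‖v‖)) :=
        (tendsto_id.mul_const _).mono_left nhdsWithin_le_nhds
      rw [zero_mul] at this
      exact this.eventually_lt_const hr0
    filter_upwards [hev, self_mem_nhdsWithin] with t ht1 ht2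
    have := key t ht2 ht1
    simp only [zero_add, zero_smul, add_zero, smul_eq_mul]
    rw [inv_mul_le_iff₀ ht2]
    exact this
  rw [← inner_gradient_left, ← hq, ← hfv] at hle
  linarith

theorem met_bdd (hG : Reg G μ j) (y x : Ed n) :
    BddAbove {a | ∃ w, IsSub G μ w ∧ a = w y - w x} := by
  refine ⟨j * ‖y - x‖, ?_⟩
  rintro _ ⟨w, hw, rfl⟩
  exact hw.le_norm hG y x

theorem IsSub.le_met (hG : Reg G μ j) (hw : IsSub G μ w) (y x : Ed n) : w y - w x ≤ met G μ y x :=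
  le_csSup (met_bdd hG y x) ⟨w, hw, rfl⟩

theorem met_le (hne : ∃ w, IsSub G μ w) {y x : Ed n} {c : ℝ}
    (h : ∀ w, IsSub G μ w → w y - w x ≤ c) : met G μ y x ≤ c := by
  obtain ⟨w, hw⟩ := hne
  refine csSup_le ⟨_, w, hw, rfl⟩ ?_
  rintro _ ⟨w, hw, rfl⟩
  exact h w hw

theorem met_self (hne : ∃ w, IsSub G μ w) (x : Ed n) : met G μ x x = 0 := by
  obtain ⟨w, hw⟩ := hne
  have : {a | ∃ w, IsSub G μ w ∧ a = w x - w x} = {0} := by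
    ext a; constructor
    · rintro ⟨w, -, rfl⟩; simp
    · rintro rfl; exact ⟨w, hw, by simp⟩
  rw [met, this, csSup_singleton]

theorem met_le_norm (hG : Reg G μ j) (hne : ∃ w, IsSub G μ w) (y x : Ed n) :
    met G μ y x ≤ j * ‖y - x‖ := met_le hne fun _ hw => hw.le_norm hG y x

theorem met_triangle (hG : Reg G μ j) (hne : ∃ w, IsSub G μ w) (x y z : Ed n) :
    met G μ x z ≤ met G μ x y + met G μ y z := met_le hne fun w hw => by
  have h1 := hw.le_met hG x y
  have h2 := hw.le_met hG y z
  linarith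

theorem isSub_of_le_met (hG : Reg G μ j) (hne : ∃ w, IsSub G μ w)
    (h : ∀ y z, w y - w z ≤ met G μ y z) : IsSub G μ w := by
  refine isSub_of_edge hG dense_univ (fun y x => (h y x).trans (met_le_norm hG hne y x)) ?_
  intro δ hδ
  obtain ⟨r, hr0, hr⟩ := hG.equi (δ / 2) (by linarith)
  exact ⟨r, hr0, fun z _ y _ hzy c hc => (h y z).trans
    (met_le hne fun w hw => hw.edge hG hδ hr hzy hc)⟩

theorem isSub_met (hG : Reg G μ j) (hne : ∃ w, IsSub G μ w) (x : Ed n) :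
    IsSub G μ fun y => met G μ y x :=
  isSub_of_le_met hG hne fun y z => by
    have := met_triangle hG hne y z x
    linarith

end Subsolutions

/-- Comparison with the cones `c + m(·, x₀)` from above. -/
def CompCones {n : ℕ} (m : Ed n → Ed n → ℝ) (U : Set (Ed n)) (u : Ed n → ℝ) : Prop :=
  ∀ V : Set (Ed n), IsOpen V → IsCompact (closure V) → closure V ⊆ U → ∀ x₀ ∉ V, ∀ c : ℝ,
    (∀ x ∈ frontier V, u x ≤ c + m x x₀) → ∀ x ∈ V, u x ≤ c + m x x₀

theorem exists_mem_segment_frontier {E : Type*} [NormedAddCommGroup E] [NormedSpace ℝ E]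
    {W : Set E} {x y : E} (hx : x ∈ W) (hy : y ∉ W) : ∃ b ∈ segment ℝ x y, b ∈ frontier W := by
  by_contra! h
  have hs : IsPreconnected (segment ℝ x y) := (convex_segment x y).isPreconnected
  have hsub : segment ℝ x y ⊆ interior W ∪ interior Wᶜ := by
    intro b hb
    have := h b hb
    rw [frontier, Set.mem_sdiff, not_and_or, not_not] at this
    rcases this with h1 | h1
    · exact Or.inr (by rwa [interior_compl])
    · exact Or.inl h1
  have hx' : x ∈ interior W := by
    rcases hsub (left_mem_segment ℝ x y) with h1 | h1
    · exact h1
    · exact absurd hx (interior_subset h1)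
  have hy' : y ∈ interior Wᶜ := by
    rcases hsub (right_mem_segment ℝ x y) with h1 | h1
    · exact absurd (interior_subset h1) hy
    · exact h1
  obtain ⟨z, -, hz1, hz2⟩ := hs _ _ isOpen_interior isOpen_interior hsub
    ⟨x, left_mem_segment ℝ x y, hx'⟩ ⟨y, right_mem_segment ℝ x y, hy'⟩
  exact interior_subset hz2 (interior_subset hz1)

theorem lipschitz_of_zero_off {E : Type*} [NormedAddCommGroup E] [NormedSpace ℝ E] {W : Set E}
    (hW : IsOpen W) {f : E → ℝ} {K : ℝ≥0} (h0 : ∀ x ∉ W, f x = 0)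
    (hf : LipschitzOnWith K f (closure W)) : LipschitzWith K f := by
  have key : ∀ x y, x ∈ W → y ∉ W → dist (f x) (f y) ≤ K * dist x y := by
    intro x y hx hy
    obtain ⟨b, hb, hbW⟩ := exists_mem_segment_frontier hx hy
    have hbd : dist x b ≤ dist x y := by
      have := dist_add_dist_of_mem_segment hb
      have := dist_nonneg (x := b) (y := y)
      linarith
    have hbW' : b ∉ W := by rw [hW.frontier_eq] at hbW; exact hbW.2
    rw [h0 y hy, ← h0 b hbW']
    refine (hf.dist_le_mul x (subset_closure hx) b (frontier_subset_closure hbW)).trans ?_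
    gcongr
  refine LipschitzWith.of_dist_le_mul fun x y => ?_
  rcases em (x ∈ W) with hx | hx <;> rcases em (y ∈ W) with hy | hy
  · exact hf.dist_le_mul x (subset_closure hx) y (subset_closure hy)
  · exact key x y hx hy
  · rw [dist_comm, dist_comm x]; exact key y x hy hx
  · rw [h0 x hx, h0 y hy, dist_self]; positivity

theorem lipschitzOn_of_locLip {n : ℕ} {U V : Set (Ed n)} {u : Ed n → ℝ}
    (h : ∀ x ∈ U, ∃ K : ℝ≥0, ∃ t ∈ nhdsWithin x U, LipschitzOnWith K u t)
    (hV : IsCompact V) (hVU : V ⊆ U) : ∃ K : ℝ≥0, LipschitzOnWith K u V := by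
  refine LocallyLipschitzOn.exists_lipschitzOnWith_of_compact hV fun x hx => ?_
  obtain ⟨K, t, ht, hK⟩ := h x (hVU hx)
  exact ⟨K, t, nhdsWithin_mono x hVU ht, hK⟩

/-- On the frontier of a superlevel set of `f` inside `V`, `f` vanishes. -/
theorem eq_zero_on_frontier {E : Type*} [TopologicalSpace E] {V : Set E} {f : E → ℝ}
    (hV : IsOpen V) (hf : ContinuousOn f (closure V)) (hb : ∀ x ∈ frontier V, f x ≤ 0) :
    IsOpen {x ∈ V | 0 < f x} ∧ ∀ x ∈ frontier {x ∈ V | 0 < f x}, f x = 0 := by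
  have hW : IsOpen {x ∈ V | 0 < f x} :=
    (hf.mono subset_closure).isOpen_inter_preimage hV isOpen_Ioi
  refine ⟨hW, fun x hx => ?_⟩
  have hxc : x ∈ closure V := closure_mono (fun y hy => hy.1) (frontier_subset_closure hx)
  have hx' : x ∉ {x ∈ V | 0 < f x} := by rw [hW.frontier_eq] at hx; exact hx.2
  apply le_antisymm
  · rcases em (x ∈ V) with h | h
    · by_contra! h'; exact hx' ⟨h, h'⟩
    · exact hb x (by rw [hV.frontier_eq]; exact ⟨hxc, h⟩)
  · have hx2 := frontier_subset_closure hx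
    have hcw : ContinuousWithinAt f {x ∈ V | 0 < f x} x :=
      (hf x hxc).mono fun y hy => subset_closure hy.1
    have := hcw.mem_closure_image hx2
    exact closure_minimal (t := Ici (0:ℝ)) (by rintro _ ⟨y, hy, rfl⟩; exact hy.2.le) isClosed_Ici this

theorem AbsSubmin.compCones {n : ℕ} {G : Ed n → Ed n → ℝ} {μ j : ℝ} {U : Set (Ed n)}
    {u : Ed n → ℝ} (hu : AbsSubmin G U u) (hG : Reg G μ j) (hne : ∃ w, IsSub G μ w) :
    CompCones (met G μ) U u := by
  obtain ⟨hloc, hu⟩ := hu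
  intro V hV hVc hVU x₀ hx₀ c hb x₁ hx₁
  by_contra! hlt
  set φ : Ed n → ℝ := fun x => c + met G μ x x₀ with hφ
  obtain ⟨⟨Kφ, hKφ⟩, hφae⟩ := isSub_met hG hne x₀
  have hφL : LipschitzWith Kφ φ := by
    refine LipschitzWith.of_dist_le_mul fun x y => ?_
    simpa [hφ] using hKφ.dist_le_mul x y
  have hgφ : ∀ x, gradient φ x = gradient (fun y => met G μ y x₀) x := fun x => by
    simp only [gradient, hφ, fderiv_const_add]
  obtain ⟨Ku, hKu⟩ := lipschitzOn_of_locLip hloc hVc hVU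
  have hfL : LipschitzOnWith (Ku + Kφ) (fun x => u x - φ x) (closure V) := by
    refine LipschitzOnWith.of_dist_le_mul fun x hx y hy => ?_
    have h1 := hKu.dist_le_mul x hx y hy
    have h2 := hφL.dist_le_mul x y
    rw [Real.dist_eq] at *
    push_cast
    calc |u x - φ x - (u y - φ y)| = |(u x - u y) - (φ x - φ y)| := by congr 1; ring
      _ ≤ |u x - u y| + |φ x - φ y| := abs_sub _ _
      _ ≤ _ := by linarith
  obtain ⟨hW, hWf⟩ := eq_zero_on_frontier hV hfL.continuousOn
    (fun x hx => by have := hb x hx; simp only [hφ]; linarith)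
  set W := {x ∈ V | 0 < u x - φ x} with hWdef
  have hWV : W ⊆ V := fun x hx => hx.1
  have hWcl : closure W ⊆ closure V := closure_mono hWV
  have hWc : IsCompact (closure W) := hVc.of_isClosed_subset isClosed_closure hWcl
  have hess := hu W hW hWc (hWcl.trans hVU) φ ⟨Kφ, hφL.lipschitzOnWith⟩
    (fun x hx => by linarith [hx.2]) (fun x hx => by linarith [hWf x hx])
  have hessφ : essSup (fun x => ((G (gradient φ x) x : ℝ) : EReal)) (volume.restrict W) ≤
      (μ : EReal) := by
    refine essSup_le_of_ae_le _ (ae_restrict_of_ae ?_)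
    filter_upwards [hφae] with x hx
    rw [hgφ]; exact_mod_cast hx
  have huae : ∀ᵐ x ∂(volume : Measure (Ed n)), x ∈ W → G (gradient u x) x ≤ μ := by
    rw [← ae_restrict_iff' hW.measurableSet]
    filter_upwards [ae_le_essSup (f := fun x => ((G (gradient u x) x : ℝ) : EReal))
      (μ := volume.restrict W)] with x hx
    exact_mod_cast hx.trans (hess.trans hessφ)
  classical
  set ψ : Ed n → ℝ := fun x => if x ∈ W then u x - φ x else 0 with hψ
  have hψL : LipschitzWith (Ku + Kφ) ψ := by
    refine lipschitz_of_zero_off hW (fun x hx => if_neg hx) ?_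
    have hEq : ∀ x ∈ closure W, ψ x = u x - φ x := fun x hx => by
      simp only [hψ]
      split_ifs with h
      · rfl
      · exact (hWf x (by rw [hW.frontier_eq]; exact ⟨hx, h⟩)).symm
    refine LipschitzOnWith.of_dist_le_mul fun x hx y hy => ?_
    rw [hEq x hx, hEq y hy]
    exact hfL.dist_le_mul x (hWcl hx) y (hWcl hy)
  set v : Ed n → ℝ := fun x => ψ x + φ x with hv
  have hvL : LipschitzWith (Ku + Kφ + Kφ) v := hψL.add hφL
  have hvsub : IsSub G μ v := by
    refine ⟨⟨_, hvL⟩, ?_⟩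
    filter_upwards [huae, hφae, hψL.ae_differentiableAt, hφL.ae_differentiableAt] with
      x h1 h2 h3 h4
    rcases em (x ∈ W) with hx | hx
    · have : v =ᶠ[nhds x] u := by
        filter_upwards [hW.mem_nhds hx] with y hy
        simp [hv, hψ, hy]
      rw [this.gradient_eq]
      exact h1 hx
    · have hmin : IsLocalMin ψ x := by
        refine Eventually.of_forall fun y => ?_
        simp only [hψ, if_neg hx]
        split_ifs with h
        · exact h.2.le
        · exact le_rfl
      have : gradient v x = gradient φ x := by
        simp only [gradient, hv]
        rw [fderiv_fun_add h3 h4, hmin.fderiv_eq_zero, zero_add]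
      rw [this, hgφ]; exact h2
  have h1 := hvsub.le_met hG x₁ x₀
  have hx₁W : x₁ ∈ W := ⟨hx₁, by simp only [hφ]; linarith⟩
  have hx₀W : x₀ ∉ W := fun h => hx₀ h.1
  simp only [hv, hψ, if_pos hx₁W, if_neg hx₀W, hφ, met_self hne] at h1
  linarith

theorem gradient_neg' {n : ℕ} (u : Ed n → ℝ) (x : Ed n) :
    gradient (fun y => -u y) x = -gradient u x := by
  simp only [gradient, fderiv_fun_neg, map_neg]

theorem AbsSupermin.neg {n : ℕ} {G : Ed n → Ed n → ℝ} {U : Set (Ed n)}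
    {u : Ed n → ℝ} (hu : AbsSupermin G U u) :
    AbsSubmin (fun p x => G (-p) x) U (fun x => - u x) := by
  refine ⟨fun x hx => ?_, ?_⟩
  · obtain ⟨K, t, ht, h⟩ := hu.1 x hx
    exact ⟨K, t, ht, h.neg⟩
  · intro V hV hVc hVU v ⟨K, hK⟩ h1 h2
    have := hu.2 V hV hVc hVU (fun x => - v x) ⟨K, hK.neg⟩
      (fun x hx => by linarith [h1 x hx]) (fun x hx => by linarith [h2 x hx])
    simpa only [gradient_neg', neg_neg] using this

theorem absSupermin_of_neg {n : ℕ} {G : Ed n → Ed n → ℝ} {U : Set (Ed n)}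
    {u : Ed n → ℝ} (hu : AbsSubmin (fun p x => G (-p) x) U (fun x => - u x)) :
    AbsSupermin G U u := by
  refine ⟨fun x hx => ?_, ?_⟩
  · obtain ⟨K, t, ht, h⟩ := hu.1 x hx
    exact ⟨K, t, ht, by simpa only [Pi.neg_def, neg_neg] using h.neg⟩
  · intro V hV hVc hVU v ⟨K, hK⟩ h1 h2
    have := hu.2 V hV hVc hVU (fun x => - v x) ⟨K, hK.neg⟩
      (fun x hx => by linarith [h1 x hx]) (fun x hx => by linarith [h2 x hx])
    simpa only [gradient_neg', neg_neg] using this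

theorem isSub_reflect {n : ℕ} {G : Ed n → Ed n → ℝ} {μ : ℝ} {w : Ed n → ℝ} :
    IsSub (fun p x => G (-p) x) μ w ↔ IsSub G μ fun y => - w y := by
  simp only [IsSub, gradient_neg']
  refine and_congr_left' ⟨fun ⟨K, h⟩ => ⟨K, h.neg⟩, fun ⟨K, h⟩ => ⟨K, by simpa only [Pi.neg_def, neg_neg] using h.neg⟩⟩

theorem met_reflect {n : ℕ} (G : Ed n → Ed n → ℝ) (μ : ℝ) (y x : Ed n) :
    met (fun p x => G (-p) x) μ y x = met G μ x y := by
  unfold met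
  congr 1
  ext a
  constructor
  · rintro ⟨w, hw, rfl⟩
    exact ⟨_, isSub_reflect.1 hw, by ring⟩
  · rintro ⟨w, hw, rfl⟩
    exact ⟨fun y => - w y, isSub_reflect.2 (by simpa using hw), by ring⟩

theorem Reg.reflect {n : ℕ} {G : Ed n → Ed n → ℝ} {μ j : ℝ} (hG : Reg G μ j) :
    Reg (fun p x => G (-p) x) μ j where
  nonneg := hG.nonneg
  conv y := by
    have := (hG.conv y).comp_linearMap (-LinearMap.id : Ed n →ₗ[ℝ] Ed n)
    simpa [Function.comp_def] using this
  cont y := (hG.cont y).comp continuous_neg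
  coer p y h := hG.coer _ y (by simpa using h)
  equi δ hδ := by
    obtain ⟨r, h0, h⟩ := hG.equi δ hδ
    exact ⟨r, h0, fun p y z hp => h _ y z (by simpa using hp)⟩

section Discrete
variable {E : Type*} [AddCommGroup E]

/-- Values obtained by following admissible steps inside `W`, paying `l + θ` for each step, until
leaving `W`. -/
inductive Reach (J : Set (E × ℝ)) (W : Set E) (f : E → ℝ) (θ : ℝ) : E → ℝ → Prop
  | base (x : E) (hx : x ∉ W) : Reach J W f θ x (f x)
  | step (x q : E) (l a : ℝ) (hx : x ∈ W) (hq : (q, l) ∈ J) (h : Reach J W f θ (x + q) a) :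
      Reach J W f θ x (a - l - θ)

variable {J : Set (E × ℝ)} {D Dp : Set E} {f g : E → ℝ} {θ : ℝ}

theorem Reach.le {W : Set E} (hW : ∀ x ∈ W, ∀ q l, (q, l) ∈ J → f (x + q) - f x - l ≤ θ)
    {x : E} {a : ℝ} (h : Reach J W f θ x a) : a ≤ f x := by
  induction h with
  | base x hx => exact le_rfl
  | step x q l a hx hq h ih =>
    have := hW x hx q l hq
    linarith

/-- A discrete subsolution can be modified into a strict one at small cost. -/
theorem discrete_patch
    (hmax : ∀ x, ∃ q l, (q, l) ∈ J ∧ ∀ q' l', (q', l') ∈ J → f (x + q') - l' ≤ f (x + q) - l)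
    (hsub : ∀ x ∈ D, ∀ q l, (q, l) ∈ J → ∃ q' l', (q', l') ∈ J ∧
      f x - f (x - q) - l ≤ f (x + q') - f x - l')
    {e : E} {lp lm : ℝ} (hlp : (e, lp) ∈ J) (hlm : (-e, lm) ∈ J) (hl0 : 0 ≤ lp + lm)
    (hθ : 0 < θ) {N : ℕ} (hN : ∀ x, ∃ i ≤ N, x + i • e ∉ D) :
    ∃ f' : E → ℝ, (∀ x, f' x ≤ f x) ∧ (∀ x, f x - N * (2 * θ + lp + lm) ≤ f' x) ∧
      ∀ x ∈ D, ∀ q l, (q, l) ∈ J → ∀ η > (0 : ℝ), ∃ q' l', (q', l') ∈ J ∧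
        θ ≤ f' (x + q') - f' x - l' + η ∧
        f' x - f' (x - q) - l ≤ f' (x + q') - f' x - l' + η := by
  set W : Set E := {x | x ∈ D ∧ ∀ q l, (q, l) ∈ J → f (x + q) - f x - l < θ} with hWdef
  have hWle : ∀ x ∈ W, ∀ q l, (q, l) ∈ J → f (x + q) - f x - l ≤ θ :=
    fun x hx q l hq => (hx.2 q l hq).le
  set f' : E → ℝ := fun x => sSup {a | Reach J W f θ x a} with hf'
  have hbdd : ∀ x, BddAbove {a | Reach J W f θ x a} := fun x => ⟨f x, fun a ha => ha.le hWle⟩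
  have hwalk : ∀ (i : ℕ) (x : E), x + i • e ∉ D → ∃ a, Reach J W f θ x a ∧
      f x - i * (2 * θ + lp + lm) ≤ a := by
    intro i
    induction i with
    | zero =>
      intro x hx
      refine ⟨_, Reach.base x fun h => hx (by simpa using h.1), by simp⟩
    | succ i ih =>
      intro x hx
      by_cases hxW : x ∈ W
      · obtain ⟨a, ha, hle⟩ := ih (x + e) (by rwa [add_assoc, ← succ_nsmul'])
        refine ⟨_, Reach.step x e lp a hxW hlp ha, ?_⟩
        obtain ⟨q', l', hq', h1⟩ := hsub x hxW.1 (-e) lm hlm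
        have h2 := hxW.2 q' l' hq'
        rw [sub_neg_eq_add] at h1
        push_cast
        linarith
      · refine ⟨_, Reach.base x hxW, ?_⟩
        have : 0 ≤ ((i + 1 : ℕ) : ℝ) * (2 * θ + lp + lm) :=
          mul_nonneg (by positivity) (by linarith)
        linarith
  have hwalk' : ∀ x, ∃ a, Reach J W f θ x a ∧ f x - N * (2 * θ + lp + lm) ≤ a := by
    intro x
    obtain ⟨i, hi, hx⟩ := hN x
    obtain ⟨a, ha, hle⟩ := hwalk i x hx
    refine ⟨a, ha, le_trans ?_ hle⟩
    have : (i : ℝ) ≤ N := by exact_mod_cast hi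
    have : (i : ℝ) * (2 * θ + lp + lm) ≤ N * (2 * θ + lp + lm) :=
      mul_le_mul_of_nonneg_right this (by linarith)
    linarith
  have hle : ∀ x, f' x ≤ f x := fun x => by
    obtain ⟨a, ha, -⟩ := hwalk' x
    exact csSup_le ⟨a, ha⟩ fun b hb => Reach.le hWle hb
  have hA : ∀ x ∉ W, f' x = f x := fun x hx =>
    le_antisymm (hle x) (le_csSup (hbdd x) (Reach.base x hx))
  have hstep : ∀ x ∈ W, ∀ q l, (q, l) ∈ J → f' (x + q) - l - θ ≤ f' x := by
    intro x hx q l hq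
    have : f' (x + q) ≤ f' x + l + θ := by
      obtain ⟨a, ha, -⟩ := hwalk' (x + q)
      refine csSup_le ⟨a, ha⟩ fun b hb => ?_
      have := le_csSup (hbdd x) (Reach.step x q l b hx hq hb)
      change _ ≤ f' x at this
      linarith
    linarith
  have hatt : ∀ x ∈ W, ∀ η > (0 : ℝ), ∃ q l, (q, l) ∈ J ∧ f' x ≤ f' (x + q) - l - θ + η := by
    intro x hx η hη
    obtain ⟨a, ha, -⟩ := hwalk' x
    obtain ⟨b, hb, hlt⟩ := exists_lt_of_lt_csSup (s := {a | Reach J W f θ x a}) ⟨a, ha⟩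
      (show f' x - η < f' x by linarith)
    cases hb with
    | base _ h => exact absurd hx h
    | step _ q l a' _ hq h =>
      refine ⟨q, l, hq, ?_⟩
      have : a' ≤ f' (x + q) := le_csSup (hbdd _) h
      linarith
  refine ⟨f', hle, fun x => ?_, fun x hx q l hq η hη => ?_⟩
  · obtain ⟨a, ha, h⟩ := hwalk' x
    exact h.trans (le_csSup (hbdd x) ha)
  have hback : x - q ∈ W → f' x - f' (x - q) - l ≤ θ := fun h => by
    have := hstep _ h q l hq
    rw [sub_add_cancel] at this
    linarith
  by_cases hxW : x ∈ W
  · obtain ⟨q', l', hq', h⟩ := hatt x hxW η hη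
    refine ⟨q', l', hq', by linarith, ?_⟩
    refine le_trans ?_ (show θ ≤ _ by linarith)
    by_cases hy : x - q ∈ W
    · exact hback hy
    · rw [hA _ hy]
      obtain ⟨q₂, l₂, hq₂, h1⟩ := hsub x hx q l hq
      have := hxW.2 q₂ l₂ hq₂
      have := hle x
      linarith
  · obtain ⟨q', l', hq', h⟩ := hmax x
    have hS : θ ≤ f (x + q') - f x - l' := by
      have : ¬ ∀ q l, (q, l) ∈ J → f (x + q) - f x - l < θ := fun h => hxW ⟨hx, h⟩
      push Not at this
      obtain ⟨q₂, l₂, hq₂, h2⟩ := this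
      have := h q₂ l₂ hq₂
      linarith
    have hx' : x + q' ∉ W := fun hW => by
      obtain ⟨q₂, l₂, hq₂, h2⟩ := hsub _ hW.1 q' l' hq'
      have h3 := hW.2 q₂ l₂ hq₂
      rw [add_sub_cancel_right] at h2
      linarith
    refine ⟨q', l', hq', ?_, ?_⟩
    · rw [hA _ hx', hA _ hxW]; linarith
    · rw [hA _ hx']
      by_cases hy : x - q ∈ W
      · have := hback hy
        rw [hA _ hxW] at this ⊢
        linarith
      · rw [hA _ hy, hA _ hxW]
        obtain ⟨q₂, l₂, hq₂, h1⟩ := hsub x hx q l hq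
        have := h q₂ l₂ hq₂
        linarith

/-- Discrete comparison principle for a strict subsolution. -/
theorem discrete_comparison_strict {B M₀ : ℝ} (hfB : ∀ x, |f x| ≤ B) (hgB : ∀ x, |g x| ≤ B)
    (hJ : ∀ q l, (q, l) ∈ J → 0 ≤ l)
    (hDp : ∀ x ∈ D, ∀ q l, (q, l) ∈ J → x + q ∈ Dp ∧ x - q ∈ Dp) (hθ : 0 < θ)
    (hf : ∀ x ∈ D, ∀ q l, (q, l) ∈ J → ∀ η > (0 : ℝ), ∃ q' l', (q', l') ∈ J ∧
        θ ≤ f (x + q') - f x - l' + η ∧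
        f x - f (x - q) - l ≤ f (x + q') - f x - l' + η)
    (hg : ∀ x ∈ D, ∃ q l, (q, l) ∈ J ∧ ∀ q' l', (q', l') ∈ J →
        g (x + q') - g x - l' ≤ g x - g (x - q) - l)
    (hb : ∀ x ∈ Dp, x ∉ D → f x - g x ≤ M₀) : ∀ x ∈ Dp, f x - g x ≤ M₀ := by
  intro x₁ hx₁
  by_contra! hlt
  set S : Set ℝ := (fun x => f x - g x) '' Dp with hS
  have hSb : BddAbove S := by
    refine ⟨2 * B, ?_⟩
    rintro _ ⟨x, -, rfl⟩
    have h1 := abs_le.1 (hfB x)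
    have h2 := abs_le.1 (hgB x)
    simp only
    linarith
  set M := sSup S with hM
  have hMlt : M₀ < M := hlt.trans_le (le_csSup hSb ⟨x₁, hx₁, rfl⟩)
  have hleM : ∀ x ∈ Dp, f x - g x ≤ M := fun x hx => le_csSup hSb ⟨x, hx, rfl⟩
  obtain ⟨N, hN⟩ := exists_nat_gt ((2 * B) / (θ / 2))
  rw [div_lt_iff₀ (by linarith)] at hN
  set η₀ : ℝ := min (θ / 2) ((M - M₀) / 2) / 4 ^ N with hη₀
  have hmpos : 0 < min (θ / 2) ((M - M₀) / 2) := lt_min (by linarith) (by linarith)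
  have hη₀pos : 0 < η₀ := by positivity
  have hηN : ∀ i ≤ N, 4 ^ i * η₀ ≤ min (θ / 2) ((M - M₀) / 2) := by
    intro i hi
    rw [hη₀, mul_div_assoc', div_le_iff₀ (by positivity), mul_comm]
    gcongr
    norm_num
  obtain ⟨_, ⟨x₀, hx₀, rfl⟩, hx₀M⟩ := exists_lt_of_lt_csSup (s := S) ⟨_, x₁, hx₁, rfl⟩
    (show M - η₀ < M by linarith)
  have hchain : ∀ i ≤ N, ∃ x ∈ Dp, M - 4 ^ i * η₀ ≤ f x - g x ∧ f x₀ + i * (θ / 2) ≤ f x := by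
    intro i
    induction i with
    | zero => exact fun _ => ⟨x₀, hx₀, by simpa using hx₀M.le, by simp⟩
    | succ i ih =>
      intro hi
      obtain ⟨x, hx, h1, h2⟩ := ih (by omega)
      have hi' := hηN i (by omega)
      have hiθ := hi'.trans (min_le_left _ _)
      have hiM := hi'.trans (min_le_right _ _)
      have hpos : 0 < 4 ^ i * η₀ := by positivity
      have hxD : x ∈ D := by
        by_contra hxD
        have := hb x hx hxD
        linarith
      obtain ⟨q, l, hq, h3⟩ := hg x hxD
      obtain ⟨q', l', hq', h4, h5⟩ := hf x hxD q l hq (4 ^ i * η₀) hpos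
      have h6 := h3 q' l' hq'
      have h7 := hleM _ (hDp x hxD q l hq).2
      have h8 := hJ q' l' hq'
      refine ⟨x + q', (hDp x hxD q' l' hq').1, ?_, ?_⟩
      · rw [pow_succ]; linarith
      · push_cast; linarith
  obtain ⟨x, -, -, h⟩ := hchain N le_rfl
  have h1 := abs_le.1 (hfB x)
  have h2 := abs_le.1 (hfB x₀)
  linarith

theorem discrete_comparison {B M₀ : ℝ} (hfB : ∀ x, |f x| ≤ B) (hgB : ∀ x, |g x| ≤ B)
    (hJ : ∀ q l, (q, l) ∈ J → 0 ≤ l)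
    (hDp : ∀ x ∈ D, ∀ q l, (q, l) ∈ J → x + q ∈ Dp ∧ x - q ∈ Dp)
    (hmax : ∀ x, ∃ q l, (q, l) ∈ J ∧ ∀ q' l', (q', l') ∈ J → f (x + q') - l' ≤ f (x + q) - l)
    (hsub : ∀ x ∈ D, ∀ q l, (q, l) ∈ J → ∃ q' l', (q', l') ∈ J ∧
      f x - f (x - q) - l ≤ f (x + q') - f x - l')
    (hg : ∀ x ∈ D, ∃ q l, (q, l) ∈ J ∧ ∀ q' l', (q', l') ∈ J →
        g (x + q') - g x - l' ≤ g x - g (x - q) - l)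
    {e : E} {lp lm : ℝ} (hlp : (e, lp) ∈ J) (hlm : (-e, lm) ∈ J)
    (hθ : 0 < θ) {N : ℕ} (hN : ∀ x, ∃ i ≤ N, x + i • e ∉ D)
    (hb : ∀ x ∈ Dp, x ∉ D → f x - g x ≤ M₀) :
    ∀ x ∈ Dp, f x - g x ≤ M₀ + N * (2 * θ + lp + lm) := by
  have hl0 : 0 ≤ lp + lm := add_nonneg (hJ _ _ hlp) (hJ _ _ hlm)
  obtain ⟨f', h1, h2, h3⟩ := discrete_patch hmax hsub hlp hlm hl0 hθ hN
  have hC : 0 ≤ N * (2 * θ + lp + lm) := mul_nonneg (by positivity) (by linarith)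
  intro x hx
  have := discrete_comparison_strict (B := B + N * (2 * θ + lp + lm)) (M₀ := M₀) (f := f')
    (g := g) (fun x => by
      have := abs_le.1 (hfB x)
      rw [abs_le]; constructor <;> linarith [h1 x, h2 x])
    (fun x => (hgB x).trans (by linarith)) hJ hDp hθ h3 hg
    (fun x hx hxD => by linarith [hb x hx hxD, h1 x]) x hx
  linarith [h2 x]
end Discrete

/-- Support function of the sublevel set `{h ≤ k}`. -/
def supp {n : ℕ} (h : Ed n → ℝ) (k : ℝ) (v : Ed n) : ℝ := sSup {a | ∃ p, h p ≤ k ∧ a = inner ℝ p v}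

section Supp
variable {n : ℕ} {h : Ed n → ℝ} {k R : ℝ}

theorem le_supp (hR : ∀ p, h p ≤ k → ‖p‖ ≤ R) {p : Ed n} (hp : h p ≤ k) (v : Ed n) :
    inner ℝ p v ≤ supp h k v := by
  refine le_csSup ⟨R * ‖v‖, ?_⟩ ⟨p, hp, rfl⟩
  rintro _ ⟨p, hp, rfl⟩
  exact (real_inner_le_norm p v).trans (by gcongr; exact hR p hp)

theorem supp_le (hne : ∃ p, h p ≤ k) {v : Ed n} {c : ℝ} (hc : ∀ p, h p ≤ k → inner ℝ p v ≤ c) :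
    supp h k v ≤ c := by
  obtain ⟨p, hp⟩ := hne
  refine csSup_le ⟨_, p, hp, rfl⟩ ?_
  rintro _ ⟨p, hp, rfl⟩
  exact hc p hp

theorem supp_le_norm (hne : ∃ p, h p ≤ k) (hR : ∀ p, h p ≤ k → ‖p‖ ≤ R) (v : Ed n) :
    supp h k v ≤ R * ‖v‖ := supp_le hne fun p hp =>
  (real_inner_le_norm p v).trans (by gcongr; exact hR p hp)

theorem supp_add_le (hne : ∃ p, h p ≤ k) (hR : ∀ p, h p ≤ k → ‖p‖ ≤ R) (v v' : Ed n) :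
    supp h k (v + v') ≤ supp h k v + supp h k v' := supp_le hne fun p hp => by
  rw [inner_add_right]
  exact add_le_add (le_supp hR hp v) (le_supp hR hp v')

theorem supp_zero (hne : ∃ p, h p ≤ k) (hR : ∀ p, h p ≤ k → ‖p‖ ≤ R) : supp h k (0 : Ed n) = 0 := by
  obtain ⟨p, hp⟩ := hne
  refine le_antisymm (supp_le ⟨p, hp⟩ fun p hp => by simp) ?_
  simpa using le_supp hR hp 0

theorem supp_smul (hne : ∃ p, h p ≤ k) (hR : ∀ p, h p ≤ k → ‖p‖ ≤ R) {t : ℝ} (ht : 0 ≤ t)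
    (v : Ed n) : supp h k (t • v) = t * supp h k v := by
  rcases ht.eq_or_lt with rfl | ht
  · simp [supp_zero hne hR]
  refine le_antisymm (supp_le hne fun p hp => ?_) ?_
  · rw [inner_smul_right]; gcongr; exact le_supp hR hp v
  · rw [← le_div_iff₀' ht]
    refine supp_le hne fun p hp => ?_
    rw [le_div_iff₀' ht, ← inner_smul_right]
    exact le_supp hR hp _

theorem supp_continuous (hne : ∃ p, h p ≤ k) (hR : ∀ p, h p ≤ k → ‖p‖ ≤ R) :
    Continuous (supp h k) := by
  have hR0 : 0 ≤ R := by
    obtain ⟨p, hp⟩ := hne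
    exact (norm_nonneg p).trans (hR p hp)
  refine (lipschitz_of_le_norm hR0 fun y x => ?_).continuous
  have h1 := supp_add_le hne hR x (y - x)
  rw [add_sub_cancel] at h1
  have h2 := supp_le_norm hne hR (y - x)
  linarith

theorem supp_mono {k' : ℝ} (hkk : k ≤ k') (hne : ∃ p, h p ≤ k) (hR : ∀ p, h p ≤ k' → ‖p‖ ≤ R)
    (v : Ed n) : supp h k v ≤ supp h k' v :=
  supp_le hne fun _ hp => le_supp hR (hp.trans hkk) v

end Supp

/-- Normalised effective Hamiltonians. -/
structure Ham {n : ℕ} (h : Ed n → ℝ) : Prop where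
  conv : ConvexOn ℝ univ h
  cont : Continuous h
  coer : ∀ C : ℝ, ∃ R : ℝ, ∀ p, h p ≤ C → ‖p‖ ≤ R
  zero : h 0 = 0
  nonneg : ∀ p, 0 ≤ h p

/-- Steps of the discrete Hopf–Lax operator. -/
def Jset {n : ℕ} (h : Ed n → ℝ) (R L t : ℝ) : Set (Ed n × ℝ) :=
  {z | ‖z.1‖ ≤ t * R ∧ z.2 ≤ t * L ∧ ∀ p, inner ℝ p z.1 ≤ t * h p + z.2}

section Conv
variable {n : ℕ} {h : Ed n → ℝ}

theorem Ham.exists_level (hh : Ham h) {k : ℝ} {p d : Ed n} (hp : h p < k) (hd : d ≠ 0) :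
    ∃ s : ℝ, 0 < s ∧ h (p + s • d) = k := by
  obtain ⟨R, hR⟩ := hh.coer k
  have hd' : 0 < ‖d‖ := norm_pos_iff.2 hd
  set T : ℝ := (|R| + ‖p‖ + 1) / ‖d‖ with hT
  have hT0 : 0 ≤ T := by positivity
  have hTk : k ≤ h (p + T • d) := by
    by_contra! hlt
    have h1 := hR _ hlt.le
    have h2 : ‖T • d‖ = |R| + ‖p‖ + 1 := by
      rw [norm_smul, Real.norm_eq_abs, abs_of_nonneg hT0, hT, div_mul_cancel₀ _ hd'.ne']
    have h3 := norm_sub_le (p + T • d) p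
    rw [add_sub_cancel_left] at h3
    have := le_abs_self R
    linarith
  have hc : ContinuousOn (fun s : ℝ => h (p + s • d)) (Icc 0 T) :=
    (hh.cont.comp (by fun_prop)).continuousOn
  obtain ⟨s, hs, hsk⟩ := intermediate_value_Icc hT0 hc ⟨by simpa using hp.le, hTk⟩
  refine ⟨s, lt_of_le_of_ne hs.1 ?_, hsk⟩
  rintro rfl
  simp at hsk
  linarith

variable {U : Set (Ed n)} {u : Ed n → ℝ} {k t R L Λ : ℝ} {x : Ed n}

theorem Ham.conv_core (hh : Ham h) (hu : CompCones (fun y x => supp h k (y - x)) U u)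
    (huc : ContinuousOn u U) (hk : 0 < k) (ht : 0 < t) (hxU : closedBall x (t * R) ⊆ U)
    (hΛR : Λ < R)
    (hΛ : ∀ p p', h p ≤ k → h p' ≤ k → h p' - h p ≤ Λ * ‖p' - p‖)
    (hL : ∀ p, h p ≤ k → ‖p‖ * R ≤ L)
    (hyp : ∀ q l, (q, l) ∈ Jset h R L t → u (x + q) - u x ≤ t * k + l) {z : Ed n}
    (hz : dist z x < t * R) : u z - u x ≤ supp h k (z - x) ∨
      ∀ p, h p < k → inner ℝ p (z - x) + t * (k - h p) ≤ supp h k (z - x) := by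
  obtain ⟨Rk, hRk⟩ := hh.coer k
  have hne : ∃ p, h p ≤ k := ⟨0, by rw [hh.zero]; exact hk.le⟩
  have hsc := supp_continuous hne hRk
  by_contra! hcon
  obtain ⟨hz1, p₀, hp₀, hz2⟩ := hcon
  set A : Set (Ed n) := {z | ∃ p, h p < k ∧ supp h k (z - x) < inner ℝ p (z - x) + t * (k - h p)}
    with hA
  have hAo : IsOpen A := by
    have : A = ⋃ p ∈ {p | h p < k}, {z | supp h k (z - x) < inner ℝ p (z - x) + t * (k - h p)} := by
      ext z; simp [hA]
    rw [this]
    refine isOpen_biUnion fun p _ => isOpen_lt (hsc.comp (by fun_prop)) (by fun_prop)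
  have hbU : ball x (t * R) ⊆ U := ball_subset_closedBall.trans hxU
  set V : Set (Ed n) := (ball x (t * R) ∩ {z | 0 < u z - u x - supp h k (z - x)}) ∩ A with hV
  have hVo : IsOpen V := by
    refine IsOpen.inter ?_ hAo
    refine ContinuousOn.isOpen_inter_preimage ?_ isOpen_ball isOpen_Ioi
    exact ((huc.mono hbU).sub continuousOn_const).sub
      ((hsc.comp (by fun_prop : Continuous fun z => z - x)).continuousOn)
  have hVΛ : V ⊆ closedBall x (t * Λ) := by
    rintro z ⟨⟨-, hzV⟩, p, hp, hlt⟩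
    rw [mem_closedBall, dist_eq_norm]
    rcases eq_or_ne (z - x) 0 with h0 | h0
    · exfalso
      have hx' : z = x := sub_eq_zero.1 h0
      simp only [Set.mem_ofPred_eq, hx', sub_self, supp_zero hne hRk] at hzV
      exact lt_irrefl _ hzV
    · obtain ⟨s, hs0, hs⟩ := hh.exists_level hp h0
      have h1 := le_supp hRk hs.le (z - x)
      have h2 := hΛ p _ hp.le hs.le
      rw [add_sub_cancel_left, norm_smul, Real.norm_eq_abs, abs_of_pos hs0, hs] at h2
      rw [inner_add_left, inner_smul_left, real_inner_self_eq_norm_sq] at h1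
      simp only [conj_trivial] at h1
      have h3 : t * (k - h p) ≤ t * (Λ * (s * ‖z - x‖)) := by gcongr
      have hpos : 0 < s * ‖z - x‖ := mul_pos hs0 (norm_pos_iff.2 h0)
      have h4 : (s * ‖z - x‖) * ‖z - x‖ ≤ (s * ‖z - x‖) * (t * Λ) := by nlinarith
      exact le_of_mul_le_mul_left h4 hpos
  have hclV : closure V ⊆ closedBall x (t * Λ) := closure_minimal hVΛ isClosed_closedBall
  have hclU : closure V ⊆ U := hclV.trans ((closedBall_subset_closedBall (by gcongr)).trans hxU)
  have hVc : IsCompact (closure V) :=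
    (isCompact_closedBall _ _).of_isClosed_subset isClosed_closure hclV
  have hxV : x ∉ V := fun hx => by
    have := hx.1.2
    simp [supp_zero hne hRk] at this
  have hzV : z ∈ V := ⟨⟨hz, by simp only [Set.mem_ofPred_eq]; linarith⟩, p₀, hp₀, hz2⟩
  have hfin := hu V hVo hVc hclU x hxV (u x) ?_ z hzV
  · linarith
  intro y hy
  by_contra! hlt
  have hyV : y ∉ V := by rw [hVo.frontier_eq] at hy; exact hy.2
  have hycl := frontier_subset_closure hy
  have hyΛ : dist y x ≤ t * Λ := hclV hycl
  have hyR : dist y x < t * R := hyΛ.trans_lt (by gcongr)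
  have hyA : ∀ p, h p < k → inner ℝ p (y - x) + t * (k - h p) ≤ supp h k (y - x) := by
    by_contra! hcon
    exact hyV ⟨⟨hyR, by simp only [Set.mem_ofPred_eq]; linarith⟩, hcon⟩
  have hJ : (y - x, supp h k (y - x) - t * k) ∈ Jset h R L t := by
    refine ⟨by rw [← dist_eq_norm]; exact hyR.le, ?_, fun p => ?_⟩
    · have : supp h k (y - x) ≤ t * L := supp_le hne fun p hp => by
        refine (real_inner_le_norm _ _).trans ?_
        rw [← dist_eq_norm]
        calc ‖p‖ * dist y x ≤ ‖p‖ * (t * R) := by gcongr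
          _ = t * (‖p‖ * R) := by ring
          _ ≤ t * L := by gcongr; exact hL p hp
      simp only
      nlinarith
    · rcases lt_or_ge (h p) k with hpk | hpk
      · have := hyA p hpk
        simp only; linarith
      · by_contra! hcon
        simp only at hcon
        have hO : IsOpen {z | supp h k (z - x) < inner ℝ p (z - x) + t * (k - h p)} :=
          isOpen_lt (hsc.comp (by fun_prop)) (by fun_prop)
        obtain ⟨y', hy'1, hy'2, p', hp', hy'3⟩ := mem_closure_iff.1 hycl _ hO (by
          simp only [Set.mem_ofPred_eq]; linarith)
        simp only [Set.mem_ofPred_eq] at hy'1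
        have hc : ContinuousOn (fun s : ℝ => h ((1 - s) • p' + s • p)) (Icc 0 1) :=
          (hh.cont.comp (by fun_prop)).continuousOn
        obtain ⟨s, hs, hsk⟩ := intermediate_value_Icc zero_le_one hc
          ⟨by simpa using hp'.le, by simpa using hpk⟩
        simp only at hsk
        have h1 := hh.conv.2 (mem_univ p') (mem_univ p) (sub_nonneg.2 hs.2) hs.1 (by ring)
        have h2 := le_supp hRk hsk.le (y' - x)
        rw [inner_add_left, inner_smul_left, inner_smul_left] at h2
        simp only [conj_trivial, smul_eq_mul, hsk] at h1 h2
        have hs0 := hs.1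
        have hs1 := sub_nonneg.2 hs.2
        have e1 : (1 - s) * supp h k (y' - x) + s * supp h k (y' - x) <
            (1 - s) * (inner ℝ p' (y' - x) + t * (k - h p')) +
            s * (inner ℝ p (y' - x) + t * (k - h p)) := by
          rcases hs0.eq_or_lt with h0 | h0
          · rw [← h0]; simpa using hy'3
          · exact add_lt_add_of_le_of_lt (by gcongr) (by gcongr)
        have e2 : t * (((1 - s) * (k - h p')) + s * (k - h p)) ≤ 0 := by
          have : ((1 - s) * (k - h p')) + s * (k - h p) ≤ 0 := by linarith
          exact mul_nonpos_of_nonneg_of_nonpos ht.le this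
        linarith
  have := hyp _ _ hJ
  rw [add_sub_cancel] at this
  linarith

theorem Ham.conv_scale (hh : Ham h) (hu : CompCones (fun y x => supp h k (y - x)) U u)
    (huc : ContinuousOn u U) (hk : 0 < k) (ht : 0 < t) (hxU : closedBall x (t * R) ⊆ U)
    (hR : 0 < R) (hΛR : Λ < R)
    (hΛ : ∀ p p', h p ≤ k → h p' ≤ k → h p' - h p ≤ Λ * ‖p' - p‖)
    (hL : ∀ p, h p ≤ k → ‖p‖ * R ≤ L)
    (hyp : ∀ q l, (q, l) ∈ Jset h R L t → u (x + q) - u x ≤ t * k + l)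
    {s : ℝ} (hs : 0 < s) (hst : s < t) {q : Ed n} {l : ℝ} (hq : (q, l) ∈ Jset h R L s) :
    u (x + q) - u x ≤ s * k + l := by
  obtain ⟨Rk, hRk⟩ := hh.coer k
  have hne : ∃ p, h p ≤ k := ⟨0, by rw [hh.zero]; exact hk.le⟩
  obtain ⟨hq1, hq2, hq3⟩ := hq
  simp only at hq1 hq2 hq3
  have hsup : supp h k q ≤ s * k + l := supp_le hne fun p hp =>
    (hq3 p).trans (by gcongr)
  have hL0 : 0 ≤ L := by simpa using hL 0 (by rw [hh.zero]; exact hk.le)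
  have hdist : dist (x + q) x < t * R := by
    rw [dist_eq_norm, add_sub_cancel_left]
    exact hq1.trans_lt (by gcongr)
  rcases hh.conv_core hu huc hk ht hxU hΛR hΛ hL hyp hdist with h1 | h1
  · rw [add_sub_cancel_left] at h1
    linarith
  · rw [add_sub_cancel_left] at h1
    have hJ : (q, s * k + l - t * k) ∈ Jset h R L t := by
      refine ⟨hq1.trans (by gcongr), ?_, fun p => ?_⟩
      · simp only; nlinarith
      · simp only
        rcases lt_or_ge (h p) k with hpk | hpk
        · have := h1 p hpk
          linarith
        · have := hq3 p
          nlinarith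
    have := hyp _ _ hJ
    linarith
end Conv

theorem Ham.reflect {n : ℕ} {h : Ed n → ℝ} (hh : Ham h) : Ham fun p => h (-p) where
  conv := by
    have := hh.conv.comp_linearMap (-LinearMap.id : Ed n →ₗ[ℝ] Ed n)
    simpa [Function.comp_def] using this
  cont := hh.cont.comp continuous_neg
  coer C := by
    obtain ⟨R, hR⟩ := hh.coer C
    exact ⟨R, fun p hp => by simpa using hR _ hp⟩
  zero := by simpa using hh.zero
  nonneg p := hh.nonneg _

theorem mem_Jset_reflect {n : ℕ} {h : Ed n → ℝ} {R L t : ℝ} {q : Ed n} {l : ℝ} :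
    (q, l) ∈ Jset (fun p => h (-p)) R L t ↔ (-q, l) ∈ Jset h R L t := by
  simp only [Jset, Set.mem_ofPred_eq, norm_neg]
  refine and_congr_right' (and_congr_right' ⟨fun H p => ?_, fun H p => ?_⟩)
  · simpa using H (-p)
  · simpa using H (-p)

/-- A direction along which the Legendre transform is sublinear at the origin. -/
theorem Ham.exists_flat_direction {n : ℕ} {h : Ed n → ℝ} (hh : Ham h)
    (hflat : interior {p | h p ≤ 0} = ∅) :
    ∃ e : Ed n, ‖e‖ = 1 ∧ ∀ κ > (0 : ℝ), ∃ σ₀ > (0 : ℝ), ∀ σ, 0 < σ → σ ≤ σ₀ →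
      ∀ p, σ * |inner ℝ p e| ≤ h p + κ * σ := by
  have hF : Convex ℝ {p | h p ≤ 0} := by simpa using hh.conv.convex_le 0
  have h0 : (0 : Ed n) ∈ {p | h p ≤ 0} := hh.zero.le
  have hspan : vectorSpan ℝ {p | h p ≤ 0} ≠ ⊤ := by
    intro htop
    rw [← AffineSubspace.affineSpan_eq_top_iff_vectorSpan_eq_top_of_nonempty _ _ _ ⟨0, h0⟩,
      ← hF.interior_nonempty_iff_affineSpan_eq_top, hflat] at htop
    exact Set.not_nonempty_empty htop
  obtain ⟨e', he', hne⟩ := Submodule.exists_mem_ne_zero_of_ne_bot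
    (fun hb => hspan ((Submodule.orthogonal_eq_bot_iff).1 hb))
  refine ⟨‖e'‖⁻¹ • e', norm_smul_inv_norm hne, fun κ hκ => ?_⟩
  set e := ‖e'‖⁻¹ • e' with he
  have hort : ∀ p, h p ≤ 0 → inner ℝ p e = 0 := by
    intro p hp
    rw [he, inner_smul_right]
    have : inner ℝ p e' = 0 := he' p (by
      have := vsub_mem_vectorSpan ℝ (s := {p | h p ≤ 0}) hp h0
      simpa using this)
    rw [this, mul_zero]
  obtain ⟨δ, hδ0, hδ⟩ : ∃ δ > (0 : ℝ), ∀ p, h p ≤ δ → |inner ℝ p e| ≤ κ := by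
    obtain ⟨R, hR⟩ := hh.coer 1
    set S : Set (Ed n) := closedBall 0 R ∩ {p | κ ≤ |inner ℝ p e|} with hS
    have hSc : IsCompact S := (isCompact_closedBall _ _).inter_right
      (isClosed_le continuous_const (by fun_prop))
    rcases S.eq_empty_or_nonempty with hE | hE
    · refine ⟨1, one_pos, fun p hp => ?_⟩
      by_contra! hlt
      have : p ∈ S := ⟨by simpa using hR p hp, hlt.le⟩
      rw [hE] at this
      exact this
    · obtain ⟨p₀, hp₀, hmin⟩ := hSc.exists_isMinOn hE hh.cont.continuousOn
      have hpos : 0 < h p₀ := by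
        by_contra! hle
        have h1 := hort p₀ hle
        have h2 : κ ≤ |inner ℝ p₀ e| := hp₀.2
        rw [h1, abs_zero] at h2
        linarith
      refine ⟨min 1 (h p₀ / 2), lt_min one_pos (by linarith), fun p hp => ?_⟩
      by_contra! hlt
      have : p ∈ S := ⟨by simpa using hR p (hp.trans (min_le_left _ _)), hlt.le⟩
      have h1 : h p₀ ≤ h p := hmin this
      have := hp.trans (min_le_right _ _)
      linarith
  refine ⟨δ / κ, by positivity, fun σ hσ hσle p => ?_⟩
  rw [le_div_iff₀ hκ] at hσle
  rcases le_or_gt (h p) δ with hp | hp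
  · have := mul_le_mul_of_nonneg_left (hδ p hp) hσ.le
    linarith [hh.nonneg p]
  · have hp0 : 0 < h p := hδ0.trans hp
    have hs1 : δ / h p ≤ 1 := (div_le_one hp0).2 hp.le
    have hs0 : 0 < δ / h p := by positivity
    have hc := hh.conv.2 (mem_univ (0 : Ed n)) (mem_univ p) (sub_nonneg.2 hs1) hs0.le (by ring)
    rw [smul_zero, zero_add, hh.zero, smul_zero, zero_add, smul_eq_mul,
      div_mul_cancel₀ _ hp0.ne'] at hc
    have h1 := hδ _ hc
    rw [inner_smul_left, abs_mul] at h1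
    simp only [conj_trivial, abs_of_pos hs0] at h1
    rw [div_mul_eq_mul_div, div_le_iff₀ hp0] at h1
    have h2 : δ * (σ * |inner ℝ p e|) ≤ δ * h p := by nlinarith
    have := le_of_mul_le_mul_left h2 hδ0
    nlinarith

/-- The discrete Hopf–Lax operator. -/
def hopfLax {n : ℕ} (J : Set (Ed n × ℝ)) (f : Ed n → ℝ) (x : Ed n) : ℝ :=
  sSup ((fun z : Ed n × ℝ => f (x + z.1) - z.2) '' J)

section HL
variable {n : ℕ} {h : Ed n → ℝ} {R L t : ℝ}

theorem Ham.Jset_compact (hh : Ham h) : IsCompact (Jset h R L t) := by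
  have hsub : Jset h R L t ⊆ closedBall 0 (t * R) ×ˢ Icc 0 (t * L) := by
    rintro ⟨q, l⟩ ⟨h1, h2, h3⟩
    refine ⟨by simpa using h1, ?_, h2⟩
    simpa [hh.zero] using h3 0
  refine ((isCompact_closedBall _ _).prod isCompact_Icc).of_isClosed_subset ?_ hsub
  have : Jset h R L t = {z | ‖z.1‖ ≤ t * R} ∩ ({z | z.2 ≤ t * L} ∩
      ⋂ p, {z | inner ℝ p z.1 ≤ t * h p + z.2}) := by
    ext z; simp [Jset]
  rw [this]
  refine (isClosed_le (by fun_prop) (by fun_prop)).inter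
    ((isClosed_le (by fun_prop) (by fun_prop)).inter (isClosed_iInter fun p =>
      isClosed_le (by fun_prop) (by fun_prop)))

theorem Ham.Jset_nonneg (hh : Ham h) {q : Ed n} {l : ℝ} (hq : (q, l) ∈ Jset h R L t) : 0 ≤ l := by
  simpa [hh.zero] using hq.2.2 0

theorem Ham.zero_mem_Jset (hh : Ham h) (ht : 0 ≤ t) (hR : 0 ≤ R) (hL : 0 ≤ L) :
    ((0 : Ed n), (0 : ℝ)) ∈ Jset h R L t :=
  ⟨by simp; positivity, by simp; positivity, fun p => by
    simpa using mul_nonneg ht (hh.nonneg p)⟩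

theorem exists_hopfLax {J : Set (Ed n × ℝ)} (hJ : IsCompact J) (hne : J.Nonempty) {f : Ed n → ℝ}
    (hf : Continuous f) (x : Ed n) : ∃ q l, (q, l) ∈ J ∧ hopfLax J f x = f (x + q) - l ∧
      ∀ q' l', (q', l') ∈ J → f (x + q') - l' ≤ f (x + q) - l := by
  obtain ⟨⟨q, l⟩, hq, hmax⟩ := hJ.exists_isMaxOn hne
    (f := fun z : Ed n × ℝ => f (x + z.1) - z.2)
    (by fun_prop)
  refine ⟨q, l, hq, ?_, fun q' l' h => hmax h⟩
  refine IsGreatest.csSup_eq ⟨⟨_, hq, rfl⟩, ?_⟩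
  rintro _ ⟨z, hz, rfl⟩
  exact hmax hz

theorem hopfLax_continuous {J : Set (Ed n × ℝ)} (hJ : IsCompact J) {f : Ed n → ℝ}
    (hf : Continuous f) : Continuous (hopfLax J f) :=
  hJ.continuous_sSup (f := fun x (z : Ed n × ℝ) => f (x + z.1) - z.2) (by fun_prop)

variable {U : Set (Ed n)} {u : Ed n → ℝ} {k₁ Λ : ℝ} {x : Ed n}

theorem Ham.discrete_sub (hh : Ham h)
    (hu : ∀ k > (0 : ℝ), CompCones (fun y x => supp h k (y - x)) U u)
    (huc : Continuous u) (ht : 0 < t) (hxU : closedBall x (2 * t * R) ⊆ U)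
    (hR : 0 < R) (hΛR : Λ < R)
    (hΛ : ∀ p p', h p ≤ k₁ + 1 → h p' ≤ k₁ + 1 → h p' - h p ≤ Λ * ‖p' - p‖)
    (hL0 : 0 ≤ L) (hL : ∀ p, h p ≤ k₁ + 1 → ‖p‖ * R ≤ L)
    (hyp : ∀ q l, (q, l) ∈ Jset h R L (2 * t) → u (x + q) - u x ≤ 2 * t * k₁ + l) :
    ∃ q l, (q, l) ∈ Jset h R L t ∧
      hopfLax (Jset h R L t) u x - u x ≤
        hopfLax (Jset h R L t) u (x + q) - hopfLax (Jset h R L t) u x - l ∧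
      ∀ q' l', (q', l') ∈ Jset h R L t →
        hopfLax (Jset h R L t) u x - hopfLax (Jset h R L t) u (x - q') - l' ≤
        hopfLax (Jset h R L t) u (x + q) - hopfLax (Jset h R L t) u x - l := by
  have hne : ∀ s : ℝ, 0 ≤ s → (Jset h R L s).Nonempty := fun s hs =>
    ⟨_, hh.zero_mem_Jset hs hR.le hL0⟩
  have hle : ∀ y q l, (q, l) ∈ Jset h R L t → u (y + q) - l ≤ hopfLax (Jset h R L t) u y := by
    intro y q l hq
    obtain ⟨q', l', -, h1, h2⟩ := exists_hopfLax hh.Jset_compact (hne t ht.le) huc y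
    rw [h1]; exact h2 q l hq
  obtain ⟨q₂, l₂, hq₂, -, hmax⟩ :=
    exists_hopfLax (hh.Jset_compact (R := R) (L := L) (t := 2 * t)) (hne _ (by linarith)) huc x
  set m := u (x + q₂) - l₂ - u x with hm
  have hm0 : 0 ≤ m := by
    have := hmax 0 0 (hh.zero_mem_Jset (by linarith) hR.le hL0)
    simp only [add_zero, sub_zero] at this
    linarith
  have hmk : m / (2 * t) ≤ k₁ := by
    rw [div_le_iff₀ (by linarith)]
    have := hyp _ _ hq₂
    linarith
  have key : ∀ q' l', (q', l') ∈ Jset h R L t → 2 * (u (x + q') - l' - u x) ≤ m := by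
    intro q' l' hq'
    refine le_of_forall_pos_le_add fun ε hε => ?_
    set η := min 1 (ε / (2 * t)) with hη
    have hη0 : 0 < η := lt_min one_pos (by positivity)
    have hη1 : η ≤ 1 := min_le_left _ _
    have hη2 : η * (2 * t) ≤ ε := by
      rw [← le_div_iff₀ (by linarith)]; exact min_le_right _ _
    have hk : m / (2 * t) + η ≤ k₁ + 1 := by linarith
    have hk0 : 0 < m / (2 * t) + η := by positivity
    have := hh.conv_scale (hu _ hk0) huc.continuousOn hk0 (by linarith : 0 < 2 * t) hxU hR hΛR
      (fun p p' h1 h2 => hΛ p p' (h1.trans hk) (h2.trans hk)) (fun p h1 => hL p (h1.trans hk))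
      (fun q l hq => by
        have h1 := hmax q l hq
        rw [mul_add, mul_div_cancel₀ _ (by linarith : 2 * t ≠ 0)]
        nlinarith) ht (by linarith : t < 2 * t) hq'
    have e : t * (m / (2 * t) + η) = m / 2 + t * η := by field_simp
    rw [e] at this
    linarith
  have hhalf : ((1 / 2 : ℝ) • q₂, l₂ / 2) ∈ Jset h R L t := by
    obtain ⟨h1, h2, h3⟩ := hq₂
    simp only at h1 h2 h3
    refine ⟨?_, by simp only; linarith, fun p => ?_⟩
    · simp only [norm_smul]; norm_num; linarith
    · have := h3 p
      simp only [inner_smul_right]; linarith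
  obtain ⟨q₁, l₁, hq₁, h1, -⟩ := exists_hopfLax (hh.Jset_compact (R := R) (L := L) (t := t))
    (hne t ht.le) huc x
  have h2 := key _ _ hq₁
  have h4 := hle (x + (1 / 2 : ℝ) • q₂) _ _ hhalf
  have e : x + (1 / 2 : ℝ) • q₂ + (1 / 2 : ℝ) • q₂ = x + q₂ := by module
  rw [e] at h4
  rw [← h1] at h2
  refine ⟨_, _, hhalf, by linarith, fun q' l' hq' => ?_⟩
  have h3 := hle (x - q') q' l' hq'
  rw [sub_add_cancel] at h3
  linarith

theorem CompCones.le_near {m : Ed n → Ed n → ℝ} (hu : CompCones m U u) {ρ : ℝ}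
    (hm0 : m x x = 0) (hxU : closedBall x ρ ⊆ U)
    (hb : ∀ z, dist z x = ρ → u z - u x ≤ m z x) {z : Ed n} (hz : dist z x < ρ) :
    u z - u x ≤ m z x := by
  rcases eq_or_ne z x with rfl | hzx
  · rw [hm0, sub_self]
  set V : Set (Ed n) := ball x ρ \ {x} with hV
  have hVo : IsOpen V := isOpen_ball.sdiff isClosed_singleton
  have hcl : closure V ⊆ closedBall x ρ :=
    closure_minimal (sdiff_subset.trans ball_subset_closedBall) isClosed_closedBall
  have := hu V hVo ((isCompact_closedBall _ _).of_isClosed_subset isClosed_closure hcl)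
    (hcl.trans hxU) x (fun h => h.2 rfl) (u x) (fun y hy => ?_) z ⟨hz, hzx⟩
  · linarith
  have hyV : y ∉ V := by rw [hVo.frontier_eq] at hy; exact hy.2
  have hyc := hcl (frontier_subset_closure hy)
  rcases eq_or_ne y x with rfl | hyx
  · rw [hm0, add_zero]
  · have : dist y x = ρ := by
      refine le_antisymm hyc ?_
      by_contra! hlt
      exact hyV ⟨hlt, hyx⟩
    linarith [hb y this]
end HL

section Comparison
variable {n : ℕ} {h : Ed n → ℝ} {U : Set (Ed n)}

theorem Ham.exists_lip (hh : Ham h) (k : ℝ) :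
    ∃ Λ : ℝ, 0 ≤ Λ ∧ ∀ p p', h p ≤ k → h p' ≤ k → h p' - h p ≤ Λ * ‖p' - p‖ := by
  obtain ⟨R, hR⟩ := hh.coer k
  have hc : IsCompact {p | h p ≤ k} :=
    (isCompact_closedBall (0 : Ed n) R).of_isClosed_subset (isClosed_le hh.cont continuous_const)
      fun p hp => by simpa using hR p hp
  obtain ⟨K, hK⟩ := hh.conv.locallyLipschitz.locallyLipschitzOn.exists_lipschitzOnWith_of_compact
    (s := {p | h p ≤ k}) hc
  refine ⟨K, K.2, fun p p' hp hp' => ?_⟩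
  have := hK.dist_le_mul p' hp' p hp
  rw [Real.dist_eq, dist_eq_norm] at this
  exact (le_abs_self _).trans this

theorem Ham.exists_bound_on_ball (hh : Ham h) (K : ℝ) : ∃ k₁ : ℝ, ∀ p, ‖p‖ ≤ K → h p ≤ k₁ := by
  obtain ⟨k₁, hk₁⟩ := (isCompact_closedBall (0 : Ed n) K).bddAbove_image hh.cont.continuousOn
  exact ⟨k₁, fun p hp => hk₁ ⟨p, by simpa using hp, rfl⟩⟩

theorem CompCones.congr {m : Ed n → Ed n → ℝ} {u u' : Ed n → ℝ} (hu : CompCones m U u)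
    (he : ∀ x ∈ U, u x = u' x) : CompCones m U u' := by
  intro V hV hVc hVU x₀ hx₀ c hc x hx
  rw [← he x (hVU (subset_closure hx))]
  exact hu V hV hVc hVU x₀ hx₀ c
    (fun y hy => by rw [he y (hVU (frontier_subset_closure hy))]; exact hc y hy) x hx

theorem Ham.near_bound (hh : Ham h) {u : Ed n → ℝ} {k₁ K B ρ : ℝ} {x : Ed n}
    (hu : CompCones (fun y x => supp h k₁ (y - x)) U u) (hk₁ : ∀ p, ‖p‖ ≤ K → h p ≤ k₁)
    (hK : 0 ≤ K) (hB : ∀ x, |u x| ≤ B) (hKρ : 2 * B ≤ K * ρ) (hxU : closedBall x ρ ⊆ U) {q : Ed n}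
    (hq : ‖q‖ < ρ) : u (x + q) - u x ≤ supp h k₁ q := by
  obtain ⟨Rk, hRk⟩ := hh.coer k₁
  have hne : ∃ p, h p ≤ k₁ := ⟨0, hk₁ 0 (by simpa using hK)⟩
  have h1 : u (x + q) - u x ≤ supp h k₁ (x + q - x) := by
    refine hu.le_near (ρ := ρ) (by simpa using supp_zero hne hRk) hxU (fun z hz => ?_)
      (by simpa [dist_eq_norm] using hq)
    have hz' : ‖z - x‖ = ρ := by rw [← hz, dist_eq_norm]
    have h2 := abs_le.1 (hB z)
    have h3 := abs_le.1 (hB x)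
    rcases (norm_nonneg (z - x)).eq_or_lt with h0 | h0
    · have : z = x := by rw [← sub_eq_zero, ← norm_eq_zero]; exact h0.symm
      subst this
      simp [supp_zero hne hRk]
    have h4 := le_supp hRk (p := (K / ‖z - x‖) • (z - x)) (hk₁ _ (by
      rw [norm_smul, norm_div, Real.norm_eq_abs, abs_of_nonneg hK, norm_norm,
        div_mul_cancel₀ _ h0.ne'])) (z - x)
    rw [real_inner_smul_left, real_inner_self_eq_norm_sq, pow_two, ← mul_assoc,
      div_mul_cancel₀ _ h0.ne', hz'] at h4
    linarith
  rwa [add_sub_cancel_left] at h1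

theorem Ham.small_step (hh : Ham h) {u : Ed n → ℝ} {k₁ K B ρ : ℝ} {x : Ed n}
    (hu : CompCones (fun y x => supp h k₁ (y - x)) U u) (hk₁ : ∀ p, ‖p‖ ≤ K → h p ≤ k₁)
    (hK : 0 ≤ K) (hB : ∀ x, |u x| ≤ B) (hKρ : 2 * B ≤ K * ρ) (hxU : closedBall x ρ ⊆ U) {q : Ed n}
    {R L l s : ℝ} (hs : 0 ≤ s) (hq : ‖q‖ < ρ) (hql : (q, l) ∈ Jset h R L s) :
    u (x + q) - u x ≤ s * k₁ + l := by
  refine (hh.near_bound hu hk₁ hK hB hKρ hxU hq).trans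
    (supp_le ⟨0, hk₁ 0 (by simpa using hK)⟩ fun p hp => (hql.2.2 p).trans ?_)
  simp only
  gcongr

theorem Ham.hopfLax_facts (hh : Ham h) {u : Ed n → ℝ}
    (hu : ∀ k > (0 : ℝ), CompCones (fun y x => supp h k (y - x)) U u) (huc : Continuous u)
    {k₁ K B ρ Λ R L t ε η : ℝ} (hk₁ : ∀ p, ‖p‖ ≤ K → h p ≤ k₁) (hk₁0 : 0 < k₁)
    (hK : 0 ≤ K) (hB : ∀ x, |u x| ≤ B) (hKρ : 2 * B ≤ K * ρ)
    (hR : 0 < R) (hΛR : Λ < R)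
    (hΛ : ∀ p p', h p ≤ k₁ + 1 → h p' ≤ k₁ + 1 → h p' - h p ≤ Λ * ‖p' - p‖)
    (hL0 : 0 ≤ L) (hL : ∀ p, h p ≤ k₁ + 1 → ‖p‖ * R ≤ L) (ht : 0 < t)
    (htρ : 2 * t * R < ρ) (htη : t * R < η)
    (hη : ∀ x ∈ closure U, ∀ y ∈ closure U, dist x y < η → dist (u x) (u y) < ε) :
    (∀ x, |hopfLax (Jset h R L t) u x| ≤ B) ∧
    (∀ x, closedBall x (ρ / 2) ⊆ U → u x ≤ hopfLax (Jset h R L t) u x ∧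
      hopfLax (Jset h R L t) u x ≤ u x + ε) ∧
    ∀ x, closedBall x ρ ⊆ U → ∃ q l, (q, l) ∈ Jset h R L t ∧
      hopfLax (Jset h R L t) u x - u x ≤
        hopfLax (Jset h R L t) u (x + q) - hopfLax (Jset h R L t) u x - l ∧
      ∀ q' l', (q', l') ∈ Jset h R L t →
        hopfLax (Jset h R L t) u x - hopfLax (Jset h R L t) u (x - q') - l' ≤
        hopfLax (Jset h R L t) u (x + q) - hopfLax (Jset h R L t) u x - l := by
  have h00 := hh.zero_mem_Jset ht.le hR.le hL0
  have hup : ∀ x, u x ≤ hopfLax (Jset h R L t) u x := fun x => by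
    obtain ⟨q, l, -, h1, h2⟩ := exists_hopfLax hh.Jset_compact ⟨_, h00⟩ huc x
    simpa [h1] using h2 _ _ h00
  refine ⟨fun x => ?_, fun x hx => ⟨hup x, ?_⟩, fun x hx => ?_⟩
  · obtain ⟨q, l, h0, h1, -⟩ := exists_hopfLax hh.Jset_compact ⟨_, h00⟩ huc x
    have := hh.Jset_nonneg h0
    have h3 := abs_le.1 (hB x)
    have h4 := abs_le.1 (hB (x + q))
    rw [abs_le]
    exact ⟨h3.1.trans (hup x), by linarith⟩
  · obtain ⟨q, l, h0, h1, -⟩ := exists_hopfLax hh.Jset_compact ⟨_, h00⟩ huc x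
    have := hh.Jset_nonneg h0
    have hq : ‖q‖ ≤ t * R := h0.1
    have hρ : 0 ≤ t * R := by positivity
    have h5 := hη (x + q) (subset_closure (hx (by
        simp only [mem_closedBall, dist_self_add_left]; linarith))) x
      (subset_closure (hx (mem_closedBall_self (by linarith)))) (by
        simp only [dist_self_add_left]; linarith)
    rw [Real.dist_eq] at h5
    linarith [(abs_lt.1 h5).2]
  · exact hh.discrete_sub hu huc ht ((closedBall_subset_closedBall htρ.le).trans hx) hR hΛR hΛ hL0
      hL fun q l hq => hh.small_step (hu k₁ hk₁0) hk₁ hK hB hKρ hx (by positivity)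
        (lt_of_le_of_lt hq.1 (by simpa using htρ)) hq

theorem exists_bounded_extension {u : Ed n → ℝ} (hU : Bornology.IsBounded U)
    (hu : ContinuousOn u (closure U)) : ∃ u' : Ed n → ℝ, Continuous u' ∧ (∃ B, ∀ x, |u' x| ≤ B) ∧
      ∀ x ∈ closure U, u x = u' x := by
  obtain ⟨f, hf⟩ := ContinuousMap.exists_restrict_eq isClosed_closure
    (⟨(closure U).domRestrict u, hu.domRestrict⟩ : C(closure U, ℝ))
  obtain ⟨B, hB⟩ := hU.isCompact_closure.exists_bound_of_continuousOn hu
  refine ⟨fun x => max (-|B|) (min (f x) |B|), by fun_prop, ⟨|B|, fun x => ?_⟩, fun x hx => ?_⟩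
  · rw [abs_le]
    exact ⟨le_max_left _ _, max_le (by linarith [abs_nonneg B]) (min_le_right _ _)⟩
  · have h1 : f x = u x := by
      have := DFunLike.congr_fun hf ⟨x, hx⟩
      simpa using this
    have h2 := abs_le.1 (hB x hx)
    beta_reduce
    rw [h1, min_eq_left (h2.2.trans (le_abs_self B)),
      max_eq_right ((neg_le_neg (le_abs_self B)).trans h2.1)]

theorem Ham.comparison (hh : Ham h) (hflat : interior {p | h p ≤ 0} = ∅) (hU : IsOpen U)
    (hUb : Bornology.IsBounded U) {u₀ v₀ : Ed n → ℝ} (hu₀ : ContinuousOn u₀ (closure U))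
    (hv₀ : ContinuousOn v₀ (closure U))
    (hus : ∀ k > (0 : ℝ), CompCones (fun y x => supp h k (y - x)) U u₀)
    (hvs : ∀ k > (0 : ℝ), CompCones (fun y x => supp (fun p => h (-p)) k (y - x)) U
      (fun x => -v₀ x))
    (hb : ∀ x ∈ frontier U, u₀ x ≤ v₀ x) : ∀ x ∈ closure U, u₀ x ≤ v₀ x := by
  obtain ⟨u, huc, ⟨Bu, hBu⟩, hue⟩ := exists_bounded_extension hUb hu₀
  obtain ⟨v, hvc, ⟨Bv, hBv⟩, hve⟩ := exists_bounded_extension hUb hv₀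
  replace hus : ∀ k > (0 : ℝ), CompCones (fun y x => supp h k (y - x)) U u := fun k hk =>
    (hus k hk).congr fun x hx => hue x (subset_closure hx)
  replace hvs : ∀ k > (0 : ℝ), CompCones (fun y x => supp (fun p => h (-p)) k (y - x)) U
      (fun x => -v x) := fun k hk =>
    (hvs k hk).congr fun x hx => by rw [hve x (subset_closure hx)]
  intro x₁ hx₁
  by_cases hx₁U : x₁ ∉ U
  · exact hb x₁ (by rw [hU.frontier_eq]; exact ⟨hx₁, hx₁U⟩)
  rw [not_not] at hx₁U
  rw [hue x₁ hx₁, hve x₁ hx₁]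
  set B : ℝ := max Bu Bv with hBdef
  replace hBu : ∀ x, |u x| ≤ B := fun x => (hBu x).trans (le_max_left _ _)
  replace hBv : ∀ x, |(fun x => -v x) x| ≤ B := fun x => by
    rw [abs_neg]; exact (hBv x).trans (le_max_right _ _)
  have hB0 : 0 ≤ B := (abs_nonneg _).trans (hBu 0)
  refine le_of_forall_pos_le_add fun ε' hε' => ?_
  obtain ⟨ε, hε, hεe⟩ : ∃ ε > (0 : ℝ), ε' = 4 * ε := ⟨ε' / 4, by positivity, by ring⟩
  set Kc : Set (Ed n) := {x ∈ closure U | ε ≤ u x - v x} ∪ {x₁} with hKc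
  have hKcc : IsCompact Kc := by
    refine IsCompact.union ?_ isCompact_singleton
    exact hUb.isCompact_closure.inter_right (isClosed_le continuous_const (huc.sub hvc))
  have hKU : Kc ⊆ U := by
    rintro x (⟨hx, hxe⟩ | hx)
    · by_contra hxU
      have := hb x (by rw [hU.frontier_eq]; exact ⟨hx, hxU⟩)
      rw [hue x hx, hve x hx] at this
      linarith
    · rw [Set.mem_singleton_iff.1 hx]; exact hx₁U
  obtain ⟨ρ, hρ, hρU⟩ := hKcc.exists_cthickening_subset_open hU hKU
  have hball : ∀ x ∈ Kc, closedBall x ρ ⊆ U := fun x hx =>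
    (closedBall_subset_cthickening hx ρ).trans hρU
  obtain ⟨d, hd⟩ := hUb.subset_closedBall (0 : Ed n)
  set K : ℝ := 2 * B / ρ with hKdef
  have hK0 : 0 ≤ K := by positivity
  have hKρ : 2 * B ≤ K * ρ := by rw [hKdef, div_mul_cancel₀ _ hρ.ne']
  obtain ⟨k₁, hk₁⟩ := hh.exists_bound_on_ball K
  obtain ⟨k₁, hk₁0, hk₁⟩ : ∃ k : ℝ, 0 < k ∧ ∀ p, ‖p‖ ≤ K → h p ≤ k :=
    ⟨max k₁ 1, by positivity, fun p hp => (hk₁ p hp).trans (le_max_left _ _)⟩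
  obtain ⟨Λ, hΛ0, hΛ⟩ := hh.exists_lip (k₁ + 1)
  obtain ⟨Rb, hRb⟩ := hh.coer (k₁ + 1)
  set R : ℝ := Λ + 1 with hRdef
  have hR : 0 < R := by positivity
  obtain ⟨e, he, hflat'⟩ := hh.exists_flat_direction hflat
  set κ : ℝ := ε / (4 * (2 * |d| + 1)) with hκdef
  have hκ : 0 < κ := by positivity
  obtain ⟨σ₀, hσ₀, hσ⟩ := hflat' κ hκ
  set σ : ℝ := min σ₀ R with hσdef
  have hσ0 : 0 < σ := lt_min hσ₀ hR
  replace hσ := hσ σ hσ0 (min_le_left _ _)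
  set L : ℝ := |Rb| * R + κ * σ with hLdef
  have hL0 : 0 ≤ L := by positivity
  have hL : ∀ p, h p ≤ k₁ + 1 → ‖p‖ * R ≤ L := fun p hp => by
    have h1 : ‖p‖ * R ≤ |Rb| * R := by
      gcongr; exact (hRb p hp).trans (le_abs_self _)
    have : 0 ≤ κ * σ := by positivity
    linarith
  have huU := hUb.isCompact_closure.uniformContinuousOn_of_continuous huc.continuousOn
  have hvU := hUb.isCompact_closure.uniformContinuousOn_of_continuous hvc.neg.continuousOn
  rw [Metric.uniformContinuousOn_iff] at huU hvU
  obtain ⟨η₁, hη₁, huη⟩ := huU ε hε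
  obtain ⟨η₂, hη₂, hvη⟩ := hvU ε hε
  set r : ℝ := min ρ (min 1 (min η₁ η₂)) with hr
  have hr0 : 0 < r := by positivity
  have hrρ : r ≤ ρ := min_le_left _ _
  have hr1 : r ≤ 1 := (min_le_right _ _).trans (min_le_left _ _)
  have hrη₁ : r ≤ η₁ := (min_le_right _ _).trans ((min_le_right _ _).trans (min_le_left _ _))
  have hrη₂ : r ≤ η₂ := (min_le_right _ _).trans ((min_le_right _ _).trans (min_le_right _ _))
  set t : ℝ := r / (4 * R) with htdef
  have ht : 0 < t := by positivity
  have htR : t * R = r / 4 := by rw [htdef]; field_simp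
  have hΛ' : ∀ p p' : Ed n, h (-p) ≤ k₁ + 1 → h (-p') ≤ k₁ + 1 → h (-p') - h (-p) ≤
      Λ * ‖p' - p‖ := fun p p' hp hp' => by
    have := hΛ _ _ hp hp'
    rwa [show -p' - -p = -(p' - p) by abel, norm_neg] at this
  obtain ⟨hu1, hu2, hu3⟩ := hh.hopfLax_facts hus huc hk₁ hk₁0 hK0 hBu hKρ hR (by linarith) hΛ hL0 hL
    ht (by linarith) (by linarith) (huη)
  obtain ⟨hv1, hv2, hv3⟩ := hh.reflect.hopfLax_facts hvs hvc.neg (fun p hp => hk₁ _ (by simpa using hp))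
    hk₁0 hK0 hBv hKρ hR (by linarith) hΛ' hL0 (fun p hp => by simpa using hL _ hp)
    ht (by linarith) (by linarith) (hvη)
  set f := hopfLax (Jset h R L t) u with hf
  set w := hopfLax (Jset (fun p => h (-p)) R L t) (fun x => -v x) with hw
  have hfc : Continuous f := hopfLax_continuous hh.Jset_compact huc
  have hlmem : ∀ s : ℝ, s = 1 ∨ s = -1 → (s • ((t * σ) • e), t * (κ * σ)) ∈ Jset h R L t := by
    intro s hs
    have hs1 : |s| = 1 := by rcases hs with rfl | rfl <;> simp
    refine ⟨?_, ?_, fun p => ?_⟩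
    · simp only [norm_smul, he, Real.norm_eq_abs, hs1, abs_of_pos (mul_pos ht hσ0)]
      have : σ ≤ R := min_le_right _ _
      simp only [one_mul, mul_one]
      gcongr
    · simp only
      gcongr
      have : 0 ≤ |Rb| * R := by positivity
      linarith
    · simp only [inner_smul_right]
      have h1 := hσ p
      have h2 : s * inner ℝ p e ≤ |inner ℝ p e| := by
        rcases hs with rfl | rfl
        · simpa using le_abs_self _
        · simpa using neg_le_abs _
      calc s * (t * σ * inner ℝ p e) = t * (σ * (s * inner ℝ p e)) := by ring
        _ ≤ t * (h p + κ * σ) := by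
            gcongr
            exact (mul_le_mul_of_nonneg_left h2 hσ0.le).trans h1
        _ = _ := by ring
  have htσ : 0 < t * σ := by positivity
  set N : ℕ := ⌊2 * |d| / (t * σ)⌋₊ + 1 with hN
  have hN1 : 2 * |d| < N * (t * σ) := by
    rw [← div_lt_iff₀ htσ, hN]; exact_mod_cast Nat.lt_floor_add_one _
  have hN2 : N * (t * σ) ≤ 2 * |d| + 1 := by
    have h1 : (⌊2 * |d| / (t * σ)⌋₊ : ℝ) ≤ 2 * |d| / (t * σ) := Nat.floor_le (by positivity)
    have h2 : (⌊2 * |d| / (t * σ)⌋₊ : ℝ) * (t * σ) ≤ 2 * |d| := by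
      rwa [le_div_iff₀ htσ] at h1
    have h3 : t * σ ≤ t * R := by
      have : σ ≤ R := min_le_right _ _
      gcongr
    rw [hN]; push_cast
    linarith
  have key := discrete_comparison (J := Jset h R L t) (D := {x | closedBall x ρ ⊆ U})
    (Dp := {x | closedBall x (ρ / 2) ⊆ U}) (f := f) (g := fun x => -w x) (B := B)
    (M₀ := 3 * ε) (e := (t * σ) • e) (lp := t * (κ * σ)) (lm := t * (κ * σ)) (θ := t * (κ * σ))
    (N := N) hu1 (fun x => by rw [abs_neg]; exact hv1 x) (fun q l hq => hh.Jset_nonneg hq)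
    (fun x hx q l hq => ?_) (fun x => ?_) (fun x hx q l hq => ?_) (fun x hx => ?_)
    (by simpa using hlmem 1 (Or.inl rfl)) (by simpa using hlmem (-1) (Or.inr rfl))
    (by positivity) (fun x => ?_) (fun x hx hxD => ?_) x₁
    ((closedBall_subset_closedBall (by linarith)).trans (hball x₁ (Or.inr rfl)))
  · have h1 := hu2 x₁ ((closedBall_subset_closedBall (by linarith)).trans (hball x₁ (Or.inr rfl)))
    have h2 := hv2 x₁ ((closedBall_subset_closedBall (by linarith)).trans (hball x₁ (Or.inr rfl)))
    have h3 : (N : ℝ) * (2 * (t * (κ * σ)) + t * (κ * σ) + t * (κ * σ)) ≤ ε := by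
      calc (N : ℝ) * (2 * (t * (κ * σ)) + t * (κ * σ) + t * (κ * σ))
          = (N * (t * σ)) * (4 * κ) := by ring
        _ ≤ (2 * |d| + 1) * (4 * κ) := by gcongr
        _ = ε := by rw [hκdef]; field_simp
    linarith [h1.1, h2.1]
  · have hq1 : ‖q‖ ≤ t * R := hq.1
    constructor
    · refine (closedBall_subset_closedBall' ?_).trans hx
      simp only [dist_self_add_left]; linarith
    · refine (closedBall_subset_closedBall' ?_).trans hx
      rw [dist_self_sub_left]; linarith
  · obtain ⟨q, l, h1, -, h2⟩ := exists_hopfLax hh.Jset_compact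
      ⟨_, hh.zero_mem_Jset ht.le hR.le hL0⟩ hfc x
    exact ⟨q, l, h1, h2⟩
  · obtain ⟨q', l', h1, -, h2⟩ := hu3 x hx
    exact ⟨q', l', h1, h2 q l hq⟩
  · obtain ⟨q, l, h1, -, h2⟩ := hv3 x hx
    refine ⟨-q, l, mem_Jset_reflect.1 h1, fun q' l' hq' => ?_⟩
    have := h2 (-q') l' (mem_Jset_reflect.2 (by simpa using hq'))
    simp only [sub_neg_eq_add] at this ⊢
    linarith
  · by_contra! hcon
    have h0 := hd (hcon 0 (Nat.zero_le _) (mem_closedBall_self hρ.le))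
    have h1 := hd (hcon N le_rfl (mem_closedBall_self hρ.le))
    simp only [zero_smul, add_zero, mem_closedBall, dist_zero_right] at h0 h1
    have h2 : ‖N • ((t * σ) • e)‖ = N * (t * σ) := by
      rw [← Nat.cast_smul_eq_nsmul ℝ, norm_smul, norm_smul, he, mul_one,
        Real.norm_of_nonneg htσ.le, Real.norm_of_nonneg (Nat.cast_nonneg N)]
    have h3 := norm_sub_le (x + N • ((t * σ) • e)) x
    rw [add_sub_cancel_left, h2] at h3
    linarith [le_abs_self d]
  · have h1 := hu2 x hx
    have h2 := hv2 x hx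
    have hxU : x ∈ U := hx (mem_closedBall_self (by positivity))
    have : u x - v x < ε := by
      by_contra! hcon
      exact hxD (hball x (Or.inl ⟨subset_closure hxU, hcon⟩))
    linarith [h1.2, h2.2]

end Comparison

section Submin
variable {n : ℕ} {h : Ed n → ℝ} {U : Set (Ed n)}

theorem fderiv_eq_inner_gradient (u : Ed n → ℝ) (x v : Ed n) :
    fderiv ℝ u x v = inner ℝ (gradient u x) v := by
  rw [gradient, InnerProductSpace.toDual_symm_apply]

theorem Ham.gradient_le_of_supp (hh : Ham h) {k : ℝ} (hk : 0 < k) {u : Ed n → ℝ} {x : Ed n}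
    (hu : ∀ᶠ z in nhds x, u z - u x ≤ supp h k (z - x)) : h (gradient u x) ≤ k := by
  by_cases hd : DifferentiableAt ℝ u x
  swap
  · rw [gradient_eq_zero_of_not_differentiableAt hd, hh.zero]; exact hk.le
  by_contra! hlt
  have hne : ∃ p, h p ≤ k := ⟨0, by rw [hh.zero]; exact hk.le⟩
  obtain ⟨R, hR⟩ := hh.coer k
  have hS1 : Convex ℝ {p | h p ≤ k} := by simpa using hh.conv.convex_le k
  have hS2 : IsClosed {p | h p ≤ k} := isClosed_le hh.cont continuous_const
  obtain ⟨f, s, hf, hs⟩ := geometric_hahn_banach_closed_point hS1 hS2 (x := gradient u x)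
    (by simpa using hlt)
  set v : Ed n := (InnerProductSpace.toDual ℝ (Ed n)).symm f with hv
  have hfv : ∀ p, f p = inner ℝ p v := fun p => by
    rw [real_inner_comm, hv, InnerProductSpace.toDual_symm_apply]
  have h1 := (hd.hasFDerivAt.hasLineDerivAt v).tendsto_slope_zero_right
  rw [fderiv_eq_inner_gradient, ← hfv] at h1
  have h2 : Tendsto (fun t : ℝ => x + t • v) (nhdsWithin 0 (Ioi 0)) (nhds x) := by
    have : Tendsto (fun t : ℝ => x + t • v) (nhds 0) (nhds (x + (0 : ℝ) • v)) :=
      (Continuous.tendsto (by fun_prop) 0)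
    rw [zero_smul, add_zero] at this
    exact this.mono_left nhdsWithin_le_nhds
  refine absurd (le_of_tendsto h1 ?_) (not_le.2 hs)
  filter_upwards [h2.eventually hu, self_mem_nhdsWithin] with t ht ht0
  have ht0' : (0 : ℝ) < t := ht0
  rw [add_sub_cancel_left, supp_smul hne hR ht0'.le] at ht
  rw [smul_eq_mul, inv_mul_le_iff₀ ht0']
  refine ht.trans ?_
  gcongr
  exact supp_le hne fun p hp => by rw [← hfv]; exact (hf p hp).le

theorem Ham.gradient_le (hh : Ham h) {k : ℝ} {u : Ed n → ℝ} {x : Ed n} {t R L Λ : ℝ}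
    (hu : CompCones (fun y x => supp h k (y - x)) U u)
    (huc : Continuous u) (hk : 0 < k) (ht : 0 < t) (hxU : closedBall x (t * R) ⊆ U)
    (hR : 0 < R) (hΛR : Λ < R)
    (hΛ : ∀ p p', h p ≤ k → h p' ≤ k → h p' - h p ≤ Λ * ‖p' - p‖)
    (hL : ∀ p, h p ≤ k → ‖p‖ * R ≤ L)
    (hyp : ∀ q l, (q, l) ∈ Jset h R L t → u (x + q) - u x ≤ t * k + l) :
    h (gradient u x) ≤ k := by
  have hne : ∃ p, h p ≤ k := ⟨0, by rw [hh.zero]; exact hk.le⟩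
  obtain ⟨Rk, hRk⟩ := hh.coer k
  have hlt : ∀ᶠ z in nhds x, supp h k (z - x) < t * k := by
    have hc : Continuous fun z => supp h k (z - x) :=
      (supp_continuous hne hRk).comp (continuous_id.sub continuous_const)
    refine hc.continuousAt.eventually_lt continuousAt_const ?_
    rw [sub_self, supp_zero hne hRk]; positivity
  refine hh.gradient_le_of_supp hk ?_
  filter_upwards [hlt, ball_mem_nhds x (by positivity : 0 < t * R)] with z hz1 hz2
  rcases hh.conv_core hu huc.continuousOn hk ht hxU hΛR hΛ hL hyp hz2 with h1 | h1
  · exact h1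
  · have := h1 0 (by rw [hh.zero]; exact hk)
    rw [inner_zero_left, hh.zero] at this
    linarith

theorem Ham.gradient_le_of_competitor (hh : Ham h) (hUb : Bornology.IsBounded U) (hU : IsOpen U)
    {u v : Ed n → ℝ} (huc : Continuous u) {B : ℝ} (hB : ∀ x, |u x| ≤ B)
    (hus : ∀ k > (0 : ℝ), CompCones (fun y x => supp h k (y - x)) U u)
    {V : Set (Ed n)} (hV : IsOpen V) (hVc : IsCompact (closure V)) (hVU : closure V ⊆ U)
    {Kv : ℝ≥0} (hv : LipschitzWith Kv v) (hle : ∀ x ∈ V, v x ≤ u x)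
    (heq : ∀ x ∈ frontier V, v x = u x) {μ k : ℝ} (hμk : μ < k) (hk : 0 < k)
    (hvμ : ∀ᵐ z ∂(volume : Measure (Ed n)), z ∈ V → h (gradient v z) ≤ μ) {x₀ : Ed n}
    (hx₀ : x₀ ∈ V) : h (gradient u x₀) ≤ k := by
  by_contra! hcon
  have hB0 : 0 ≤ B := (abs_nonneg _).trans (hB 0)
  obtain ⟨ρ, hρ, hρU⟩ := hVc.exists_cthickening_subset_open hU hVU
  have hball : ∀ x ∈ V, closedBall x ρ ⊆ U := fun x hx =>
    (closedBall_subset_cthickening (subset_closure hx) ρ).trans hρU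
  obtain ⟨d₀, hd₀, hdV⟩ := Metric.nhds_basis_closedBall.mem_iff.1 (hV.mem_nhds hx₀)
  set K : ℝ := 2 * B / ρ with hKdef
  have hK0 : 0 ≤ K := by positivity
  have hKρ : 2 * B ≤ K * ρ := by rw [hKdef, div_mul_cancel₀ _ hρ.ne']
  obtain ⟨k₁, hk₁⟩ := hh.exists_bound_on_ball K
  obtain ⟨k₁, hkk₁, hk₁⟩ : ∃ k' : ℝ, k ≤ k' ∧ ∀ p, ‖p‖ ≤ K → h p ≤ k' :=
    ⟨max k₁ k, le_max_right _ _, fun p hp => (hk₁ p hp).trans (le_max_left _ _)⟩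
  obtain ⟨Λ, hΛ0, hΛ⟩ := hh.exists_lip (k₁ + 1)
  obtain ⟨Rb, hRb⟩ := hh.coer (k₁ + 1)
  set R : ℝ := Λ + 1 with hRdef
  have hR : 0 < R := by positivity
  set L : ℝ := |Rb| * R with hLdef
  have hL0 : 0 ≤ L := by positivity
  have hL : ∀ p, h p ≤ k₁ + 1 → ‖p‖ * R ≤ L := fun p hp => by
    rw [hLdef]; gcongr; exact (hRb p hp).trans (le_abs_self _)
  obtain ⟨ε, hε, hεe⟩ : ∃ ε > (0 : ℝ), d₀ / (2 * R) * (k - μ) = 4 * ε :=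
    ⟨d₀ / (2 * R) * (k - μ) / 4, by have := sub_pos.2 hμk; positivity, by ring⟩
  have huU := hUb.isCompact_closure.uniformContinuousOn_of_continuous huc.continuousOn
  rw [Metric.uniformContinuousOn_iff] at huU
  obtain ⟨η, hη, huη⟩ := huU ε hε
  set r : ℝ := min (min ρ (η / 2)) (min (d₀ / 2) (ε / (Kv + 1))) with hr
  have hr0 : 0 < r := by positivity
  have hrρ : r ≤ ρ := (min_le_left _ _).trans (min_le_left _ _)
  have hrη : r ≤ η / 2 := (min_le_left _ _).trans (min_le_right _ _)
  have hrd : r ≤ d₀ / 2 := (min_le_right _ _).trans (min_le_left _ _)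
  have hrK : Kv * r ≤ ε := by
    have h1 : r * (Kv + 1) ≤ ε := by
      rw [← le_div_iff₀ (by positivity)]; exact (min_le_right _ _).trans (min_le_right _ _)
    nlinarith
  set t : ℝ := r / (4 * R) with htdef
  have ht : 0 < t := by positivity
  have htR : t * R = r / 4 := by rw [htdef]; field_simp
  obtain ⟨hu1, hu2, hu3⟩ := hh.hopfLax_facts hus huc hk₁ (hk.trans_le hkk₁) hK0 hB hKρ hR
    (by linarith) hΛ hL0 hL ht (by linarith) (by linarith) huη
  set f := hopfLax (Jset h R L t) u with hf
  have hfc : Continuous f := hopfLax_continuous hh.Jset_compact huc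
  have hne : (Jset h R L t).Nonempty := ⟨_, hh.zero_mem_Jset ht.le hR.le hL0⟩
  have hball2 : ∀ x ∈ V, closedBall x (ρ / 2) ⊆ U := fun x hx =>
    (closedBall_subset_closedBall (by linarith)).trans (hball x hx)
  choose Q l hQ _ hmax using fun x => exists_hopfLax hh.Jset_compact hne hfc x
  have hQr : ∀ x, ‖Q x‖ ≤ r / 4 := fun x => by rw [← htR]; exact (hQ x).1
  set S : Ed n → ℝ := fun x => f (x + Q x) - f x - l x with hS
  have hS0 : t * k ≤ S x₀ := by
    obtain ⟨q, l', h1, h2, -⟩ := hu3 x₀ (hball x₀ hx₀)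
    have h3 := hmax x₀ q l' h1
    have h4 : t * k ≤ f x₀ - u x₀ := by
      by_contra! hlt
      refine absurd (hh.gradient_le (hus k hk) huc hk ht
        ((closedBall_subset_closedBall (by linarith)).trans (hball x₀ hx₀)) hR
        (by linarith : Λ < R) (fun p p' h1 h2 => hΛ p p' (by linarith) (by linarith))
        (fun p hp => hL p (by linarith)) fun q l hq => ?_) (not_le.2 hcon)
      obtain ⟨q', l', -, h1, h2⟩ := exists_hopfLax hh.Jset_compact hne huc x₀
      have := h2 q l hq
      rw [← h1] at this
      linarith
    simp only [hS]
    linarith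
  have hS1 : ∀ y, y + Q y ∈ V → S y ≤ S (y + Q y) := fun y hy => by
    obtain ⟨q, l', h1, -, h2⟩ := hu3 _ (hball _ hy)
    have h3 := hmax (y + Q y) q l' h1
    have h4 := h2 _ _ (hQ y)
    rw [add_sub_cancel_right] at h4
    simp only [hS]
    linarith
  have hvinc : ∀ x, closedBall x r ⊆ V → v (x + Q x) - v x ≤ t * μ + l x := fun x hx => by
    refine lip_increment_le hv (half_pos hr0) ?_
    filter_upwards [hvμ] with z hz
    rintro ⟨s, hs, hzs⟩
    have hzV : z ∈ V := by
      refine hx ?_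
      rw [mem_closedBall]
      have h1 : dist (x + s • (x + Q x - x)) x ≤ r / 4 := by
        rw [dist_self_add_left, add_sub_cancel_left, norm_smul, Real.norm_of_nonneg hs.1]
        nlinarith [hQr x, hs.2, norm_nonneg (Q x)]
      linarith [dist_triangle z (x + s • (x + Q x - x)) x]
    rw [fderiv_eq_inner_gradient, add_sub_cancel_left]
    refine ((hQ x).2.2 (gradient v z)).trans ?_
    have := hz hzV
    simp only
    gcongr
  set X : ℕ → Ed n := fun j => (fun x => x + Q x)^[j] x₀ with hX
  have hX0 : X 0 = x₀ := rfl
  have hXs : ∀ j, X (j + 1) = X j + Q (X j) := fun j => by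
    simp only [hX, Function.iterate_succ_apply']
  have chain : ∀ j, (∀ i < j, closedBall (X i) r ⊆ V) → X j ∈ V ∧ t * k ≤ S (X j) ∧
      j * (t * (k - μ)) ≤ f (X j) - v (X j) ∧ ‖X j - x₀‖ ≤ j * (t * R) := by
    intro j
    induction j with
    | zero =>
      intro _
      rw [hX0]
      refine ⟨hx₀, hS0, ?_, by simp⟩
      have h1 := (hu2 x₀ (hball2 x₀ hx₀)).1
      have h2 := hle x₀ hx₀
      simp; linarith
    | succ j ih =>
      intro hj
      obtain ⟨h1, h2, h3, h4⟩ := ih fun i hi => hj i (by omega)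
      have h5 := hj j (by omega)
      have h6 : X (j + 1) ∈ V := h5 (by
        rw [hXs, mem_closedBall, dist_self_add_left]; linarith [hQr (X j)])
      refine ⟨h6, ?_, ?_, ?_⟩
      · rw [hXs] at h6 ⊢
        exact h2.trans (hS1 _ h6)
      · have h7 := hvinc _ h5
        rw [hXs]
        simp only [hS] at h2
        push_cast
        linarith
      · have h8 : ‖Q (X j)‖ ≤ t * R := (hQ (X j)).1
        have h9 : X (j + 1) - x₀ = (X j - x₀) + Q (X j) := by rw [hXs]; abel
        rw [h9]
        push_cast
        linarith [norm_add_le (X j - x₀) (Q (X j))]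
  have htμ : 0 < t * (k - μ) := mul_pos ht (sub_pos.2 hμk)
  by_cases hall : ∀ j, closedBall (X j) r ⊆ V
  · obtain ⟨C, hC⟩ := hVc.exists_bound_of_continuousOn hv.continuous.continuousOn
    obtain ⟨N, hN⟩ := exists_nat_gt ((B + C) / (t * (k - μ)))
    obtain ⟨h1, -, h2, -⟩ := chain N fun i _ => hall i
    rw [div_lt_iff₀ htμ] at hN
    have h3 := abs_le.1 (hu1 (X N))
    have h4 := abs_le.1 (hC _ (subset_closure h1))
    linarith
  · push Not at hall
    classical
    set N := Nat.find hall with hNdef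
    have hN1 : ¬ closedBall (X N) r ⊆ V := Nat.find_spec hall
    obtain ⟨h1, -, h2, h3⟩ := chain N fun i hi => by
      have := Nat.find_min hall hi
      rwa [not_not] at this
    have h4 : d₀ / 2 ≤ ‖X N - x₀‖ := by
      by_contra! hlt
      refine hN1 ((closedBall_subset_closedBall' ?_).trans hdV)
      rw [dist_eq_norm]; linarith
    obtain ⟨y, hy, hyV⟩ := Set.not_subset.1 hN1
    obtain ⟨b, hb, hbV⟩ := exists_mem_segment_frontier h1 hyV
    have hbr : dist (X N) b ≤ r := by
      have : b ∈ closedBall (X N) r :=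
        (convex_closedBall (X N) r).segment_subset (mem_closedBall_self hr0.le) hy hb
      rwa [dist_comm]
    have h5 := huη _ (subset_closure (hVU (subset_closure h1))) b
      (subset_closure (hVU (frontier_subset_closure hbV))) (by linarith)
    rw [Real.dist_eq] at h5
    have h6 := hv.dist_le_mul (X N) b
    rw [Real.dist_eq] at h6
    have h7 : Kv * dist (X N) b ≤ Kv * r := by gcongr
    have h8 := (hu2 _ (hball2 _ h1)).2
    have h9 := heq b hbV
    have h10 : d₀ / (2 * R) ≤ N * t := by
      rw [div_le_iff₀ (by positivity)]; linarith
    have h11 : d₀ / (2 * R) * (k - μ) ≤ N * t * (k - μ) := by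
      have := sub_pos.2 hμk
      gcongr
    have h12 := (abs_lt.1 h5).2
    have h13 := (abs_le.1 (h6.trans (h7.trans hrK))).1
    linarith

theorem Ham.absSubmin (hh : Ham h) (hUb : Bornology.IsBounded U) (hU : IsOpen U)
    {u : Ed n → ℝ} (hu : ContinuousOn u (closure U))
    (hus : ∀ k > (0 : ℝ), CompCones (fun y x => supp h k (y - x)) U u) :
    AbsSubmin (fun p _ => h p) U u := by
  obtain ⟨u', huc, ⟨B, hB⟩, hue⟩ := exists_bounded_extension hUb hu
  have hus' : ∀ k > (0 : ℝ), CompCones (fun y x => supp h k (y - x)) U u' := fun k hk =>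
    (hus k hk).congr fun x hx => hue x (subset_closure hx)
  have hB0 : 0 ≤ B := (abs_nonneg _).trans (hB 0)
  refine ⟨fun x hx => ?_, fun V hV hVc hVU v ⟨Kv, hv⟩ hle heq => ?_⟩
  · obtain ⟨ρ, hρ, hρU⟩ := Metric.nhds_basis_closedBall.mem_iff.1 (hU.mem_nhds hx)
    set K : ℝ := 2 * B / (ρ / 2) with hKdef
    have hK0 : 0 ≤ K := by positivity
    have hKρ : 2 * B ≤ K * (ρ / 2) := by rw [hKdef, div_mul_cancel₀ _ (by positivity)]
    obtain ⟨k₁, hk₁⟩ := hh.exists_bound_on_ball K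
    obtain ⟨k₁, hk₁0, hk₁⟩ : ∃ k : ℝ, 0 < k ∧ ∀ p, ‖p‖ ≤ K → h p ≤ k :=
      ⟨max k₁ 1, by positivity, fun p hp => (hk₁ p hp).trans (le_max_left _ _)⟩
    obtain ⟨Rk, hRk⟩ := hh.coer k₁
    have hne : ∃ p, h p ≤ k₁ := ⟨0, by rw [hh.zero]; exact hk₁0.le⟩
    refine ⟨Real.toNNReal |Rk|, ball x (ρ / 4), nhdsWithin_le_nhds (ball_mem_nhds _ (by positivity)),
      LipschitzOnWith.of_le_add_mul _ fun y hy z hz => ?_⟩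
    have hyU : y ∈ U := hρU (by have := mem_ball.1 hy; rw [mem_closedBall]; linarith)
    have hzU : z ∈ U := hρU (by have := mem_ball.1 hz; rw [mem_closedBall]; linarith)
    rw [hue y (subset_closure hyU), hue z (subset_closure hzU)]
    have hd : dist y z < ρ / 2 := by
      have := mem_ball.1 hy
      have := mem_ball.1 hz
      linarith [dist_triangle_right y z x]
    have h1 := hh.near_bound (hus' k₁ hk₁0) hk₁ hK0 hB hKρ (x := z) (q := y - z)
      ((closedBall_subset_closedBall' (by have := mem_ball.1 hz; linarith)).trans hρU)
      (by rwa [← dist_eq_norm])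
    have h2 := supp_le_norm hne (fun p hp => (hRk p hp).trans (le_abs_self _)) (y - z)
    rw [add_sub_cancel] at h1
    rw [Real.coe_toNNReal _ (abs_nonneg _), dist_eq_norm]
    linarith
  · refine le_of_forall_gt_imp_ge_of_dense fun c hc => ?_
    rcases V.eq_empty_or_nonempty with rfl | hVne
    · simp
    obtain ⟨v', hv', hvv⟩ := hv.extend_real
    have hgv : ∀ z ∈ V, gradient v z = gradient v' z := fun z hz => by
      have : v =ᶠ[nhds z] v' := by
        filter_upwards [hV.mem_nhds hz] with y hy using hvv (subset_closure hy)
      rw [gradient, gradient, this.fderiv_eq]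
    obtain ⟨μ, hμ1, hμ2⟩ := EReal.lt_iff_exists_real_btwn.1 hc
    obtain ⟨k, hk1, hk2⟩ := EReal.lt_iff_exists_real_btwn.1 hμ2
    have hμk : μ < k := by exact_mod_cast hk1
    have hae := ae_lt_of_essSup_lt hμ1
    have hvμ : ∀ᵐ z ∂(volume : Measure (Ed n)), z ∈ V → h (gradient v' z) ≤ μ := by
      rw [ae_restrict_iff' hV.measurableSet] at hae
      filter_upwards [hae] with z hz hzV
      rw [← hgv z hzV]
      exact_mod_cast (hz hzV).le
    have hμ0 : 0 ≤ μ := by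
      by_contra! hneg
      have : ∀ᵐ z ∂(volume : Measure (Ed n)), z ∉ V := by
        filter_upwards [hvμ] with z hz hzV
        linarith [hz hzV, hh.nonneg (gradient v' z)]
      have h0 : volume V = 0 := by
        rw [ae_iff] at this; simpa using this
      exact hVne.ne_empty ((hV.measure_eq_zero_iff volume).1 h0)
    refine le_trans (essSup_le_of_ae_le (k : EReal) ?_) hk2.le
    rw [EventuallyLE, ae_restrict_iff' hV.measurableSet]
    refine Eventually.of_forall fun x hx => ?_
    have hgu : gradient u x = gradient u' x := by
      have : u =ᶠ[nhds x] u' := by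
        filter_upwards [hU.mem_nhds (hVU (subset_closure hx))] with y hy
          using hue y (subset_closure hy)
      rw [gradient, gradient, this.fderiv_eq]
    rw [hgu]
    have hVU' : ∀ y ∈ closure V, u y = u' y := fun y hy => hue y (subset_closure (hVU hy))
    exact_mod_cast hh.gradient_le_of_competitor hUb hU huc hB hus' hV hVc hVU hv'
      (fun y hy => by
        rw [← hvv (subset_closure hy), ← hVU' y (subset_closure hy)]; exact hle y hy)
      (fun y hy => by
        rw [← hvv (frontier_subset_closure hy), ← hVU' y (frontier_subset_closure hy)]
        exact heq y hy)
      hμk (hμ0.trans_lt hμk) hvμ hx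

end Submin

/-- Convex coercive Hamiltonians whose set of minimisers has empty interior. -/
structure Eff {n : ℕ} (Hb : Ed n → ℝ) : Prop where
  conv : ConvexOn ℝ univ Hb
  coer : ∀ C : ℝ, ∃ R : ℝ, ∀ p, Hb p ≤ C → ‖p‖ ≤ R
  flat : interior {p | ∀ q, Hb p ≤ Hb q} = ∅

section EffSec
variable {n : ℕ} {Hb : Ed n → ℝ} {U : Set (Ed n)}

theorem Eff.cont (hH : Eff Hb) : Continuous Hb := hH.conv.locallyLipschitz.continuous

theorem Eff.reflect (hH : Eff Hb) : Eff fun p => Hb (-p) where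
  conv := by
    have := hH.conv.comp_linearMap (-LinearMap.id : Ed n →ₗ[ℝ] Ed n)
    simpa [Function.comp_def] using this
  coer C := by
    obtain ⟨R, hR⟩ := hH.coer C
    exact ⟨R, fun p hp => by simpa using hR _ hp⟩
  flat := by
    have : {p | ∀ q, Hb (-p) ≤ Hb (-q)} = -{p | ∀ q, Hb p ≤ Hb q} := by
      ext p
      simp only [Set.mem_ofPred_eq, Set.mem_neg]
      exact ⟨fun h q => by simpa using h (-q), fun h q => h _⟩
    rw [this, ← Set.image_neg_eq_neg]
    have h2 := (Homeomorph.neg (Ed n)).image_interior {p | ∀ q, Hb p ≤ Hb q}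
    simp only [Homeomorph.coe_neg] at h2
    rw [← h2, hH.flat, Set.image_empty]

theorem Eff.exists_min (hH : Eff Hb) : ∃ p₀, ∀ q, Hb p₀ ≤ Hb q := by
  refine hH.cont.exists_forall_le' 0 ?_
  obtain ⟨R, hR⟩ := hH.coer (Hb 0)
  filter_upwards [(isCompact_closedBall (0 : Ed n) R).compl_mem_cocompact] with p hp
  by_contra! hlt
  exact hp (by simpa using hR p hlt.le)

theorem Eff.ham (hH : Eff Hb) {p₀ : Ed n} (hp₀ : ∀ q, Hb p₀ ≤ Hb q) :
    Ham fun p => Hb (p + p₀) - Hb p₀ where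
  conv := by
    have := (hH.conv.translate_left p₀)
    simp only [preimage_univ] at this
    have h2 := this.add_const (-Hb p₀)
    simpa [Function.comp_def, sub_eq_add_neg, Pi.add_def] using h2
  cont := by have := hH.cont; fun_prop
  coer C := by
    obtain ⟨R, hR⟩ := hH.coer (C + Hb p₀)
    refine ⟨R + ‖p₀‖, fun p hp => ?_⟩
    have h1 := hR (p + p₀) (by linarith)
    have h2 := norm_sub_le (p + p₀) p₀
    rw [add_sub_cancel_right] at h2
    linarith
  zero := by simp
  nonneg p := by linarith [hp₀ (p + p₀)]

theorem Eff.ham_flat (hH : Eff Hb) {p₀ : Ed n} (hp₀ : ∀ q, Hb p₀ ≤ Hb q) :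
    interior {p | Hb (p + p₀) - Hb p₀ ≤ 0} = ∅ := by
  have : {p | Hb (p + p₀) - Hb p₀ ≤ 0} = (Homeomorph.addRight p₀) ⁻¹' {p | ∀ q, Hb p ≤ Hb q} := by
    ext p
    simp only [Set.mem_ofPred_eq, Set.mem_preimage, Homeomorph.coe_addRight]
    exact ⟨fun h q => by linarith [hp₀ q], fun h => by linarith [h p₀]⟩
  rw [this, ← Homeomorph.preimage_interior, hH.flat, Set.preimage_empty]

theorem supp_translate (hc : ∀ C : ℝ, ∃ R : ℝ, ∀ p, Hb p ≤ C → ‖p‖ ≤ R) {p₀ : Ed n} {k : ℝ}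
    (hk : 0 ≤ k) (v : Ed n) :
    supp (fun p => Hb (p + p₀) - Hb p₀) k v = supp Hb (k + Hb p₀) v - inner ℝ p₀ v := by
  obtain ⟨R, hR⟩ := hc (k + Hb p₀)
  refine le_antisymm (supp_le ⟨0, by simpa using hk⟩ fun p hp => ?_) ?_
  · have h1 := le_supp hR (p := p + p₀) (by linarith) v
    rw [inner_add_left] at h1
    linarith
  · rw [sub_le_iff_le_add]
    refine supp_le ⟨p₀, by linarith⟩ fun p hp => ?_
    have h1 := le_supp (h := fun p => Hb (p + p₀) - Hb p₀) (k := k) (R := R + ‖p₀‖) (fun p hp => by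
      have h1 := hR (p + p₀) (by linarith)
      have h2 := norm_sub_le (p + p₀) p₀
      rw [add_sub_cancel_right] at h2
      linarith) (p := p - p₀) (by simp only [sub_add_cancel]; linarith) v
    rw [inner_sub_left] at h1
    linarith

theorem Eff.compCones_translate (hH : Eff Hb) {p₀ : Ed n} {u : Ed n → ℝ}
    (hu : ∀ k, (∃ p, Hb p < k) → CompCones (fun y x => supp Hb k (y - x)) U u) :
    ∀ k > (0 : ℝ), CompCones (fun y x => supp (fun p => Hb (p + p₀) - Hb p₀) k (y - x)) U
      fun x => u x - inner ℝ p₀ x := by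
  intro k hk V hV hVc hVU x₀ hx₀ c hb x hx
  have h1 := hu (k + Hb p₀) ⟨p₀, by linarith⟩ V hV hVc hVU x₀ hx₀ (c + inner ℝ p₀ x₀)
    (fun y hy => ?_) x hx
  · simp only at h1 ⊢
    rw [supp_translate hH.coer hk.le, inner_sub_right]
    linarith
  · have := hb y hy
    simp only at this ⊢
    rw [supp_translate hH.coer hk.le, inner_sub_right] at this
    linarith

theorem Eff.comparison (hH : Eff Hb) (hU : IsOpen U) (hUb : Bornology.IsBounded U)
    {u v : Ed n → ℝ} (hu : ContinuousOn u (closure U)) (hv : ContinuousOn v (closure U))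
    (hus : ∀ k, (∃ p, Hb p < k) → CompCones (fun y x => supp Hb k (y - x)) U u)
    (hvs : ∀ k, (∃ p, Hb (-p) < k) → CompCones (fun y x => supp (fun p => Hb (-p)) k (y - x)) U
      (fun x => -v x))
    (hb : ∀ x ∈ frontier U, u x ≤ v x) : ∀ x ∈ closure U, u x ≤ v x := by
  obtain ⟨p₀, hp₀⟩ := hH.exists_min
  have hvs' := hH.reflect.compCones_translate (p₀ := -p₀) hvs
  intro x hx
  have := (hH.ham hp₀).comparison (hH.ham_flat hp₀) hU hUb (u₀ := fun x => u x - inner ℝ p₀ x)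
    (v₀ := fun x => v x - inner ℝ p₀ x) (hu.sub (by fun_prop)) (hv.sub (by fun_prop))
    (hH.compCones_translate hus) (fun k hk => ?_) (fun x hx => by linarith [hb x hx]) x hx
  · linarith
  · have h1 := hvs' k hk
    simp only [neg_add_rev, neg_neg, inner_neg_left, sub_neg_eq_add] at h1
    have e1 : (fun p => Hb (-p + p₀) - Hb p₀) = fun p => Hb (p₀ + -p) - Hb p₀ := by
      funext p; rw [add_comm]
    have e2 : (fun x => -(v x - inner ℝ p₀ x)) = fun x => -v x + inner ℝ p₀ x := by
      funext x; ring
    rw [e1, e2]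
    exact h1

theorem gradient_sub_inner {u : Ed n → ℝ} {x : Ed n} (hu : DifferentiableAt ℝ u x) (p₀ : Ed n) :
    gradient (fun y => u y - inner ℝ p₀ y) x = gradient u x - p₀ := by
  have h1 : HasFDerivAt (fun y : Ed n => inner ℝ p₀ y) (InnerProductSpace.toDual ℝ (Ed n) p₀) x :=
    (InnerProductSpace.toDual ℝ (Ed n) p₀).hasFDerivAt
  rw [gradient, (hu.hasFDerivAt.fun_sub h1).fderiv, map_sub, LinearIsometryEquiv.symm_apply_apply,
    gradient]

theorem ae_differentiableAt_of_lipschitzOn {V : Set (Ed n)} (hV : IsOpen V) {u : Ed n → ℝ}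
    {K : ℝ≥0} (hu : LipschitzOnWith K u V) :
    ∀ᵐ z ∂(volume : Measure (Ed n)), z ∈ V → DifferentiableAt ℝ u z := by
  filter_upwards [hu.ae_differentiableWithinAt_of_mem (μ := volume)] with z hz hzV
  exact (hz hzV).differentiableAt (hV.mem_nhds hzV)

theorem Eff.absSubmin (hH : Eff Hb) (hU : IsOpen U) (hUb : Bornology.IsBounded U)
    {u : Ed n → ℝ} (hu : ContinuousOn u (closure U))
    (hus : ∀ k, (∃ p, Hb p < k) → CompCones (fun y x => supp Hb k (y - x)) U u) :
    AbsSubmin (fun p _ => Hb p) U u := by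
  obtain ⟨p₀, hp₀⟩ := hH.exists_min
  obtain ⟨hloc, hmin⟩ := (hH.ham hp₀).absSubmin hUb hU (u := fun x => u x - inner ℝ p₀ x)
    (hu.sub (by fun_prop)) (hH.compCones_translate hus)
  have hlin : LipschitzWith (Real.toNNReal ‖p₀‖) (fun x : Ed n => (inner ℝ p₀ x : ℝ)) :=
    lipschitz_of_le_norm (norm_nonneg _) fun y x => by
      rw [← inner_sub_right]; exact real_inner_le_norm _ _
  have hloc' : ∀ x ∈ U, ∃ K : ℝ≥0, ∃ t ∈ nhdsWithin x U, LipschitzOnWith K u t := fun x hx => by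
    obtain ⟨K, t, ht, hK⟩ := hloc x hx
    refine ⟨_, t, ht, (?_ : LipschitzOnWith (K + Real.toNNReal ‖p₀‖) u t)⟩
    simpa using hK.add hlin.lipschitzOnWith
  refine ⟨hloc', fun V hV hVc hVU v ⟨Kv, hv⟩ hle heq => ?_⟩
  obtain ⟨Ku, hKu⟩ := lipschitzOn_of_locLip hloc' hVc hVU
  have hu' := ae_differentiableAt_of_lipschitzOn hV (hKu.mono subset_closure)
  have hv' := ae_differentiableAt_of_lipschitzOn hV (hv.mono subset_closure)
  refine le_of_forall_gt_imp_ge_of_dense fun c hc => ?_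
  obtain ⟨μ, hμ1, hμ2⟩ := EReal.lt_iff_exists_real_btwn.1 hc
  have hae := ae_lt_of_essSup_lt hμ1
  rw [ae_restrict_iff' hV.measurableSet] at hae
  have h1 : essSup (fun x => ((Hb (gradient (fun y => v y - inner ℝ p₀ y) x + p₀) - Hb p₀ : ℝ) : EReal))
      (volume.restrict V) ≤ ((μ - Hb p₀ : ℝ) : EReal) := by
    refine essSup_le_of_ae_le _ ?_
    rw [EventuallyLE, ae_restrict_iff' hV.measurableSet]
    filter_upwards [hae, hv'] with z hz hz' hzV
    rw [gradient_sub_inner (hz' hzV), sub_add_cancel]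
    have : Hb (gradient v z) < μ := by exact_mod_cast hz hzV
    exact_mod_cast (by linarith : Hb (gradient v z) - Hb p₀ ≤ μ - Hb p₀)
  have h2 := (hmin V hV hVc hVU (fun x => v x - inner ℝ p₀ x)
    ⟨_, hv.sub hlin.lipschitzOnWith⟩ (fun x hx => by linarith [hle x hx])
    (fun x hx => by linarith [heq x hx])).trans h1
  refine le_trans (essSup_le_of_ae_le (μ : EReal) ?_) hμ2.le
  have h3 := ae_le_essSup (μ := volume.restrict V)
    (f := fun x => ((Hb (gradient (fun y => u y - inner ℝ p₀ y) x + p₀) - Hb p₀ : ℝ) : EReal))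
  rw [ae_restrict_iff' hV.measurableSet] at h3
  rw [EventuallyLE, ae_restrict_iff' hV.measurableSet]
  filter_upwards [h3, hu'] with z hz hz' hzV
  have h4 := (hz hzV).trans h2
  rw [gradient_sub_inner (hz' hzV), sub_add_cancel] at h4
  have h5 : Hb (gradient u z) - Hb p₀ ≤ μ - Hb p₀ := by exact_mod_cast h4
  exact_mod_cast (by linarith : Hb (gradient u z) ≤ μ)

theorem Eff.absMin (hH : Eff Hb) (hU : IsOpen U) (hUb : Bornology.IsBounded U)
    {u : Ed n → ℝ} (hu : ContinuousOn u (closure U))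
    (hus : ∀ k, (∃ p, Hb p < k) → CompCones (fun y x => supp Hb k (y - x)) U u)
    (hvs : ∀ k, (∃ p, Hb (-p) < k) → CompCones (fun y x => supp (fun p => Hb (-p)) k (y - x)) U
      (fun x => -u x)) :
    AbsMin (fun p _ => Hb p) U u :=
  ⟨hH.absSubmin hU hUb hu hus, absSupermin_of_neg (hH.reflect.absSubmin hU hUb hu.neg hvs)⟩

theorem Eff.exists_reg (hH : Eff Hb) (k : ℝ) : ∃ j, Reg (fun p (_ : Ed n) => Hb p) k j := by
  obtain ⟨R, hR⟩ := hH.coer (k + 1)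
  refine ⟨|R|, abs_nonneg _, fun _ => hH.conv, fun _ => hH.cont, fun p _ hp => ?_,
    fun δ hδ => ⟨1, one_pos, fun p y z _ _ => by simpa using hδ.le⟩⟩
  by_contra! hlt
  exact absurd (hR p hlt.le) (not_le.2 ((le_abs_self R).trans_lt hp))

theorem isSub_inner {p : Ed n} {k : ℝ} (hp : Hb p ≤ k) :
    IsSub (fun p (_ : Ed n) => Hb p) k fun y => inner ℝ p y := by
  refine ⟨⟨_, lipschitz_of_le_norm (norm_nonneg p) fun y x => by
    rw [← inner_sub_right]; exact real_inner_le_norm _ _⟩, Eventually.of_forall fun y => ?_⟩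
  have h1 : HasFDerivAt (fun y : Ed n => inner ℝ p y) (InnerProductSpace.toDual ℝ (Ed n) p) y :=
    (InnerProductSpace.toDual ℝ (Ed n) p).hasFDerivAt
  rw [gradient, h1.fderiv, LinearIsometryEquiv.symm_apply_apply]
  exact hp

theorem Eff.met_eq_supp (hH : Eff Hb) {k : ℝ} (hk : ∃ p, Hb p < k) (y x : Ed n) :
    met (fun p _ => Hb p) k y x = supp Hb k (y - x) := by
  obtain ⟨p, hp⟩ := hk
  obtain ⟨j, hj⟩ := hH.exists_reg k
  obtain ⟨R, hR⟩ := hH.coer k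
  refine le_antisymm (met_le ⟨_, isSub_inner hp.le⟩ fun w hw => ?_) (supp_le ⟨p, hp.le⟩ fun q hq => ?_)
  · obtain ⟨⟨K, hK⟩, hw⟩ := hw
    refine lip_increment_le hK one_pos ?_
    filter_upwards [hw] with z hz _
    rw [fderiv_eq_inner_gradient]
    exact le_supp hR hz _
  · have := (isSub_inner hq).le_met hj y x
    rwa [← inner_sub_right] at this

theorem Eff.compCones_of_absSubmin (hH : Eff Hb) {u : Ed n → ℝ}
    (hu : AbsSubmin (fun p _ => Hb p) U u) (k : ℝ) (hk : ∃ p, Hb p < k) :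
    CompCones (fun y x => supp Hb k (y - x)) U u := by
  obtain ⟨j, hj⟩ := hH.exists_reg k
  have h1 := hu.compCones hj (by obtain ⟨p, hp⟩ := hk; exact ⟨_, isSub_inner hp.le⟩)
  have e : met (fun p _ => Hb p) k = fun y x => supp Hb k (y - x) := by
    funext y x; exact hH.met_eq_supp hk y x
  rwa [e] at h1

theorem Eff.unique (hH : Eff Hb) (hU : IsOpen U) (hUb : Bornology.IsBounded U)
    {u v : Ed n → ℝ} (hu : ContinuousOn u (closure U)) (hv : ContinuousOn v (closure U))
    (hum : AbsMin (fun p _ => Hb p) U u) (hvm : AbsMin (fun p _ => Hb p) U v)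
    (hb : ∀ x ∈ frontier U, u x = v x) : ∀ x ∈ closure U, u x = v x := fun x hx =>
  le_antisymm
    (hH.comparison hU hUb hu hv (hH.compCones_of_absSubmin hum.1)
      (hH.reflect.compCones_of_absSubmin hvm.2.neg) (fun y hy => (hb y hy).le) x hx)
    (hH.comparison hU hUb hv hu (hH.compCones_of_absSubmin hvm.1)
      (hH.reflect.compCones_of_absSubmin hum.2.neg) (fun y hy => (hb y hy).ge) x hx)

end EffSec

section Limit
variable {n : ℕ} {Hb : Ed n → ℝ} {U : Set (Ed n)}

/-- `F` is the upper limit of `f ε` as `ε → 0⁺`, pointwise on `S`. -/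
structure IsLimsup (f : ℝ → Ed n → ℝ) (S : Set (Ed n)) (F : Ed n → ℝ) : Prop where
  le : ∀ x ∈ S, ∀ η > (0 : ℝ), ∀ᶠ ε in nhdsWithin 0 (Ioi 0), f ε x ≤ F x + η
  ge : ∀ x ∈ S, ∀ η > (0 : ℝ), ∃ᶠ ε in nhdsWithin (0 : ℝ) (Ioi 0), F x - η ≤ f ε x

theorem exists_isLimsup {f : ℝ → Ed n → ℝ} {S : Set (Ed n)} {B : ℝ}
    (hB : ∀ ε > 0, ∀ x ∈ S, |f ε x| ≤ B) : ∃ F, IsLimsup f S F := by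
  have hev : ∀ x ∈ S, ∀ᶠ ε in nhdsWithin (0 : ℝ) (Ioi 0), |f ε x| ≤ B := fun x hx => by
    filter_upwards [self_mem_nhdsWithin] with ε hε using hB ε hε x hx
  have h1 : ∀ x ∈ S, IsBoundedUnder (· ≤ ·) (nhdsWithin (0 : ℝ) (Ioi 0)) fun ε => f ε x :=
    fun x hx => ⟨B, eventually_map.2 <| (hev x hx).mono fun ε h => (abs_le.1 h).2⟩
  have h2 : ∀ x ∈ S, IsBoundedUnder (· ≥ ·) (nhdsWithin (0 : ℝ) (Ioi 0)) fun ε => f ε x :=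
    fun x hx => ⟨-B, eventually_map.2 <| (hev x hx).mono fun ε h => (abs_le.1 h).1⟩
  refine ⟨fun x => limsup (fun ε => f ε x) (nhdsWithin 0 (Ioi 0)), fun x hx η hη => ?_,
    fun x hx η hη => ?_⟩
  · exact (eventually_lt_of_limsup_lt (lt_add_of_pos_right _ hη) (h1 x hx)).mono fun ε h => h.le
  · exact (frequently_lt_of_lt_limsup (h2 x hx).isCoboundedUnder_le
      (sub_lt_self _ hη)).mono fun ε h => h.le

variable {f : ℝ → Ed n → ℝ} {F : Ed n → ℝ}

theorem IsLimsup.continuousOn {S : Set (Ed n)} (hF : IsLimsup f S F)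
    (heq : ∀ η > 0, ∃ δ > 0, ∀ ε > 0, ∀ x ∈ S, ∀ y ∈ S, dist x y < δ → |f ε x - f ε y| ≤ η) :
    ContinuousOn F S := by
  have key : ∀ η > 0, ∃ δ > 0, ∀ x ∈ S, ∀ y ∈ S, dist x y < δ → F x ≤ F y + η := by
    intro η hη
    obtain ⟨δ, hδ, h⟩ := heq (η / 3) (by positivity)
    refine ⟨δ, hδ, fun x hx y hy hxy => ?_⟩
    obtain ⟨ε, ⟨h1, h2⟩, hε⟩ := (((hF.ge x hx (η / 3) (by positivity)).and_eventually
      (hF.le y hy (η / 3) (by positivity))).and_eventually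
        (self_mem_nhdsWithin (a := (0 : ℝ)) (s := Ioi 0))).exists
    have h3 := (abs_le.1 (h ε hε x hx y hy hxy)).2
    linarith
  refine Metric.continuousOn_iff.2 fun x hx η hη => ?_
  obtain ⟨δ, hδ, h⟩ := key (η / 2) (by positivity)
  refine ⟨δ, hδ, fun y hy hyx => ?_⟩
  have h1 := h y hy x hx hyx
  have h2 := h x hx y hy (by rwa [dist_comm])
  rw [Real.dist_eq, abs_lt]
  constructor <;> linarith

theorem eventually_forall_le_of_compact {S C : Set (Ed n)} (hC : IsCompact C) (hCS : C ⊆ S)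
    {f G : ℝ → Ed n → ℝ}
    (hf : ∀ η > 0, ∃ δ > 0, ∀ ε > 0, ∀ x ∈ S, ∀ y ∈ S, dist x y < δ → f ε x ≤ f ε y + η)
    (hG : ∀ η > 0, ∃ δ > 0, ∀ ε > 0, ∀ x ∈ S, ∀ y ∈ S, dist x y < δ → G ε x ≤ G ε y + η)
    (h : ∀ x ∈ C, ∀ η > 0, ∀ᶠ ε in nhdsWithin (0 : ℝ) (Ioi 0), f ε x ≤ G ε x + η)
    {η : ℝ} (hη : 0 < η) :
    ∀ᶠ ε in nhdsWithin (0 : ℝ) (Ioi 0), ∀ x ∈ C, f ε x ≤ G ε x + η := by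
  obtain ⟨δ₁, hδ₁, h1⟩ := hf (η / 3) (by positivity)
  obtain ⟨δ₂, hδ₂, h2⟩ := hG (η / 3) (by positivity)
  obtain ⟨t, htC, htf, hcov⟩ := hC.finite_cover_balls (lt_min hδ₁ hδ₂)
  have hev : ∀ᶠ ε in nhdsWithin (0 : ℝ) (Ioi 0), ∀ z ∈ t, f ε z ≤ G ε z + η / 3 :=
    (htf.eventually_all).2 fun z hz => h z (htC hz) _ (by positivity)
  filter_upwards [hev, self_mem_nhdsWithin] with ε hε hpos x hx
  obtain ⟨z, hz, hxz⟩ := mem_iUnion₂.1 (hcov hx)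
  have hxz' : dist x z < min δ₁ δ₂ := hxz
  have e1 := h1 ε hpos x (hCS hx) z (hCS (htC hz)) (hxz'.trans_le (min_le_left _ _))
  have e2 := h2 ε hpos z (hCS (htC hz)) x (hCS hx)
    (by rw [dist_comm]; exact hxz'.trans_le (min_le_right _ _))
  have e3 := hε z hz
  linarith

theorem IsLimsup.compCones {m : ℝ → Ed n → Ed n → ℝ} {M : Ed n → Ed n → ℝ} {j : ℝ}
    (hF : IsLimsup f (closure U) F)
    (heq : ∀ η > 0, ∃ δ > 0, ∀ ε > 0, ∀ x ∈ closure U, ∀ y ∈ closure U, dist x y < δ →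
      |f ε x - f ε y| ≤ η)
    (hm : ∀ ε > 0, CompCones (m ε) U (f ε))
    (hj : ∀ ε > 0, ∀ y z x, m ε y x - m ε z x ≤ j * ‖y - z‖)
    (hlim : ∀ y x, Tendsto (fun ε => m ε y x) (nhdsWithin 0 (Ioi 0)) (nhds (M y x))) :
    CompCones M U F := by
  intro V hV hVc hVU x₀ hx₀ c hb x hx
  have hj' : ∀ η > 0, ∃ δ > 0, ∀ ε > 0, ∀ y ∈ closure U, ∀ z ∈ closure U, dist y z < δ →
      c + m ε y x₀ ≤ c + m ε z x₀ + η := by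
    intro η hη
    refine ⟨η / (|j| + 1), by positivity, fun ε hε y _ z _ hyz => ?_⟩
    rw [dist_eq_norm, lt_div_iff₀ (by positivity)] at hyz
    have h1 := hj ε hε y z x₀
    have h2 : j * ‖y - z‖ ≤ |j| * ‖y - z‖ := by gcongr; exact le_abs_self j
    nlinarith [norm_nonneg (y - z)]
  have hlim' : ∀ y x, ∀ η > 0, ∀ᶠ ε in nhdsWithin (0 : ℝ) (Ioi 0), |m ε y x - M y x| < η :=
    fun y x η hη => by
      simpa [Real.dist_eq] using (Metric.tendsto_nhds.1 (hlim y x)) η hη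
  refine le_of_forall_pos_le_add fun η hη => ?_
  have hev := eventually_forall_le_of_compact (S := closure U) (C := frontier V)
    (hVc.of_isClosed_subset isClosed_frontier frontier_subset_closure)
    ((frontier_subset_closure.trans hVU).trans subset_closure) (f := f)
    (G := fun ε y => c + m ε y x₀)
    (fun η hη => by
      obtain ⟨δ, hδ, h⟩ := heq η hη
      refine ⟨δ, hδ, fun ε hε x hx y hy hxy => ?_⟩
      have := (abs_le.1 (h ε hε x hx y hy hxy)).2
      linarith) hj'
    (fun z hz η hη => by
      filter_upwards [hF.le z (subset_closure (hVU (frontier_subset_closure hz))) (η / 2)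
        (by positivity), hlim' z x₀ (η / 2) (by positivity)] with ε h1 h2
      have h3 := hb z hz
      have h4 := (abs_lt.1 h2).1
      linarith) (η := η / 3) (by positivity)
  obtain ⟨ε, ⟨h1, h2, h3⟩, hε⟩ := ((hF.ge x (subset_closure (hVU (subset_closure hx))) (η / 3)
    (by positivity)).and_eventually (hev.and (hlim' x x₀ (η / 3) (by positivity)))).and_eventually
      (self_mem_nhdsWithin (a := (0 : ℝ)) (s := Ioi 0)) |>.exists
  have h4 := hm ε hε V hV hVc hVU x₀ hx₀ (c + η / 3) (fun z hz => by
    have := h2 z hz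
    linarith) x hx
  have h5 := (abs_lt.1 h3).2
  linarith

theorem supp_le_supp_add (hconv : ConvexOn ℝ univ Hb) {p₀ : Ed n} {k μ R : ℝ} (hp₀ : Hb p₀ < k)
    (hkμ : k ≤ μ) (hR : ∀ p, Hb p ≤ μ → ‖p‖ ≤ R) (v : Ed n) :
    supp Hb μ v ≤ supp Hb k v + (μ - k) / (k - Hb p₀) * (2 * R * ‖v‖) := by
  refine supp_le ⟨p₀, by linarith⟩ fun p hp => ?_
  have hd : 0 < μ - Hb p₀ := by linarith
  have hd' : 0 < k - Hb p₀ := by linarith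
  set s := (μ - k) / (μ - Hb p₀) with hs
  have hs0 : 0 ≤ s := div_nonneg (by linarith) hd.le
  have hs1 : s ≤ 1 := by rw [hs, div_le_one hd]; linarith
  have hsd : s * (μ - Hb p₀) = μ - k := by rw [hs]; field_simp
  have hq : Hb (s • p₀ + (1 - s) • p) ≤ k := by
    have := hconv.2 (mem_univ p₀) (mem_univ p) hs0 (by linarith : 0 ≤ 1 - s) (by ring)
    simp only [smul_eq_mul] at this
    nlinarith
  have h1 := le_supp (fun p h => hR p (h.trans hkμ)) hq v
  have h2 : inner ℝ p v = inner ℝ (s • p₀ + (1 - s) • p) v + s * inner ℝ (p - p₀) v := by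
    simp only [inner_add_left, inner_sub_left, real_inner_smul_left]; ring
  have h3 : inner ℝ (p - p₀) v ≤ 2 * R * ‖v‖ := by
    refine (real_inner_le_norm _ _).trans ?_
    gcongr
    have := norm_sub_le p p₀
    linarith [hR p hp, hR p₀ (by linarith)]
  have hR0 : 0 ≤ R := (norm_nonneg p).trans (hR p hp)
  have h4 : s ≤ (μ - k) / (k - Hb p₀) := by
    rw [hs]; gcongr
  have h5 : s * inner ℝ (p - p₀) v ≤ (μ - k) / (k - Hb p₀) * (2 * R * ‖v‖) :=
    (mul_le_mul_of_nonneg_left h3 hs0).trans (by gcongr)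
  linarith

theorem Eff.compCones_of_rat (hH : Eff Hb)
    (hu : ∀ μ : ℚ, (∃ p, Hb p < μ) → CompCones (fun y x => supp Hb μ (y - x)) U F)
    (k : ℝ) (hk : ∃ p, Hb p < k) : CompCones (fun y x => supp Hb k (y - x)) U F := by
  intro V hV hVc hVU x₀ hx₀ c hb x hx
  obtain ⟨p₀, hp₀⟩ := hk
  obtain ⟨R, hR⟩ := hH.coer (k + 1)
  have hR0 : 0 ≤ R := (norm_nonneg p₀).trans (hR p₀ (by linarith))
  refine le_of_forall_pos_le_add fun η hη => ?_
  set A := 2 * R * ‖x - x₀‖ with hA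
  have hA0 : 0 ≤ A := by positivity
  have hd : 0 < k - Hb p₀ := by linarith
  obtain ⟨μ, hμ1, hμ2⟩ := exists_rat_btwn
    (show k < k + min 1 (η * (k - Hb p₀) / (A + 1)) from lt_add_of_pos_right _ (by positivity))
  have hμ3 : (μ : ℝ) - k ≤ η * (k - Hb p₀) / (A + 1) := by
    linarith [min_le_right 1 (η * (k - Hb p₀) / (A + 1))]
  have hμ4 : (μ : ℝ) ≤ k + 1 := by linarith [min_le_left 1 (η * (k - Hb p₀) / (A + 1))]
  have h1 := hu μ ⟨p₀, hp₀.trans hμ1⟩ V hV hVc hVU x₀ hx₀ c (fun z hz => (hb z hz).trans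
    (by gcongr; exact supp_mono hμ1.le ⟨p₀, hp₀.le⟩ (fun p h => hR p (h.trans hμ4)) _)) x hx
  have h2 := supp_le_supp_add hH.conv hp₀ hμ1.le (fun p h => hR p (h.trans hμ4)) (x - x₀)
  have h3 : ((μ : ℝ) - k) / (k - Hb p₀) * A ≤ η := by
    rw [div_mul_eq_mul_div, div_le_iff₀ hd]
    rw [le_div_iff₀ (by positivity)] at hμ3
    nlinarith
  simp only at h1 ⊢
  linarith

theorem supp_reflect (k : ℝ) (v : Ed n) : supp (fun p => Hb (-p)) k v = supp Hb k (-v) := by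
  unfold supp
  congr 1
  ext a
  constructor
  · rintro ⟨p, hp, rfl⟩
    exact ⟨-p, hp, by simp⟩
  · rintro ⟨p, hp, rfl⟩
    exact ⟨-p, by simpa using hp, by simp⟩

theorem Eff.limit (hH : Eff Hb) (hU : IsOpen U) (hUb : Bornology.IsBounded U) {g : Ed n → ℝ}
    {B : ℝ} (hB : ∀ ε > 0, ∀ x ∈ closure U, |f ε x| ≤ B)
    (heq : ∀ η > 0, ∃ δ > 0, ∀ ε > 0, ∀ x ∈ closure U, ∀ y ∈ closure U, dist x y < δ →
      |f ε x - f ε y| ≤ η)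
    (hg : ∀ ε > 0, ∀ x ∈ frontier U, f ε x = g x)
    (hm : ∀ μ : ℚ, (∃ p, Hb p < μ) → ∃ (j : ℝ) (m : ℝ → Ed n → Ed n → ℝ),
      (∀ ε > 0, CompCones (m ε) U (f ε) ∧ CompCones (fun y x => m ε x y) U (fun x => -f ε x)) ∧
      (∀ ε > 0, ∀ y z x, m ε y x - m ε z x ≤ j * ‖y - z‖ ∧ m ε x y - m ε x z ≤ j * ‖y - z‖) ∧
      ∀ y x, Tendsto (fun ε => m ε y x) (nhdsWithin 0 (Ioi 0)) (nhds (supp Hb μ (y - x)))) :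
    ∃ ub : Ed n → ℝ, ContinuousOn ub (closure U) ∧ AbsMin (fun p _ => Hb p) U ub ∧
      (∀ x ∈ frontier U, ub x = g x) ∧
      TendstoUniformlyOn f ub (nhdsWithin 0 (Ioi 0)) (closure U) := by
  have heq' : ∀ η > 0, ∃ δ > 0, ∀ ε > 0, ∀ x ∈ closure U, ∀ y ∈ closure U, dist x y < δ →
      |(-f ε x) - (-f ε y)| ≤ η := fun η hη => by
    obtain ⟨δ, hδ, h⟩ := heq η hη
    refine ⟨δ, hδ, fun ε hε x hx y hy hxy => ?_⟩
    rw [neg_sub_neg, abs_sub_comm]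
    exact h ε hε x hx y hy hxy
  obtain ⟨F, hF⟩ := exists_isLimsup hB
  obtain ⟨F', hF'⟩ := exists_isLimsup (f := fun ε x => -f ε x) (S := closure U) (B := B)
    (fun ε hε x hx => by rw [abs_neg]; exact hB ε hε x hx)
  have hFc := hF.continuousOn heq
  have hF'c := hF'.continuousOn heq'
  have hus := hH.compCones_of_rat (U := U) (F := F) fun μ hμ => by
    obtain ⟨j, m, h1, h2, h3⟩ := hm μ hμ
    exact hF.compCones heq (fun ε hε => (h1 ε hε).1) (fun ε hε y z x => (h2 ε hε y z x).1) h3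
  have hvs := hH.reflect.compCones_of_rat (U := U) (F := F') fun μ hμ => by
    obtain ⟨j, m, h1, h2, h3⟩ := hm μ (by obtain ⟨p, hp⟩ := hμ; exact ⟨-p, hp⟩)
    refine hF'.compCones heq' (m := fun ε y x => m ε x y) (fun ε hε => (h1 ε hε).2)
      (fun ε hε y z x => (h2 ε hε y z x).2) fun y x => ?_
    rw [supp_reflect, neg_sub]
    exact h3 x y
  have hFg : ∀ x ∈ frontier U, F x = g x := fun x hx => by
    refine le_antisymm (le_of_forall_pos_le_add fun η hη => ?_)
      (le_of_forall_pos_le_add fun η hη => ?_)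
    · obtain ⟨ε, h1, h2⟩ := ((hF.ge x (frontier_subset_closure hx) η hη).and_eventually
        (self_mem_nhdsWithin (a := (0 : ℝ)) (s := Ioi 0))).exists
      rw [hg ε h2 x hx] at h1
      linarith
    · obtain ⟨ε, h1, h2⟩ := ((hF.le x (frontier_subset_closure hx) η hη).and
        (self_mem_nhdsWithin (a := (0 : ℝ)) (s := Ioi 0))).exists
      rwa [hg ε h2 x hx] at h1
  have hF'g : ∀ x ∈ frontier U, F' x = -g x := fun x hx => by
    refine le_antisymm (le_of_forall_pos_le_add fun η hη => ?_)
      (le_of_forall_pos_le_add fun η hη => ?_)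
    · obtain ⟨ε, h1, h2⟩ := ((hF'.ge x (frontier_subset_closure hx) η hη).and_eventually
        (self_mem_nhdsWithin (a := (0 : ℝ)) (s := Ioi 0))).exists
      rw [hg ε h2 x hx] at h1
      linarith
    · obtain ⟨ε, h1, h2⟩ := ((hF'.le x (frontier_subset_closure hx) η hη).and
        (self_mem_nhdsWithin (a := (0 : ℝ)) (s := Ioi 0))).exists
      rwa [hg ε h2 x hx] at h1
  have hle : ∀ x ∈ closure U, F x ≤ -F' x :=
    hH.comparison hU hUb hFc hF'c.neg hus (by simpa using hvs) fun x hx => by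
      rw [hFg x hx, hF'g x hx, neg_neg]
  have hge : ∀ x ∈ closure U, -F' x ≤ F x := fun x hx => by
    refine le_of_forall_pos_le_add fun η hη => ?_
    obtain ⟨ε, h1, h2⟩ := ((hF.le x hx (η / 2) (by positivity)).and
      (hF'.le x hx (η / 2) (by positivity))).exists
    linarith
  have hFF : ∀ x ∈ closure U, F' x = -F x := fun x hx => by linarith [hle x hx, hge x hx]
  refine ⟨F, hFc, hH.absMin hU hUb hFc hus fun k hk => (hvs k hk).congr fun x hx =>
    hFF x (subset_closure hx), hFg, ?_⟩
  have hcpt : IsCompact (closure U) := hUb.isCompact_closure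
  have hFu : ∀ η > 0, ∃ δ > 0, ∀ x ∈ closure U, ∀ y ∈ closure U, dist x y < δ →
      |F x - F y| ≤ η := fun η hη => by
    obtain ⟨δ, hδ, h⟩ := Metric.uniformContinuousOn_iff.1
      (hcpt.uniformContinuousOn_of_continuous hFc) η hη
    exact ⟨δ, hδ, fun x hx y hy hxy => (h x hx y hy hxy).le⟩
  rw [Metric.tendstoUniformlyOn_iff]
  intro η hη
  have e1 := eventually_forall_le_of_compact hcpt subset_rfl (f := f) (G := fun _ => F)
    (fun η hη => by
      obtain ⟨δ, hδ, h⟩ := heq η hη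
      refine ⟨δ, hδ, fun ε hε x hx y hy hxy => ?_⟩
      linarith [(abs_le.1 (h ε hε x hx y hy hxy)).2])
    (fun η hη => by
      obtain ⟨δ, hδ, h⟩ := hFu η hη
      refine ⟨δ, hδ, fun ε hε x hx y hy hxy => ?_⟩
      linarith [(abs_le.1 (h x hx y hy hxy)).2]) (fun x hx η hη => hF.le x hx η hη)
    (half_pos hη)
  have e2 := eventually_forall_le_of_compact hcpt subset_rfl (f := fun _ => F) (G := f)
    (fun η hη => by
      obtain ⟨δ, hδ, h⟩ := hFu η hη
      refine ⟨δ, hδ, fun ε hε x hx y hy hxy => ?_⟩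
      linarith [(abs_le.1 (h x hx y hy hxy)).2])
    (fun η hη => by
      obtain ⟨δ, hδ, h⟩ := heq η hη
      refine ⟨δ, hδ, fun ε hε x hx y hy hxy => ?_⟩
      linarith [(abs_le.1 (h ε hε x hx y hy hxy)).2])
    (fun x hx η hη => (hF'.le x hx η hη).mono fun ε h => by
      rw [hFF x hx] at h; linarith)
    (half_pos hη)
  filter_upwards [e1, e2] with ε h1 h2 x hx
  rw [Real.dist_eq, abs_lt]
  constructor <;> linarith [h1 x hx, h2 x hx]

end Limit

section Greedy

theorem greedy_count {a e : ℕ → ENNReal} {K : ℕ} {l : ENNReal} (he : ∀ i, e i ≤ 1)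
    (h : ∀ i, e i ≠ 0 → ∃ L : ℕ, 1 ≤ L ∧ L ≤ K ∧ l * L ≤ ∑ k ∈ Finset.range L, a (i + k)) :
    ∀ m i, l * ∑ k ∈ Finset.range m, e (i + k) ≤ ∑ k ∈ Finset.range (m + K), a (i + k) := by
  intro m
  induction m using Nat.strong_induction_on with
  | _ m ih =>
    intro i
    rcases Nat.eq_zero_or_pos m with rfl | hm
    · simp
    by_cases hi : e i = 0
    · obtain ⟨m, rfl⟩ : ∃ m', m = m' + 1 := ⟨m - 1, by omega⟩
      have := ih m (by omega) (i + 1)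
      rw [Finset.sum_range_succ', show m + 1 + K = (m + K) + 1 by omega, Finset.sum_range_succ']
      simp only [add_zero, hi]
      refine (le_of_eq_of_le ?_ this).trans (le_of_eq_of_le ?_ le_self_add)
      · simp only [add_assoc, add_comm 1]
      · simp only [add_assoc, add_comm 1]
    · obtain ⟨L, hL1, hLK, hL⟩ := h i hi
      rcases le_total m L with hmL | hLm
      · calc l * ∑ k ∈ Finset.range m, e (i + k) ≤ l * m := by
              gcongr
              calc _ ≤ ∑ k ∈ Finset.range m, (1 : ENNReal) := Finset.sum_le_sum fun k _ => he _
                _ = m := by simp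
          _ ≤ l * L := by gcongr
          _ ≤ _ := hL
          _ ≤ _ := Finset.sum_le_sum_of_subset (Finset.range_subset_range.2 (by omega))
      · obtain ⟨m', rfl⟩ := Nat.exists_eq_add_of_le hLm
        have := ih m' (by omega) (i + L)
        rw [Finset.sum_range_add, add_assoc, Finset.sum_range_add, mul_add]
        simp only [← add_assoc]
        refine add_le_add ?_ this
        refine le_trans ?_ hL
        gcongr
        calc _ ≤ ∑ k ∈ Finset.range L, (1 : ENNReal) := Finset.sum_le_sum fun k _ => he _
          _ = L := by simp

open Classical in
theorem greedy_cost {c : ℕ → ℕ → ℝ} {bad : ℕ → Prop} {K : ℕ} {a D : ℝ} (hD : 0 ≤ D)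
    (hc : ∀ i k m, c i (k + m) ≤ c i k + c (i + k) m) (hC : ∀ i m, c i m ≤ (a + D) * m)
    (h : ∀ i, ¬ bad i → ∃ L : ℕ, 1 ≤ L ∧ L ≤ K ∧ c i L ≤ a * L) :
    ∀ m i, c i m ≤ a * m + D * ∑ k ∈ Finset.range m, (if bad (i + k) then (1 : ℝ) else 0)
      + D * K := by
  intro m
  induction m using Nat.strong_induction_on with
  | _ m ih =>
    intro i
    have hDK : 0 ≤ D * K := by positivity
    rcases Nat.eq_zero_or_pos m with rfl | hm
    · have := hC i 0
      simp only [Nat.cast_zero, mul_zero, Finset.range_zero, Finset.sum_empty] at this ⊢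
      linarith
    by_cases hi : bad i
    · obtain ⟨m, rfl⟩ : ∃ m', m = m' + 1 := ⟨m - 1, by omega⟩
      have h1 := ih m (by omega) (i + 1)
      have h2 := hc i 1 m
      have h3 := hC i 1
      rw [Finset.sum_range_succ']
      simp only [add_zero, hi, if_true]
      have h4 : ∀ k, i + 1 + k = i + (k + 1) := fun k => by omega
      simp only [h4] at h1
      rw [add_comm 1 m] at h2
      push_cast at h3 ⊢
      linarith
    · obtain ⟨L, hL1, hLK, hL⟩ := h i hi
      rcases lt_or_ge m L with hmL | hLm
      · have h1 := hC i m
        have h2 : (0 : ℝ) ≤ ∑ k ∈ Finset.range m, (if bad (i + k) then (1 : ℝ) else 0) :=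
          Finset.sum_nonneg fun k _ => by positivity
        have h3 : (m : ℝ) ≤ K := by exact_mod_cast (by omega : m ≤ K)
        have h4 := mul_le_mul_of_nonneg_left h3 hD
        have h5 := mul_nonneg hD h2
        linarith
      · obtain ⟨m', rfl⟩ := Nat.exists_eq_add_of_le hLm
        have h1 := ih m' (by omega) (i + L)
        have h2 := hc i L m'
        rw [Finset.sum_range_add]
        have h3 : (0 : ℝ) ≤ ∑ k ∈ Finset.range L, (if bad (i + k) then (1 : ℝ) else 0) :=
          Finset.sum_nonneg fun k _ => by positivity
        have h5 := mul_nonneg hD h3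
        simp only [← add_assoc]
        push_cast
        linarith

end Greedy

section Ergodic
variable {n : ℕ} {Ω : Type*} [MeasurableSpace Ω]

/-- An ergodic measure preserving action of `ℝⁿ`. -/
structure ErgAct (P : Measure Ω) (τ : Ed n → Ω → Ω) : Prop where
  mp : ∀ y, MeasurePreserving (τ y) P P
  grp : ∀ y z ω, τ (y + z) ω = τ y (τ z ω)
  zero : ∀ ω, τ 0 ω = ω
  erg : ∀ D, MeasurableSet D → (∀ z, τ z ⁻¹' D = D) → P D = 0 ∨ P D = 1

variable {P : Measure Ω} [IsProbabilityMeasure P] {τ : Ed n → Ω → Ω}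

theorem le_of_forall_nat_mul_le {a b c : ℝ} (h : ∀ n : ℕ, n * a ≤ n * b + c) : a ≤ b := by
  by_contra! hab
  obtain ⟨n, hn⟩ := exists_nat_gt (c / (a - b))
  rw [div_lt_iff₀ (by linarith)] at hn
  linarith [h n]

open Classical in
theorem ErgAct.maximal (hτ : ErgAct P τ) (x : Ed n) {B : Set Ω} (hB : MeasurableSet B) {l : ℝ}
    (hl : P.real B < l) :
    0 < P {ω | ∀ L : ℕ, 1 ≤ L →
      ∑ k ∈ Finset.range L, (if τ ((k : ℝ) • x) ω ∈ B then (1 : ℝ) else 0) < l * L} := by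
  have hl0 : 0 < l := measureReal_nonneg.trans_lt hl
  set s : ℕ → Ω → ENNReal := fun k ω => B.indicator 1 (τ ((k : ℝ) • x) ω) with hs
  have hsm : ∀ k, Measurable (s k) := fun k =>
    (measurable_one.indicator hB).comp (hτ.mp _).measurable
  have hsi : ∀ k, ∫⁻ ω, s k ω ∂P = P B := fun k => by
    rw [hs, (hτ.mp ((k : ℝ) • x)).lintegral_comp (measurable_one.indicator hB),
      lintegral_indicator_one hB]
  have hss : ∀ (k : ℕ) (i : ℕ) ω, s k (τ ((i : ℝ) • x) ω) = s (i + k) ω := fun k i ω => by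
    rw [hs]
    simp only
    rw [← hτ.grp, ← add_smul, Nat.cast_add, add_comm (k : ℝ)]
  set E : ℕ → Set Ω := fun K => {ω | ∃ L : ℕ, 1 ≤ L ∧ L ≤ K ∧
    ENNReal.ofReal l * L ≤ ∑ k ∈ Finset.range L, s k ω} with hE
  have hEm : ∀ K, MeasurableSet (E K) := fun K => by
    have : E K = ⋃ L ∈ {L : ℕ | 1 ≤ L ∧ L ≤ K},
        {ω | ENNReal.ofReal l * L ≤ ∑ k ∈ Finset.range L, s k ω} := by
      ext ω; simp [hE, and_assoc]
    rw [this]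
    exact MeasurableSet.biUnion (to_countable _) fun L _ => measurableSet_le measurable_const
      (Finset.measurable_fun_sum _ fun k _ => hsm k)
  have hbound : ∀ K, l * P.real (E K) ≤ P.real B := fun K => by
    refine le_of_forall_nat_mul_le (c := K * P.real B) fun N => ?_
    have h1 : ENNReal.ofReal l * (N * P (E K)) ≤ (N + K : ℕ) * P B := by
      have h2 : ∀ k : ℕ, ∫⁻ ω, (E K).indicator 1 (τ ((k : ℝ) • x) ω) ∂P = P (E K) := fun k => by
        rw [(hτ.mp ((k : ℝ) • x)).lintegral_comp (measurable_one.indicator (hEm K)),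
          lintegral_indicator_one (hEm K)]
      have h3 : ∫⁻ ω, ENNReal.ofReal l * ∑ k ∈ Finset.range N,
          (E K).indicator 1 (τ ((k : ℝ) • x) ω) ∂P ≤
          ∫⁻ ω, ∑ k ∈ Finset.range (N + K), s k ω ∂P := by
        refine lintegral_mono fun ω => ?_
        have := greedy_count (a := fun k => s k ω)
          (e := fun k => (E K).indicator 1 (τ ((k : ℝ) • x) ω)) (K := K) (l := ENNReal.ofReal l)
          (fun i => indicator_le_self' (by simp) _)
          (fun i hi => by
            have hi' : τ ((i : ℝ) • x) ω ∈ E K := by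
              by_contra h
              exact hi (indicator_of_notMem h _)
            obtain ⟨L, h1, h2, h3⟩ := hi'
            refine ⟨L, h1, h2, ?_⟩
            simpa only [hss] using h3) N 0
        simpa only [zero_add] using this
      have hm : ∀ k : ℕ, Measurable fun ω => (E K).indicator (1 : Ω → ENNReal)
          (τ ((k : ℝ) • x) ω) := fun k =>
        (measurable_one.indicator (hEm K)).comp (hτ.mp _).measurable
      rw [lintegral_const_mul _ (Finset.measurable_fun_sum _ fun k _ => hm k),
        lintegral_finsetSum _ (fun k _ => hm k), lintegral_finsetSum _ (fun k _ => hsm k)] at h3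
      simpa only [h2, hsi, Finset.sum_const, Finset.card_range, nsmul_eq_mul] using h3
    have h4 := ENNReal.toReal_mono (by finiteness) h1
    simp only [ENNReal.toReal_mul, ENNReal.toReal_ofReal hl0.le, ENNReal.toReal_natCast] at h4
    change l * (N * P.real (E K)) ≤ (N + K : ℕ) * P.real B at h4
    push_cast at h4
    linarith
  have hmono : Monotone E := fun K K' h ω ⟨L, h1, h2, h3⟩ => ⟨L, h1, h2.trans h, h3⟩
  have hU : P.real (⋃ K, E K) ≤ P.real B / l := by
    have := (tendsto_measure_iUnion_atTop (μ := P) hmono)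
    have h2 : Tendsto (fun K => P.real (E K)) atTop (nhds (P.real (⋃ K, E K))) :=
      (ENNReal.tendsto_toReal (measure_ne_top _ _)).comp this
    refine le_of_tendsto' h2 fun K => ?_
    rw [le_div_iff₀ hl0]
    linarith [hbound K]
  have hlt : P.real (⋃ K, E K) < 1 := hU.trans_lt (by rwa [div_lt_one hl0])
  have hpos : 0 < P (⋃ K, E K)ᶜ := by
    rw [pos_iff_ne_zero]
    intro h0
    rw [prob_compl_eq_zero_iff (MeasurableSet.iUnion hEm)] at h0
    simp [Measure.real, h0] at hlt
  refine hpos.trans_le (measure_mono fun ω hω L hL => ?_)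
  by_contra! hc
  refine hω (mem_iUnion.2 ⟨L, L, hL, le_rfl, ?_⟩)
  have h5 : ∑ k ∈ Finset.range L, s k ω = ENNReal.ofReal
      (∑ k ∈ Finset.range L, (if τ ((k : ℝ) • x) ω ∈ B then (1 : ℝ) else 0)) := by
    rw [ENNReal.ofReal_sum_of_nonneg fun _ _ => by positivity]
    refine Finset.sum_congr rfl fun k _ => ?_
    by_cases hk : τ ((k : ℝ) • x) ω ∈ B <;> simp [hs, hk]
  rw [h5, ← ENNReal.ofReal_natCast, ← ENNReal.ofReal_mul hl0.le]
  exact ENNReal.ofReal_le_ofReal hc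

/-- For a bounded sequence, the upper limit is bounded by `r`. -/
theorem limsup_le_iff_eventually {u : ℕ → ℝ} {B r : ℝ} (hB : ∀ N, |u N| ≤ B) :
    limsup u atTop ≤ r ↔ ∀ η > 0, ∀ᶠ N in atTop, u N ≤ r + η := by
  have h1 : IsBoundedUnder (· ≤ ·) atTop u := ⟨B, eventually_map.2 <| .of_forall fun N =>
    (abs_le.1 (hB N)).2⟩
  have h2 : IsBoundedUnder (· ≥ ·) atTop u := ⟨-B, eventually_map.2 <| .of_forall fun N =>
    (abs_le.1 (hB N)).1⟩
  constructor
  · intro h η hη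
    exact (eventually_lt_of_limsup_lt (by linarith : limsup u atTop < r + η) h1).mono
      fun N h => h.le
  · intro h
    refine le_of_forall_pos_le_add fun η hη => ?_
    exact limsup_le_of_le h2.isCoboundedUnder_le (h η hη)

theorem limsup_eq_of_tendsto_sub {u v : ℕ → ℝ} {B : ℝ} (hu : ∀ N, |u N| ≤ B) (hv : ∀ N, |v N| ≤ B)
    (h : Tendsto (fun N => u N - v N) atTop (nhds 0)) : limsup u atTop = limsup v atTop := by
  have key : ∀ {u v : ℕ → ℝ}, (∀ N, |u N| ≤ B) → (∀ N, |v N| ≤ B) →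
      Tendsto (fun N => u N - v N) atTop (nhds 0) → limsup u atTop ≤ limsup v atTop := by
    intro u v hu hv h
    rw [limsup_le_iff_eventually hu]
    intro η hη
    filter_upwards [(limsup_le_iff_eventually hv).1 le_rfl (η / 2) (by positivity),
      h.eventually_lt_const (half_pos hη)] with N h1 h2
    linarith
  refine le_antisymm (key hu hv h) (key hv hu ?_)
  simpa using h.neg

theorem ErgAct.ae_const (hτ : ErgAct P τ) {φ : Ω → ℝ} (hφ : Measurable φ)
    (hinv : ∀ z ω, φ (τ z ω) = φ ω) : ∃ c, ∀ᵐ ω ∂P, φ ω = c := by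
  obtain ⟨c, hc⟩ := exists_eventuallyEq_const_of_forall_separating (l := ae P) (f := φ)
    MeasurableSet fun S hS => by
      have h1 : MeasurableSet (φ ⁻¹' S) := hφ hS
      rcases hτ.erg _ h1 (fun z => by ext ω; simp [hinv]) with h | h
      · exact Or.inr (measure_eq_zero_iff_ae_notMem.1 h)
      · exact Or.inl ((prob_compl_eq_zero_iff h1).2 h)
  exact ⟨c, hc⟩

theorem ErgAct.limsup_const (hτ : ErgAct P τ) {u : ℕ → Ω → ℝ} (hu : ∀ N, Measurable (u N)) {B : ℝ}
    (hB : ∀ N ω, |u N ω| ≤ B)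
    (hinv : ∀ z ω, Tendsto (fun N => u N (τ z ω) - u N ω) atTop (nhds 0)) :
    ∃ c, ∀ᵐ ω ∂P, limsup (fun N => u N ω) atTop = c :=
  hτ.ae_const (Measurable.limsup hu) fun z ω =>
    limsup_eq_of_tendsto_sub (fun N => hB N _) (fun N => hB N _) (hinv z ω)

end Ergodic

section Cocyc
variable {n : ℕ} {Ω : Type*} [MeasurableSpace Ω]

/-- Stationary random asymmetric distances, bounded by a multiple of the norm. -/
structure Cocycle (τ : Ed n → Ω → Ω) (j : ℝ) (f : Ed n → Ed n → Ω → ℝ) : Prop where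
  nonneg : 0 ≤ j
  bdd : ∀ y x ω, |f y x ω| ≤ j * ‖y - x‖
  tri : ∀ x y z ω, f x z ω ≤ f x y ω + f y z ω
  stat : ∀ y x z ω, f y x (τ z ω) = f (y + z) (x + z) ω
  meas : ∀ y x, Measurable (f y x)

variable {P : Measure Ω} [IsProbabilityMeasure P] {τ : Ed n → Ω → Ω} {j : ℝ}
  {f : Ed n → Ed n → Ω → ℝ}

theorem Cocycle.lip (hf : Cocycle τ j f) (y x y' x' : Ed n) (ω : Ω) :
    |f y x ω - f y' x' ω| ≤ j * (‖y - y'‖ + ‖x - x'‖) := by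
  have key : ∀ y x y' x' : Ed n, f y x ω - f y' x' ω ≤ j * (‖y - y'‖ + ‖x - x'‖) := by
    intro y x y' x'
    have h1 := hf.tri y y' x ω
    have h2 := hf.tri y' x' x ω
    have h3 := (abs_le.1 (hf.bdd y y' ω)).2
    have h4 := (abs_le.1 (hf.bdd x' x ω)).2
    rw [norm_sub_rev x' x] at h4
    linarith
  rw [abs_le]
  have h1 := key y x y' x'
  have h2 := key y' x' y x
  rw [norm_sub_rev y' y, norm_sub_rev x' x] at h2
  constructor <;> linarith

theorem abs_div_natCast_le {a b : ℝ} (N : ℕ) (hb : 0 ≤ b) (h : |a| ≤ b * N) : |a / N| ≤ b := by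
  rcases Nat.eq_zero_or_pos N with rfl | hN
  · simpa using hb
  · rw [abs_div, Nat.abs_cast, div_le_iff₀ (by exact_mod_cast hN)]
    exact h

theorem tendsto_const_div_nat (c : ℝ) : Tendsto (fun N : ℕ => c / (N : ℝ)) atTop (nhds 0) :=
  tendsto_const_nhds.div_atTop tendsto_natCast_atTop_atTop

theorem Cocycle.ray_bdd (hf : Cocycle τ j f) (x v : Ed n) (N : ℕ) (ω : Ω) :
    |f ((N : ℝ) • (x + v)) ((N : ℝ) • x) ω / N| ≤ j * ‖v‖ := by
  refine abs_div_natCast_le N (mul_nonneg hf.nonneg (norm_nonneg _)) ((hf.bdd _ _ _).trans_eq ?_)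
  rw [← smul_sub, add_sub_cancel_left, norm_smul, Real.norm_natCast]
  ring

theorem Cocycle.ray_inv (hf : Cocycle τ j f) (x v z : Ed n) (ω : Ω) :
    Tendsto (fun N : ℕ => f ((N : ℝ) • (x + v)) ((N : ℝ) • x) (τ z ω) / N -
      f ((N : ℝ) • (x + v)) ((N : ℝ) • x) ω / N) atTop (nhds 0) := by
  refine squeeze_zero_norm (fun N => ?_) (tendsto_const_div_nat (2 * j * ‖z‖))
  rw [← sub_div, Real.norm_eq_abs, abs_div, Nat.abs_cast]
  gcongr
  rw [hf.stat]
  refine (hf.lip _ _ _ _ ω).trans_eq ?_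
  rw [add_sub_cancel_left, add_sub_cancel_left]
  ring

theorem exists_of_pos_of_ae {P : Measure Ω} {p q : Ω → Prop} (hp : 0 < P {ω | p ω}) (hq : ∀ᵐ ω ∂P, q ω) :
    ∃ ω, p ω ∧ q ω := by
  by_contra! h
  exact hp.ne' (measure_mono_null (fun ω hω => h ω hω) hq)

theorem exists_measureReal_lt_of_antitone {B : ℕ → Set Ω} (hB : ∀ K, MeasurableSet (B K))
    (hanti : Antitone B) (h : ∀ᵐ ω ∂P, ∃ K, ω ∉ B K) {l : ℝ} (hl : 0 < l) :
    ∃ K, P.real (B K) < l := by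
  have h1 := tendsto_measure_iInter_atTop (μ := P) (fun K => (hB K).nullMeasurableSet) hanti
    ⟨0, measure_ne_top _ _⟩
  have h0 : P (⋂ K, B K) = 0 := by
    rw [measure_eq_zero_iff_ae_notMem]
    filter_upwards [h] with ω ⟨K, hK⟩ hω using hK (mem_iInter.1 hω K)
  rw [h0] at h1
  have h2 : Tendsto (fun K => P.real (B K)) atTop (nhds 0) := by
    simpa [Function.comp_def, Measure.real] using
      (ENNReal.tendsto_toReal ENNReal.zero_ne_top).comp h1
  exact (h2.eventually_lt_const hl).exists

theorem Cocycle.exists_lim (hτ : ErgAct P τ) (hf : Cocycle τ j f) (v : Ed n) :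
    ∃ M, ∀ᵐ ω ∂P, Tendsto (fun N : ℕ => f ((N : ℝ) • v) 0 ω / N) atTop (nhds M) := by
  set u : ℕ → Ω → ℝ := fun N ω => f ((N : ℝ) • v) 0 ω / N with hu
  have hB : ∀ N ω, |u N ω| ≤ j * ‖v‖ := fun N ω => by
    simpa using hf.ray_bdd 0 v N ω
  have hinv : ∀ z ω, Tendsto (fun N => u N (τ z ω) - u N ω) atTop (nhds 0) := fun z ω => by
    simpa using hf.ray_inv 0 v z ω
  have hm : ∀ N, Measurable (u N) := fun N => (hf.meas _ _).div_const _
  obtain ⟨b, hb⟩ := hτ.limsup_const hm hB hinv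
  obtain ⟨a', ha'⟩ := hτ.limsup_const (u := fun N ω => - u N ω) (fun N => (hm N).neg)
    (fun N ω => by rw [abs_neg]; exact hB N ω) (fun z ω => by
      have := (hinv z ω).neg
      simp only [neg_zero] at this
      exact this.congr fun N => by ring)
  have hba : b ≤ -a' := by
    refine le_of_forall_pos_le_add fun η' hη' => ?_
    set η := min 1 (η' / 3) with hη
    have hη0 : 0 < η := by positivity
    set D := j * ‖v‖ + |a'| + 1 with hD
    have hD0 : 0 < D := by have := hf.nonneg; positivity
    set B : ℕ → Set Ω := fun K => {ω | ∀ L : ℕ, 1 ≤ L → L ≤ K →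
      (-a' + η) * L < f ((L : ℝ) • v) 0 ω} with hBdef
    have hBm : ∀ K, MeasurableSet (B K) := fun K => by
      simp only [hBdef, ofPred_forall]
      exact .iInter fun L => .iInter fun _ => .iInter fun _ =>
        measurableSet_lt measurable_const (hf.meas _ _)
    have hanti : Antitone B := fun K K' h ω hω L h1 h2 => hω L h1 (h2.trans h)
    have hae : ∀ᵐ ω ∂P, ∃ K, ω ∉ B K := by
      filter_upwards [ha'] with ω hω
      by_contra! hc
      have h1 : ∀ᶠ N in atTop, - u N ω ≤ (a' - η) := by
        filter_upwards [eventually_ge_atTop 1] with N hN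
        have h2 := hc N N hN le_rfl
        have h3 : (0 : ℝ) < N := by exact_mod_cast hN
        have h4 : -a' + η < u N ω := by rw [hu]; simp only; rwa [lt_div_iff₀ h3]
        linarith
      have h5 : limsup (fun N => - u N ω) atTop ≤ a' - η :=
        (limsup_le_iff_eventually (B := j * ‖v‖)
          (fun N => by rw [abs_neg]; exact hB N ω)).2 fun κ hκ => h1.mono fun N h => by linarith
      linarith
    obtain ⟨K, hK⟩ := exists_measureReal_lt_of_antitone hBm hanti hae (l := η / D) (by positivity)
    obtain ⟨ω, hω, hbω⟩ := exists_of_pos_of_ae (hτ.maximal v (hBm K) hK) hb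
    rw [← hbω, limsup_le_iff_eventually (fun N => hB N ω)]
    intro κ hκ
    filter_upwards [eventually_ge_atTop 1,
      (tendsto_const_div_nat (D * K)).eventually_lt_const hκ] with N hN hNK
    have hN0 : (0 : ℝ) < N := by exact_mod_cast hN
    classical
    have hg := greedy_cost (c := fun i k => f ((i + k : ℝ) • v) ((i : ℝ) • v) ω)
      (bad := fun i => τ ((i : ℝ) • v) ω ∈ B K) (K := K) (a := -a' + η) (D := D) hD0.le
      (fun i k m => by
        have := hf.tri ((i + k + m : ℝ) • v) ((i + k : ℝ) • v) ((i : ℝ) • v) ω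
        push_cast
        rw [← add_assoc]
        linarith)
      (fun i m => by
        refine (le_abs_self _).trans ((hf.bdd _ _ _).trans ?_)
        rw [← sub_smul, norm_smul, add_sub_cancel_left, Real.norm_natCast]
        have h1 : j * ‖v‖ ≤ -a' + η + D := by linarith [le_abs_self a']
        nlinarith)
      (fun i hi => by
        simp only [hBdef, Set.mem_ofPred_eq] at hi
        push Not at hi
        obtain ⟨L, h1, h2, h3⟩ := hi
        refine ⟨L, h1, h2, ?_⟩
        rw [hf.stat, zero_add, ← add_smul] at h3
        rwa [add_comm (i : ℝ)]) N 0
    have hω' := hω N hN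
    simp only [zero_add, Nat.cast_zero, zero_smul] at hg
    have h6 : D * ∑ k ∈ Finset.range N, (if τ ((k : ℝ) • v) ω ∈ B K then (1 : ℝ) else 0) ≤
        η * N := by
      calc _ ≤ D * (η / D * N) := by
            refine mul_le_mul_of_nonneg_left ?_ hD0.le
            convert hω'.le
        _ = η * N := by field_simp
    rw [div_lt_iff₀ hN0] at hNK
    rw [hu]
    simp only
    rw [div_le_iff₀ hN0]
    have h7 : η ≤ η' / 3 := min_le_right _ _
    nlinarith
  refine ⟨b, ?_⟩
  filter_upwards [hb, ha'] with ω h1 h2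
  rw [Metric.tendsto_nhds]
  intro η hη
  filter_upwards [(limsup_le_iff_eventually (fun N => hB N ω)).1 h1.le (η / 2) (by positivity),
    (limsup_le_iff_eventually (u := fun N => - u N ω) (B := j * ‖v‖)
      (fun N => by rw [abs_neg]; exact hB N ω)).1 h2.le (η / 2) (by positivity)] with N h3 h4
  rw [Real.dist_eq, abs_lt]
  constructor <;> linarith

theorem Cocycle.lim_moving (hτ : ErgAct P τ) (hf : Cocycle τ j f) {v : Ed n} {M : ℝ}
    (hM : ∀ᵐ ω ∂P, Tendsto (fun N : ℕ => f ((N : ℝ) • v) 0 ω / N) atTop (nhds M)) (x : Ed n) :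
    ∀ᵐ ω ∂P, Tendsto (fun N : ℕ => f ((N : ℝ) • (x + v)) ((N : ℝ) • x) ω / N) atTop (nhds M) := by
  set u : ℕ → Ω → ℝ := fun N ω => |f ((N : ℝ) • (x + v)) ((N : ℝ) • x) ω / N - M| with hu
  have hB : ∀ N ω, |u N ω| ≤ j * ‖v‖ + |M| := fun N ω => by
    rw [hu]
    simp only [abs_abs]
    exact (abs_sub _ _).trans (by gcongr; exact hf.ray_bdd x v N ω)
  have hm : ∀ N, Measurable (u N) := fun N =>
    (((hf.meas _ _).div_const _).sub_const _).abs
  obtain ⟨c, hc⟩ := hτ.limsup_const hm hB (fun z ω => by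
    refine squeeze_zero_norm (fun N => ?_)
      (by have := (hf.ray_inv x v z ω).abs; rwa [abs_zero] at this)
    refine (abs_abs_sub_abs_le _ _).trans_eq ?_
    rw [sub_sub_sub_cancel_right])
  have hc0 : c ≤ 0 := by
    refine le_of_forall_pos_le_add fun η' hη' => ?_
    obtain ⟨η, hη0, hη⟩ : ∃ η > 0, 3 * η ≤ η' := ⟨η' / 3, by positivity, by linarith⟩
    have hj := hf.nonneg
    set C := 2 * j * ‖x‖ with hC
    have hC0 : 0 ≤ C := by positivity
    set l := min 1 (η / (C + 1)) with hl
    have hl0 : 0 < l := by positivity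
    have hl1 : l ≤ 1 := min_le_left _ _
    have hCl : C * l ≤ η := by
      have : l ≤ η / (C + 1) := min_le_right _ _
      rw [le_div_iff₀ (by positivity)] at this
      nlinarith
    set B : ℕ → Set Ω := fun K => {ω | ∃ N : ℕ, K ≤ N ∧ η < |f ((N : ℝ) • v) 0 ω / N - M|}
      with hBdef
    have hBm : ∀ K, MeasurableSet (B K) := fun K => by
      simp only [hBdef, ofPred_exists, ofPred_and]
      exact .iUnion fun L => (MeasurableSet.const _).inter <|
        measurableSet_lt measurable_const (((hf.meas _ _).div_const _).sub_const _).abs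
    have hanti : Antitone B := fun K K' h ω ⟨N, h1, h2⟩ => ⟨N, h.trans h1, h2⟩
    have hae : ∀ᵐ ω ∂P, ∃ K, ω ∉ B K := by
      filter_upwards [hM] with ω hω
      obtain ⟨K, hK⟩ := eventually_atTop.1 ((Metric.tendsto_nhds.1 hω) η hη0)
      refine ⟨K, fun ⟨N, h1, h2⟩ => ?_⟩
      exact absurd (hK N h1) (by rw [Real.dist_eq]; exact not_lt.2 h2.le)
    obtain ⟨K, hK⟩ := exists_measureReal_lt_of_antitone hBm hanti hae hl0
    obtain ⟨ω, hω, hcω⟩ := exists_of_pos_of_ae (hτ.maximal x (hBm K) hK) hc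
    rw [← hcω, limsup_le_iff_eventually (fun N => hB N ω)]
    intro κ hκ
    filter_upwards [eventually_ge_atTop 1, eventually_ge_atTop K,
      (tendsto_const_div_nat C).eventually_lt_const hη0] with N hN hNK hNC
    have hN0 : (0 : ℝ) < N := by exact_mod_cast hN
    classical
    obtain ⟨k, hkN, hk1, hk2⟩ : ∃ k : ℕ, k < N ∧ (N : ℝ) - k ≤ l * N + 1 ∧
        τ ((k : ℝ) • x) ω ∉ B K := by
      by_contra! hcon
      have h1 := hω N hN
      set m := ⌈l * N⌉₊ with hmdef
      have hmN : m ≤ N := Nat.ceil_le.2 (by nlinarith)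
      have hm1 : (m : ℝ) < l * N + 1 := Nat.ceil_lt_add_one (by positivity)
      have hm2 : l * N ≤ m := Nat.le_ceil _
      have h2 : (m : ℝ) ≤ ∑ k ∈ Finset.range N,
          (if τ ((k : ℝ) • x) ω ∈ B K then (1 : ℝ) else 0) := by
        rw [Finset.sum_boole, Nat.cast_le]
        calc m = (Finset.Ico (N - m) N).card := by rw [Nat.card_Ico]; omega
          _ ≤ _ := Finset.card_le_card fun k hk => by
            rw [Finset.mem_Ico] at hk
            refine Finset.mem_filter.2 ⟨Finset.mem_range.2 hk.2, hcon k hk.2 ?_⟩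
            have : (N : ℝ) ≤ m + k := by exact_mod_cast (by omega : N ≤ m + k)
            linarith
      have h3 : (m : ℝ) < l * N := by
        refine h2.trans_lt ?_
        convert h1
      linarith
    have h4 : |f ((N : ℝ) • v) 0 (τ ((k : ℝ) • x) ω) / N - M| ≤ η := by
      by_contra! h
      exact hk2 ⟨N, hNK, h⟩
    rw [hf.stat, zero_add] at h4
    have h5 := hf.lip ((N : ℝ) • (x + v)) ((N : ℝ) • x) ((N : ℝ) • v + (k : ℝ) • x) ((k : ℝ) • x) ω
    have h6 : (N : ℝ) • (x + v) - ((N : ℝ) • v + (k : ℝ) • x) = ((N : ℝ) - k) • x := by module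
    have hkN' : (k : ℝ) ≤ N := by exact_mod_cast hkN.le
    rw [h6, ← sub_smul, norm_smul, Real.norm_of_nonneg (by linarith)] at h5
    have h7 : |f ((N : ℝ) • (x + v)) ((N : ℝ) • x) ω / N -
        f ((N : ℝ) • v + (k : ℝ) • x) ((k : ℝ) • x) ω / N| ≤ C * l + C / N := by
      rw [← sub_div, abs_div, Nat.abs_cast, div_le_iff₀ hN0]
      refine h5.trans ?_
      have h8 : C / N * N = C := by field_simp
      rw [add_mul, h8]
      have := mul_le_mul_of_nonneg_left hk1 hC0
      rw [hC] at this ⊢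
      nlinarith
    have h9 := abs_sub_le (f ((N : ℝ) • (x + v)) ((N : ℝ) • x) ω / N)
      (f ((N : ℝ) • v + (k : ℝ) • x) ((k : ℝ) • x) ω / N) M
    rw [hu]
    simp only
    linarith
  filter_upwards [hc] with ω h1
  rw [Metric.tendsto_nhds]
  intro η hη
  filter_upwards [(limsup_le_iff_eventually (fun N => hB N ω)).1 (h1.le.trans hc0) (η / 2)
    (by positivity)] with N h3
  rw [Real.dist_eq]
  simp only [hu] at h3
  linarith

theorem Cocycle.exists_homogenized (hτ : ErgAct P τ) (hf : Cocycle τ j f) :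
    ∃ M : Ed n → ℝ, ∀ᵐ ω ∂P, ∀ x v : Ed n, ∀ η > 0, ∀ᶠ t : ℝ in atTop,
      |f (t • (x + v)) (t • x) ω - t * M v| ≤ η * t := by
  choose M hM using fun v => hf.exists_lim hτ v
  have hj := hf.nonneg
  have hlip : ∀ v v', |M v - M v'| ≤ j * ‖v - v'‖ := fun v v' => by
    obtain ⟨ω, h1, h2⟩ := ((hM v).and (hM v')).exists
    refine le_of_tendsto (h1.sub h2).abs (.of_forall fun N => ?_)
    rw [← sub_div]
    refine abs_div_natCast_le N (by positivity) ((hf.lip _ _ _ _ ω).trans_eq ?_)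
    rw [← smul_sub, norm_smul, Real.norm_natCast]
    simp
    ring
  obtain ⟨D, hDc, hDd⟩ := TopologicalSpace.exists_countable_dense (Ed n)
  refine ⟨M, ?_⟩
  have hall : ∀ᵐ ω ∂P, ∀ x ∈ D, ∀ v ∈ D,
      Tendsto (fun N : ℕ => f ((N : ℝ) • (x + v)) ((N : ℝ) • x) ω / N) atTop (nhds (M v)) :=
    (ae_ball_iff hDc).2 fun x _ => (ae_ball_iff hDc).2 fun v _ => hf.lim_moving hτ (hM v) x
  filter_upwards [hall] with ω hω x v η hη
  set δ := η / (2 * (4 * j + 1)) with hδ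
  have hδ0 : 0 < δ := by positivity
  obtain ⟨x', hx', hxx⟩ := hDd.exists_dist_lt x hδ0
  obtain ⟨v', hv', hvv⟩ := hDd.exists_dist_lt v hδ0
  rw [dist_eq_norm] at hxx hvv
  obtain ⟨N₀, hN₀⟩ := eventually_atTop.1 ((Metric.tendsto_nhds.1 (hω x' hx' v' hv')) δ hδ0)
  set C := j * (‖x + v‖ + ‖x‖) + |M v| with hC
  have hC0 : 0 ≤ C := by positivity
  filter_upwards [eventually_ge_atTop ((N₀ : ℝ) + 1), eventually_ge_atTop (1 : ℝ),
    eventually_ge_atTop (2 * C / η)] with t ht1 ht2 ht3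
  have ht0 : 0 ≤ t := by linarith
  set N := ⌊t⌋₊ with hN
  have hNt : (N : ℝ) ≤ t := Nat.floor_le ht0
  have htN : t < N + 1 := Nat.lt_floor_add_one t
  have hNN : N₀ ≤ N := Nat.le_floor (by linarith)
  have hN1 : 1 ≤ N := Nat.le_floor (by simpa using ht2)
  have hN0 : (0 : ℝ) < N := by exact_mod_cast hN1
  have h1 : |f ((N : ℝ) • (x' + v')) ((N : ℝ) • x') ω - N * M v'| ≤ δ * N := by
    have h := (hN₀ N hNN).le
    rw [Real.dist_eq] at h
    have h' : f ((N : ℝ) • (x' + v')) ((N : ℝ) • x') ω - N * M v' =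
        N * (f ((N : ℝ) • (x' + v')) ((N : ℝ) • x') ω / N - M v') := by field_simp
    rw [h', abs_mul, Nat.abs_cast, mul_comm]
    gcongr
  have h2 := hf.lip (t • (x + v)) (t • x) ((N : ℝ) • (x' + v')) ((N : ℝ) • x') ω
  have hgen : ∀ a a' : Ed n, ‖t • a - (N : ℝ) • a'‖ ≤ ‖a‖ + t * ‖a - a'‖ := fun a a' => by
    have : t • a - (N : ℝ) • a' = (t - N) • a + (N : ℝ) • (a - a') := by module
    rw [this]
    refine (norm_add_le _ _).trans ?_
    rw [norm_smul, norm_smul, Real.norm_natCast, Real.norm_of_nonneg (by linarith)]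
    have e1 : (t - N) * ‖a‖ ≤ 1 * ‖a‖ := by gcongr; linarith
    have e2 : N * ‖a - a'‖ ≤ t * ‖a - a'‖ := by gcongr
    linarith
  have h3 := hgen (x + v) (x' + v')
  have h4 := hgen x x'
  have h5 : ‖x + v - (x' + v')‖ ≤ 2 * δ := by
    rw [add_sub_add_comm]
    exact (norm_add_le _ _).trans (by linarith)
  have h6 : |f (t • (x + v)) (t • x) ω - f ((N : ℝ) • (x' + v')) ((N : ℝ) • x') ω| ≤
      j * (‖x + v‖ + ‖x‖) + t * (3 * j * δ) := by
    refine h2.trans ?_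
    calc _ ≤ j * ((‖x + v‖ + t * (2 * δ)) + (‖x‖ + t * δ)) := by
          gcongr
          · exact h3.trans (by gcongr)
          · exact h4.trans (by gcongr)
      _ = _ := by ring
  have h7 : |N * M v' - t * M v| ≤ |M v| + t * (j * δ) := by
    have : N * M v' - t * M v = -((t - N) * M v) - N * (M v - M v') := by ring
    rw [this]
    refine (abs_sub _ _).trans ?_
    rw [abs_neg, abs_mul, abs_mul, Nat.abs_cast, abs_of_nonneg (by linarith : 0 ≤ t - N)]
    have e1 : (t - N) * |M v| ≤ 1 * |M v| := by gcongr; linarith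
    have e2 : N * |M v - M v'| ≤ t * (j * δ) := by
      gcongr
      exact (hlip v v').trans (by gcongr)
    linarith
  have h8 : |f (t • (x + v)) (t • x) ω - t * M v| ≤ C + t * ((4 * j + 1) * δ) := by
    have e1 := abs_sub_le (f (t • (x + v)) (t • x) ω)
      (f ((N : ℝ) • (x' + v')) ((N : ℝ) • x') ω) (t * M v)
    have e2 := abs_sub_le (f ((N : ℝ) • (x' + v')) ((N : ℝ) • x') ω) (N * M v') (t * M v)
    have e3 : δ * N ≤ t * δ := by rw [mul_comm]; gcongr
    rw [hC]
    linarith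
  have h9 : (4 * j + 1) * δ = η / 2 := by rw [hδ]; field_simp
  rw [h9] at h8
  rw [div_le_iff₀ hη] at ht3
  linarith

end Cocyc

section Affine
variable {n : ℕ} {G : Ed n → Ed n → ℝ} {μ : ℝ} {w : Ed n → ℝ}

theorem ae_affine {p : Ed n → Prop} (hp : ∀ᵐ y ∂(volume : Measure (Ed n)), p y) {s : ℝ}
    (hs : 0 < s) (z : Ed n) : ∀ᵐ y ∂(volume : Measure (Ed n)), p (s • y + z) := by
  have h1 : Measure.QuasiMeasurePreserving (fun y : Ed n => s • y) volume volume := by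
    refine ⟨measurable_const_smul s, ?_⟩
    rw [Measure.map_addHaar_smul _ hs.ne']
    exact Measure.smul_absolutelyContinuous
  have h2 : Measure.QuasiMeasurePreserving (fun y : Ed n => y + z) volume volume :=
    (measurePreserving_add_right volume z).quasiMeasurePreserving
  exact (h2.comp h1).ae hp

theorem IsSub.affine (hw : IsSub G μ w) {s : ℝ} (hs : 0 < s) (z : Ed n) :
    IsSub (fun p y => G p (s • y + z)) μ fun y => s⁻¹ * w (s • y + z) := by
  obtain ⟨⟨K, hK⟩, hae⟩ := hw
  refine ⟨⟨K, LipschitzWith.of_dist_le_mul fun x y => ?_⟩, ?_⟩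
  · have h := hK.dist_le_mul (s • x + z) (s • y + z)
    rw [Real.dist_eq] at h ⊢
    rw [← mul_sub, abs_mul, abs_of_pos (inv_pos.2 hs), inv_mul_le_iff₀ hs]
    refine h.trans_eq ?_
    rw [dist_add_right, dist_smul₀, Real.norm_of_nonneg hs.le]
    ring
  · filter_upwards [ae_affine hae hs z, ae_affine hK.ae_differentiableAt hs z] with y h1 h2
    have h3 : HasFDerivAt (fun y : Ed n => s • y + z) (s • ContinuousLinearMap.id ℝ (Ed n)) y :=
      ((hasFDerivAt_id y).const_smul s).add_const z
    have h4 : HasFDerivAt (fun y => s⁻¹ * w (s • y + z)) (fderiv ℝ w (s • y + z)) y := by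
      have := (h2.hasFDerivAt.comp y h3).const_mul s⁻¹
      exact this.congr_fderiv (by ext v; simp [hs.ne'])
    have h5 : gradient (fun y => s⁻¹ * w (s • y + z)) y = gradient w (s • y + z) := by
      rw [gradient, gradient, h4.fderiv]
    rw [h5]
    exact h1

theorem met_affine (G : Ed n → Ed n → ℝ) (μ : ℝ) {s : ℝ} (hs : 0 < s) (z y x : Ed n) :
    met (fun p y => G p (s • y + z)) μ y x = s⁻¹ * met G μ (s • y + z) (s • x + z) := by
  unfold met
  rw [← smul_eq_mul, ← Real.sSup_smul_of_nonneg (inv_nonneg.2 hs.le)]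
  congr 1
  ext a
  simp only [Set.mem_smul_set, smul_eq_mul]
  constructor
  · rintro ⟨w, hw, rfl⟩
    have h := hw.affine (inv_pos.2 hs) (-(s⁻¹ • z))
    have e : ∀ y : Ed n, s • (s⁻¹ • y + -(s⁻¹ • z)) + z = y := fun y => by
      rw [smul_add, smul_neg, smul_inv_smul₀ hs.ne', smul_inv_smul₀ hs.ne', neg_add_cancel_right]
    have e' : ∀ y : Ed n, s⁻¹ • (s • y + z) + -(s⁻¹ • z) = y := fun y => by
      rw [smul_add, inv_smul_smul₀ hs.ne', add_neg_cancel_right]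
    simp only [e, inv_inv] at h
    refine ⟨_, ⟨_, h, rfl⟩, ?_⟩
    simp only [e']
    field_simp
  · rintro ⟨_, ⟨w, hw, rfl⟩, rfl⟩
    exact ⟨_, hw.affine hs z, by ring⟩

theorem exists_isSub_affine (h : ∃ w, IsSub G μ w) {s : ℝ} (hs : 0 < s) (z : Ed n) :
    ∃ w, IsSub (fun p y => G p (s • y + z)) μ w :=
  let ⟨_, hw⟩ := h
  ⟨_, hw.affine hs z⟩

theorem Reg.affine {j : ℝ} (hG : Reg G μ j) {s : ℝ} (hs : 0 < s) (z : Ed n) :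
    Reg (fun p y => G p (s • y + z)) μ j where
  nonneg := hG.nonneg
  conv y := hG.conv _
  cont y := hG.cont _
  coer p y h := hG.coer p _ h
  equi δ hδ := by
    obtain ⟨r, hr, h⟩ := hG.equi δ hδ
    refine ⟨r / s, by positivity, fun p y z' hp hyz => h p _ _ hp ?_⟩
    rw [dist_add_right, dist_smul₀, Real.norm_of_nonneg hs.le]
    rwa [lt_div_iff₀' hs] at hyz

end Affine

section Chains

/-- Costs of chains of `k` steps starting at the index `x`. -/
def ChainCost (E : ℕ → ℕ → ℚ → Prop) (x : ℕ) : ℕ → ℕ → ℚ → Prop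
  | 0, y, c => y = x ∧ c = 0
  | k + 1, y, c => ∃ (z : ℕ) (c' : ℚ), ChainCost E x k z (c - c') ∧ E z y c'

theorem measurableSet_chainCost {Ω : Type*} [MeasurableSpace Ω] {E : Ω → ℕ → ℕ → ℚ → Prop}
    (hE : ∀ z y c, MeasurableSet {ω | E ω z y c}) (x : ℕ) :
    ∀ k y c, MeasurableSet {ω | ChainCost (E ω) x k y c} := by
  intro k
  induction k with
  | zero => intro y c; exact MeasurableSet.const _
  | succ k ih =>
    intro y c
    simp only [ChainCost, ofPred_exists, ofPred_and]
    exact .iUnion fun z => .iUnion fun c' => (ih z _).inter (hE z y c')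

variable {n : ℕ} {G : Ed n → Ed n → ℝ} {μ j : ℝ}

/-- Admissible steps between the points of a dense sequence. -/
def Step (G : Ed n → Ed n → ℝ) (μ j : ℝ) (r : ℕ → ℝ) (z y : ℕ) (c : ℚ) : Prop :=
  (∃ m : ℕ, dist (TopologicalSpace.denseSeq (Ed n) z) (TopologicalSpace.denseSeq (Ed n) y) < r m ∧
    Edge G (μ + 1 / (m + 1)) (TopologicalSpace.denseSeq (Ed n) z)
      (TopologicalSpace.denseSeq (Ed n) y) c) ∨
  j * ‖TopologicalSpace.denseSeq (Ed n) y - TopologicalSpace.denseSeq (Ed n) z‖ ≤ c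

theorem exists_isSub_iff (hG : Reg G μ j) {r : ℕ → ℝ} (hr0 : ∀ m, 0 < r m)
    (hr : ∀ (m : ℕ) p y z, ‖p‖ ≤ j → dist y z < r m → |G p y - G p z| ≤ 1 / (m + 1) / 2)
    (x y : ℕ) (a : ℝ) :
    (∃ w, IsSub G μ w ∧ a ≤ w (TopologicalSpace.denseSeq (Ed n) y) -
      w (TopologicalSpace.denseSeq (Ed n) x)) ↔
    ∀ k c, ChainCost (Step G μ j r) x k y c → a ≤ c := by
  set d := TopologicalSpace.denseSeq (Ed n) with hd
  constructor
  · rintro ⟨w, hw, ha⟩ k c hc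
    have key : ∀ k y c, ChainCost (Step G μ j r) x k y c → w (d y) - w (d x) ≤ c := by
      intro k
      induction k with
      | zero => rintro y c ⟨rfl, rfl⟩; simp
      | succ k ih =>
        rintro y c ⟨z, c', h1, h2⟩
        have h3 := ih z _ h1
        have h4 : w (d y) - w (d z) ≤ c' := by
          rcases h2 with ⟨m, h5, h6⟩ | h5
          · exact hw.edge hG (by positivity) (hr m) (by rwa [dist_comm]) h6
          · exact (hw.le_norm hG _ _).trans h5
        push_cast at h3
        linarith
    exact ha.trans (key k y c hc)
  · intro h
    set S : ℕ → Set ℝ := fun i => {b | ∃ k c, ChainCost (Step G μ j r) x k i c ∧ b = c} with hS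
    have hSne : ∀ i, (S i).Nonempty := fun i => by
      obtain ⟨q, hq⟩ := exists_rat_gt (j * ‖d i - d x‖)
      exact ⟨q, 1, q, ⟨x, q, ⟨rfl, sub_self q⟩, Or.inr hq.le⟩, rfl⟩
    have hSb : ∀ i, BddBelow (S i) := fun i => by
      obtain ⟨q, hq⟩ := exists_rat_gt (j * ‖d y - d i‖)
      refine ⟨a - q, ?_⟩
      rintro _ ⟨k, c, hc, rfl⟩
      have := h (k + 1) (c + q) ⟨i, q, by simpa using hc, Or.inr hq.le⟩
      push_cast at this
      linarith
    set W : ℕ → ℝ := fun i => sInf (S i) with hW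
    have hstep : ∀ i k (c : ℚ), Step G μ j r i k c → W k - W i ≤ c := fun i k c hc => by
      have : W k - c ≤ W i := le_csInf (hSne i) (by
        rintro _ ⟨m, c', hc', rfl⟩
        have : W k ≤ ((c' + c : ℚ) : ℝ) :=
          csInf_le (hSb k) ⟨m + 1, c' + c, ⟨i, c, by simpa using hc', hc⟩, rfl⟩
        push_cast at this
        linarith)
      linarith
    have hWlip : ∀ i k, W k - W i ≤ j * ‖d k - d i‖ := fun i k => by
      refine le_of_forall_gt_imp_ge_of_dense fun b hb => ?_
      obtain ⟨q, hq1, hq2⟩ := exists_rat_btwn hb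
      exact (hstep i k q (Or.inr hq1.le)).trans hq2.le
    set w : Ed n → ℝ := fun z => ⨅ i, (W i + j * ‖z - d i‖) with hw
    have hbdd : ∀ z, BddBelow (range fun i => W i + j * ‖z - d i‖) := fun z => by
      refine ⟨W 0 - j * ‖d 0 - z‖, ?_⟩
      rintro _ ⟨i, rfl⟩
      have h1 := hWlip i 0
      have h2 : j * ‖d 0 - d i‖ ≤ j * (‖d 0 - z‖ + ‖z - d i‖) :=
        mul_le_mul_of_nonneg_left (norm_sub_le_norm_sub_add_norm_sub _ _ _) hG.nonneg
      simp only
      linarith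
    have hwd : ∀ i, w (d i) = W i := fun i => by
      refine le_antisymm ?_ (le_ciInf fun k => ?_)
      · exact (ciInf_le (hbdd _) i).trans (by simp)
      · linarith [hWlip k i]
    have hwlip : ∀ y z, w y - w z ≤ j * ‖y - z‖ := fun y z => by
      have : w y - j * ‖y - z‖ ≤ w z := le_ciInf fun i => by
        have h1 : w y ≤ _ := ciInf_le (hbdd y) i
        have h2 : j * ‖y - d i‖ ≤ j * (‖y - z‖ + ‖z - d i‖) :=
          mul_le_mul_of_nonneg_left (norm_sub_le_norm_sub_add_norm_sub _ _ _) hG.nonneg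
        linarith
      linarith
    refine ⟨w, ?_, ?_⟩
    · refine isSub_of_edge hG (TopologicalSpace.denseRange_denseSeq (Ed n)) hwlip fun δ hδ => ?_
      obtain ⟨m, hm⟩ := exists_nat_one_div_lt hδ
      refine ⟨r m, hr0 m, ?_⟩
      rintro _ ⟨i, rfl⟩ _ ⟨k, rfl⟩ hik c hc
      change w (d k) - w (d i) ≤ c
      rw [hwd, hwd]
      refine le_of_forall_gt_imp_ge_of_dense fun b hb => ?_
      obtain ⟨q, hq1, hq2⟩ := exists_rat_btwn hb
      refine (hstep i k q (Or.inl ⟨m, ?_, fun p hp => ?_⟩)).trans hq2.le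
      · rwa [dist_comm]
      · exact (hc p (by linarith)).trans hq1.le
    · rw [hwd, hwd]
      have h1 : a ≤ W y := le_csInf (hSne y) (by
        rintro _ ⟨k, c, hc, rfl⟩
        exact h k c hc)
      have h2 : W x ≤ 0 := csInf_le (hSb x) ⟨0, 0, ⟨rfl, rfl⟩, by simp⟩
      linarith

end Chains

/-- A stationary ergodic environment of convex, coercive, equicontinuous Hamiltonians. -/
structure Env {n : ℕ} {Ω : Type*} [MeasurableSpace Ω] (P : Measure Ω) (τ : Ed n → Ω → Ω)
    (H : Ed n → Ed n → Ω → ℝ) : Prop where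
  act : ErgAct P τ
  meas : ∀ p, Measurable (fun q : Ed n × Ω => H p q.1 q.2)
  stat : ∀ p y z ω, H p y (τ z ω) = H p (y + z) ω
  conv : ∀ y ω, ConvexOn ℝ univ (fun p => H p y ω)
  coer : ∀ ω, ∀ C : ℝ, ∃ R : ℝ, ∀ p y, R ≤ ‖p‖ → C ≤ H p y ω
  bdd : ∀ R > (0 : ℝ), ∃ C : ℝ, ∀ ω p y, ‖p‖ < R → |H p y ω| ≤ C
  equi : ∀ R > (0 : ℝ), ∀ ε > (0 : ℝ), ∃ δ > (0 : ℝ), ∀ (ω : Ω) (p₁ p₂ y₁ y₂ : Ed n),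
    ‖p₁‖ < R → ‖p₂‖ < R → dist p₁ p₂ < δ → dist y₁ y₂ < δ → |H p₁ y₁ ω - H p₂ y₂ ω| ≤ ε

section Measurability

variable {n : ℕ} {Ω : Type*} [MeasurableSpace Ω] {P : Measure Ω} {τ : Ed n → Ω → Ω}
  {H : Ed n → Ed n → Ω → ℝ}

theorem Env.continuous (hE : Env P τ H) (ω : Ω) :
    Continuous fun q : Ed n × Ed n => H q.1 q.2 ω := by
  refine continuous_iff_continuousAt.2 fun q => Metric.continuousAt_iff.2 fun ε hε => ?_
  obtain ⟨δ, hδ, h⟩ := hE.equi (‖q.1‖ + 1) (by positivity) (ε / 2) (by positivity)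
  refine ⟨min δ 1, lt_min hδ one_pos, fun {q'} hq => ?_⟩
  have h1 : dist q'.1 q.1 < min δ 1 := (le_max_left _ _).trans_lt hq
  have h2 : dist q'.2 q.2 < min δ 1 := (le_max_right _ _).trans_lt hq
  have h3 : ‖q'.1‖ < ‖q.1‖ + 1 := by
    have h4 : ‖q'.1‖ ≤ ‖q.1‖ + ‖q'.1 - q.1‖ := by
      simpa using norm_add_le q.1 (q'.1 - q.1)
    rw [← dist_eq_norm] at h4
    linarith [min_le_right δ 1]
  rw [Real.dist_eq]
  exact (h ω _ _ _ _ h3 (by linarith) (h1.trans_le (min_le_left _ _))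
    (h2.trans_le (min_le_left _ _))).trans_lt (by linarith)

theorem Env.measurable_right (hE : Env P τ H) (p y : Ed n) : Measurable fun ω => H p y ω :=
  (hE.meas p).comp measurable_prodMk_left

theorem Env.measurableSet_coer (hE : Env P τ H) (μ j : ℝ) :
    MeasurableSet {ω | ∀ p y, j < ‖p‖ → μ + 1 ≤ H p y ω} := by
  set d := TopologicalSpace.denseSeq (Ed n) with hd
  have key : {ω | ∀ p y, j < ‖p‖ → μ + 1 ≤ H p y ω} =
      ⋂ (i : ℕ) (k : ℕ), {ω | j < ‖d i‖ → μ + 1 ≤ H (d i) (d k) ω} := by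
    ext ω
    simp only [Set.mem_iInter, Set.mem_ofPred_eq]
    refine ⟨fun h i k hi => h _ _ hi, fun h p y hp => ?_⟩
    by_contra! hlt
    have hO : IsOpen {q : Ed n × Ed n | j < ‖q.1‖ ∧ H q.1 q.2 ω < μ + 1} :=
      (isOpen_lt continuous_const (continuous_fst.norm)).inter
        (isOpen_lt (hE.continuous ω) continuous_const)
    have hD : DenseRange (Prod.map d d) :=
      (TopologicalSpace.denseRange_denseSeq (Ed n)).prodMap
        (TopologicalSpace.denseRange_denseSeq (Ed n))
    obtain ⟨⟨i, k⟩, hik⟩ := hD.exists_mem_open hO ⟨(p, y), hp, hlt⟩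
    exact absurd (h i k hik.1) (not_le.2 hik.2)
  rw [key]
  refine .iInter fun i => .iInter fun k => ?_
  by_cases hi : j < ‖d i‖
  · simpa [hi] using measurableSet_le measurable_const (hE.measurable_right (d i) (d k))
  · simp [hi]

theorem Env.measurableSet_edge (hE : Env P τ H) (ν : ℝ) (z y : Ed n) (c : ℝ) :
    MeasurableSet {ω | Edge (fun p y => H p y ω) ν z y c} := by
  set d := TopologicalSpace.denseSeq (Ed n) with hd
  have key : {ω | Edge (fun p y => H p y ω) ν z y c} =
      ⋂ i : ℕ, {ω | H (d i) z ω < ν → inner ℝ (d i) (y - z) ≤ c} := by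
    ext ω
    simp only [Set.mem_iInter, Set.mem_ofPred_eq]
    refine ⟨fun h i hi => h _ hi, fun h p hp => ?_⟩
    by_contra! hlt
    have hc : Continuous fun p => H p z ω :=
      (hE.continuous ω).comp (continuous_id.prodMk continuous_const)
    have hO : IsOpen {p : Ed n | H p z ω < ν ∧ c < inner ℝ p (y - z)} :=
      (isOpen_lt hc continuous_const).inter
        (isOpen_lt continuous_const (by fun_prop : Continuous fun p : Ed n => inner ℝ p (y - z)))
    obtain ⟨i, hi⟩ := (TopologicalSpace.denseRange_denseSeq (Ed n)).exists_mem_open hO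
      ⟨p, hp, hlt⟩
    exact absurd (h i hi.1) (not_le.2 hi.2)
  rw [key]
  refine .iInter fun i => ?_
  by_cases hi : inner ℝ (d i) (y - z) ≤ c
  · simp [hi]
  · simpa [hi] using measurableSet_le measurable_const (hE.measurable_right (d i) z)

theorem Env.reg (hE : Env P τ H) {μ j : ℝ} (hj : 0 ≤ j) {ω : Ω}
    (hω : ∀ p y, j < ‖p‖ → μ + 1 ≤ H p y ω) : Reg (fun p y => H p y ω) μ j where
  nonneg := hj
  conv y := hE.conv y ω
  cont y := (hE.continuous ω).comp (continuous_id.prodMk continuous_const)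
  coer := hω
  equi δ hδ := by
    obtain ⟨r, hr, h⟩ := hE.equi (j + 1) (by positivity) δ hδ
    exact ⟨r, hr, fun p y z hp hyz => h ω p p y z (by linarith) (by linarith)
      (by simpa using hr) hyz⟩

theorem Env.coer_shift (hE : Env P τ H) {μ j : ℝ} {ω : Ω} (z : Ed n)
    (hω : ∀ p y, j < ‖p‖ → μ + 1 ≤ H p y ω) :
    ∀ p y, j < ‖p‖ → μ + 1 ≤ H p y (τ z ω) := fun p y hp => by
  rw [hE.stat]; exact hω p _ hp

theorem Env.apply_shift (hE : Env P τ H) (z : Ed n) (ω : Ω) :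
    (fun p y => H p y (τ z ω)) = fun p y => H p ((1 : ℝ) • y + z) ω := by
  funext p y
  rw [hE.stat, one_smul]

theorem ErgAct.apply_neg (hτ : ErgAct P τ) (z : Ed n) (ω : Ω) : τ (-z) (τ z ω) = ω := by
  rw [← hτ.grp, neg_add_cancel, hτ.zero]

theorem Env.exists_coer [IsProbabilityMeasure P] (hE : Env P τ H) (μ : ℝ) :
    ∃ j : ℝ, 0 ≤ j ∧ ∀ᵐ ω ∂P, ∀ p y, j < ‖p‖ → μ + 1 ≤ H p y ω := by
  set A : ℕ → Set Ω := fun j => {ω | ∀ p y, (j : ℝ) < ‖p‖ → μ + 1 ≤ H p y ω} with hA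
  have hAm : ∀ j, MeasurableSet (A j) := fun j => hE.measurableSet_coer μ j
  have hAi : ∀ j z, τ z ⁻¹' A j = A j := fun j z => by
    ext ω
    refine ⟨fun h => ?_, fun h => hE.coer_shift z h⟩
    have := hE.coer_shift (-z) h
    rwa [hE.act.apply_neg] at this
  by_cases h : ∃ j, P (A j) = 1
  · obtain ⟨j, hj⟩ := h
    exact ⟨j, j.cast_nonneg, (mem_ae_iff_prob_eq_one (hAm j)).2 hj⟩
  · push Not at h
    have h0 : ∀ j, P (A j) = 0 := fun j =>
      (hE.act.erg (A j) (hAm j) (hAi j)).resolve_right (h j)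
    have hU : ⋃ j, A j = univ := by
      refine eq_univ_of_forall fun ω => ?_
      obtain ⟨R, hR⟩ := hE.coer ω (μ + 1)
      obtain ⟨j, hj⟩ := exists_nat_ge R
      exact mem_iUnion.2 ⟨j, fun p y hp => hR p y (hj.trans hp.le)⟩
    have := measure_iUnion_null h0
    rw [hU, measure_univ] at this
    exact absurd this one_ne_zero

open Classical in
/-- The intrinsic distance as a random field, set to zero where it degenerates. -/
def rmet (H : Ed n → Ed n → Ω → ℝ) (μ j : ℝ) (y x : Ed n) (ω : Ω) : ℝ :=
  if (∀ p y, j < ‖p‖ → μ + 1 ≤ H p y ω) ∧ ∃ w, IsSub (fun p y => H p y ω) μ w then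
    met (fun p y => H p y ω) μ y x else 0

theorem Env.rmet_shift (hE : Env P τ H) (μ j : ℝ) (y x z : Ed n) (ω : Ω) :
    rmet H μ j y x (τ z ω) = rmet H μ j (y + z) (x + z) ω := by
  have h1 : ((∀ p y, j < ‖p‖ → μ + 1 ≤ H p y (τ z ω)) ∧
      ∃ w, IsSub (fun p y => H p y (τ z ω)) μ w) ↔
      ((∀ p y, j < ‖p‖ → μ + 1 ≤ H p y ω) ∧ ∃ w, IsSub (fun p y => H p y ω) μ w) := by
    constructor
    · rintro ⟨ha, hb⟩
      have ha' := hE.coer_shift (-z) ha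
      have hb' := exists_isSub_affine hb one_pos (-z)
      rw [hE.act.apply_neg] at ha'
      rw [← hE.apply_shift (-z) (τ z ω), hE.act.apply_neg] at hb'
      exact ⟨ha', hb'⟩
    · rintro ⟨ha, hb⟩
      refine ⟨hE.coer_shift z ha, ?_⟩
      rw [hE.apply_shift]
      exact exists_isSub_affine hb one_pos z
  have h2 : met (fun p y => H p y (τ z ω)) μ y x = met (fun p y => H p y ω) μ (y + z) (x + z) := by
    rw [hE.apply_shift, met_affine (fun p y => H p y ω) μ one_pos z y x]
    simp
  unfold rmet
  split_ifs with ha hb hb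
  · exact h2
  · exact absurd (h1.1 ha) hb
  · exact absurd (h1.2 hb) ha
  · rfl

theorem Env.measurable_rmet_dense (hE : Env P τ H) {μ j : ℝ} (hj : 0 ≤ j) (y x : ℕ) :
    Measurable (rmet H μ j (TopologicalSpace.denseSeq (Ed n) y)
      (TopologicalSpace.denseSeq (Ed n) x)) := by
  set d := TopologicalSpace.denseSeq (Ed n) with hd
  have hr : ∀ m : ℕ, ∃ r > (0 : ℝ), ∀ (ω : Ω) (p y z : Ed n), ‖p‖ ≤ j → dist y z < r →
      |H p y ω - H p z ω| ≤ 1 / ((m : ℝ) + 1) / 2 := fun m => by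
    obtain ⟨r, hr, h⟩ := hE.equi (j + 1) (by positivity) (1 / ((m : ℝ) + 1) / 2) (by positivity)
    exact ⟨r, hr, fun ω p y z hp hyz => h ω p p y z (by linarith) (by linarith)
      (by simpa using hr) hyz⟩
  choose r hr0 hr using hr
  set A : Set Ω := {ω | ∀ p y, j < ‖p‖ → μ + 1 ≤ H p y ω} with hA
  set T : ℕ → ℕ → ℝ → Set Ω := fun y x a =>
    {ω | ∃ w, IsSub (fun p y => H p y ω) μ w ∧ a ≤ w (d y) - w (d x)} with hT
  have hAT : ∀ y x a, MeasurableSet (A ∩ T y x a) := fun y x a => by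
    have e : A ∩ T y x a = A ∩ ⋂ (k : ℕ) (c : ℚ),
        {ω | ChainCost (Step (fun p y => H p y ω) μ j r) x k y c → a ≤ c} := by
      ext ω
      refine and_congr_right fun hω => ?_
      simp only [Set.mem_iInter, Set.mem_ofPred_eq]
      exact exists_isSub_iff (hE.reg hj hω) hr0 (fun m => hr m ω) x y a
    rw [e]
    refine (hE.measurableSet_coer μ j).inter (.iInter fun k => .iInter fun c => ?_)
    have hm := measurableSet_chainCost (E := fun ω => Step (fun p y => H p y ω) μ j r)
      (fun z y c => by
        simp only [Step, Set.ofPred_or, Set.ofPred_exists, Set.ofPred_and]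
        exact (MeasurableSet.iUnion fun m => (MeasurableSet.const _).inter
          (hE.measurableSet_edge _ _ _ _)).union (MeasurableSet.const _)) x k y c
    by_cases hac : a ≤ c
    · simp [hac]
    · simp only [hac, imp_false]
      exact hm.compl
  refine measurable_of_Ici fun a => ?_
  have e : rmet H μ j (d y) (d x) ⁻¹' Ici a =
      (A ∩ T y x a) ∪ ((A ∩ T 0 0 0)ᶜ ∩ {_ω | a ≤ 0}) := by
    ext ω
    have hS : ω ∈ A ∩ T 0 0 0 ↔ (∀ p y, j < ‖p‖ → μ + 1 ≤ H p y ω) ∧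
        ∃ w, IsSub (fun p y => H p y ω) μ w := by
      simp [hA, hT]
    by_cases hω : ω ∈ A ∩ T 0 0 0
    · have hω' := hS.1 hω
      have hR := hE.reg hj hω'.1
      have : a ≤ met (fun p y => H p y ω) μ (d y) (d x) ↔ ω ∈ T y x a := by
        constructor
        · intro h
          refine ⟨_, isSub_met hR hω'.2 (d x), ?_⟩
          rwa [met_self hω'.2, sub_zero]
        · rintro ⟨w, hw, h⟩
          exact h.trans (hw.le_met hR _ _)
      have hωA : ω ∈ A := hω.1
      simp only [Set.mem_preimage, rmet, if_pos hω', Set.mem_Ici, this, Set.mem_union,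
        Set.mem_inter_iff, hωA, true_and, Set.mem_compl_iff]
      have hωT : ω ∈ T 0 0 0 := hω.2
      simp [hωT]
    · have hω' := fun h => hω (hS.2 h)
      have h2 : ω ∉ A ∩ T y x a := by
        rintro ⟨h1, w, hw, _⟩
        exact hω' ⟨h1, w, hw⟩
      simp only [Set.mem_preimage, rmet, if_neg hω', Set.mem_Ici, Set.mem_union, h2, false_or,
        Set.mem_inter_iff, Set.mem_compl_iff, hω, not_false_eq_true, true_and, Set.mem_ofPred_eq]
  rw [e]
  exact (hAT _ _ _).union ((hAT _ _ _).compl.inter (MeasurableSet.const _))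

theorem Env.cocycle (hE : Env P τ H) {μ j : ℝ} (hj : 0 ≤ j) : Cocycle τ j (rmet H μ j) := by
  have tri : ∀ x y z ω, rmet H μ j x z ω ≤ rmet H μ j x y ω + rmet H μ j y z ω := by
    intro x y z ω
    unfold rmet
    split_ifs with h
    · exact met_triangle (hE.reg hj h.1) h.2 x y z
    · simp
  have bdd : ∀ y x ω, |rmet H μ j y x ω| ≤ j * ‖y - x‖ := by
    intro y x ω
    unfold rmet
    split_ifs with h
    · refine abs_le.2 ⟨?_, met_le_norm (hE.reg hj h.1) h.2 y x⟩
      have h1 := met_triangle (hE.reg hj h.1) h.2 y x y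
      have h2 := met_le_norm (hE.reg hj h.1) h.2 x y
      rw [met_self h.2] at h1
      rw [norm_sub_rev] at h2
      linarith
    · rw [abs_zero]; positivity
  refine ⟨hj, bdd, tri, fun y x z ω => hE.rmet_shift μ j y x z ω, fun y x => ?_⟩
  have hD := TopologicalSpace.denseRange_denseSeq (Ed n)
  have hs : ∀ y : Ed n, ∃ i : ℕ → ℕ, Tendsto (fun m => TopologicalSpace.denseSeq (Ed n) (i m))
      atTop (nhds y) := fun y => by
    obtain ⟨s, hs1, hs2⟩ := mem_closure_iff_seq_limit.1 (hD y)
    choose i hi using hs1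
    exact ⟨i, by simpa only [hi] using hs2⟩
  obtain ⟨a, ha⟩ := hs y
  obtain ⟨b, hb⟩ := hs x
  refine measurable_of_tendsto_metrizable
    (fun m => hE.measurable_rmet_dense (μ := μ) hj (a m) (b m)) ?_
  refine tendsto_pi_nhds.2 fun ω => ?_
  refine tendsto_iff_norm_sub_tendsto_zero.2 ?_
  have h0 : Tendsto (fun m => j * ‖TopologicalSpace.denseSeq (Ed n) (a m) - y‖ +
      j * ‖TopologicalSpace.denseSeq (Ed n) (b m) - x‖) atTop (nhds 0) := by
    have h1 := (tendsto_iff_norm_sub_tendsto_zero.1 ha).const_mul j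
    have h2 := (tendsto_iff_norm_sub_tendsto_zero.1 hb).const_mul j
    simpa using h1.add h2
  refine squeeze_zero (fun _ => norm_nonneg _) (fun m => ?_) h0
  set y' := TopologicalSpace.denseSeq (Ed n) (a m)
  set x' := TopologicalSpace.denseSeq (Ed n) (b m)
  have h1 := tri y' y x' ω
  have h2 := tri y x x' ω
  have h3 := tri y y' x ω
  have h4 := tri y' x' x ω
  have b1 := (abs_le.1 (bdd y' y ω)).2
  have b2 := (abs_le.1 (bdd x x' ω)).2
  have b3 := (abs_le.1 (bdd y y' ω)).2
  have b4 := (abs_le.1 (bdd x' x ω)).2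
  rw [norm_sub_rev] at b2 b3
  rw [Real.norm_eq_abs, abs_le]
  constructor <;> linarith

end Measurability

theorem rmet_eq {n : ℕ} {Ω : Type*} {H : Ed n → Ed n → Ω → ℝ} {μ j : ℝ} {ω : Ω} (h : ∀ p y, j < ‖p‖ → μ + 1 ≤ H p y ω)
    (h' : ∃ w, IsSub (fun p y => H p y ω) μ w) (y x : Ed n) :
    rmet H μ j y x ω = met (fun p y => H p y ω) μ y x :=
  if_pos ⟨h, h'⟩

/-- `M` is the homogenized limit of the two-point function `f`. -/
def Homogenizes {n : ℕ} (f : Ed n → Ed n → ℝ) (M : Ed n → ℝ) : Prop :=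
  ∀ x v : Ed n, ∀ η > (0 : ℝ), ∀ᶠ t : ℝ in atTop, |f (t • (x + v)) (t • x) - t * M v| ≤ η * t

/-- `p` admits a sublinear corrector at the level `μ`. -/
def Corr {n : ℕ} (G : Ed n → Ed n → ℝ) (p : Ed n) (μ : ℝ) : Prop :=
  ∃ w : Ed n → ℝ, IsSub (fun q y => G (p + q) y) μ w ∧
    Tendsto (fun y : Ed n => w y / ‖y‖) (cocompact (Ed n)) (nhds 0)

section Homogenized

variable {n : ℕ} {f : Ed n → Ed n → ℝ} {M : Ed n → ℝ} {j : ℝ}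

theorem Homogenizes.tendsto (h : Homogenizes f M) (x v : Ed n) :
    Tendsto (fun t : ℝ => t⁻¹ * f (t • (x + v)) (t • x)) atTop (nhds (M v)) := by
  refine Metric.tendsto_nhds.2 fun η hη => ?_
  filter_upwards [h x v (η / 2) (by positivity), eventually_gt_atTop 0] with t ht ht0
  have e : t⁻¹ * f (t • (x + v)) (t • x) - M v = t⁻¹ * (f (t • (x + v)) (t • x) - t * M v) := by
    field_simp
  rw [Real.dist_eq, e, abs_mul, abs_of_pos (inv_pos.2 ht0), inv_mul_lt_iff₀ ht0]
  nlinarith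

theorem Homogenizes.map_smul (h : Homogenizes f M) {s : ℝ} (hs : 0 < s) (v : Ed n) :
    M (s • v) = s * M v := by
  have h1 := h.tendsto 0 (s • v)
  have h2 : Tendsto (fun t : ℝ => t * s) atTop atTop := tendsto_id.atTop_mul_const hs
  have h3 := ((h.tendsto 0 v).comp h2).const_mul s
  refine tendsto_nhds_unique h1 (h3.congr fun t => ?_)
  simp only [Function.comp, zero_add, smul_zero, smul_smul, mul_inv]
  field_simp

theorem Homogenizes.map_add_le (h : Homogenizes f M) (tri : ∀ x y z, f x z ≤ f x y + f y z)
    (v v' : Ed n) : M (v + v') ≤ M v + M v' := by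
  have h1 := h.tendsto 0 (v + v')
  have h2 := (h.tendsto v' v).add (h.tendsto 0 v')
  refine le_of_tendsto_of_tendsto h1 h2 ?_
  filter_upwards [eventually_gt_atTop 0] with t ht
  rw [← mul_add]
  refine mul_le_mul_of_nonneg_left ?_ (inv_nonneg.2 ht.le)
  simp only [zero_add, smul_zero, add_comm v' v]
  exact tri _ _ _

theorem Homogenizes.map_sub_le (h : Homogenizes f M)
    (lip : ∀ y y' x, f y x - f y' x ≤ j * ‖y - y'‖) (v v' : Ed n) :
    M v - M v' ≤ j * ‖v - v'‖ := by
  refine le_of_tendsto ((h.tendsto 0 v).sub (h.tendsto 0 v')) ?_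
  filter_upwards [eventually_gt_atTop 0] with t ht
  rw [← mul_sub, inv_mul_le_iff₀ ht]
  simp only [zero_add, smul_zero]
  refine (lip _ _ _).trans_eq ?_
  rw [← smul_sub, norm_smul, Real.norm_of_nonneg ht.le]
  ring

theorem Homogenizes.uniform (h : Homogenizes f M) (hj : 0 ≤ j)
    (lip : ∀ y y' x, f y x - f y' x ≤ j * ‖y - y'‖)
    (lip' : ∀ y x x', f y x - f y x' ≤ j * ‖x - x'‖) {η : ℝ} (hη : 0 < η) :
    ∃ T₀ : ℝ, 0 < T₀ ∧ ∀ T ≥ T₀, ∀ a b : Ed n, ‖a‖ ≤ T → ‖b‖ ≤ T → M (a - b) - η * T ≤ f a b := by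
  set e := η / (8 * (j + 1)) with he
  have he0 : 0 < e := by positivity
  have hje : j * e ≤ η / 8 := by
    have : (j + 1) * e = η / 8 := by rw [he]; field_simp
    linarith
  obtain ⟨t, -, htf, ht⟩ := finite_cover_balls_of_compact (isCompact_closedBall (0 : Ed n) 1) he0
  have h1 : ∀ᶠ T : ℝ in atTop, ∀ p ∈ t, ∀ q ∈ t, |f (T • p) (T • q) - T * M (p - q)| ≤ η / 4 * T := by
    rw [Filter.eventually_all_finite htf]
    intro p _
    rw [Filter.eventually_all_finite htf]
    intro q _
    filter_upwards [h q (p - q) (η / 4) (by positivity)] with T hT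
    rwa [add_sub_cancel] at hT
  obtain ⟨T₁, hT₁⟩ := eventually_atTop.1 h1
  refine ⟨max T₁ 1, by positivity, fun T hT a b ha hb => ?_⟩
  have hT0 : 0 < T := one_pos.trans_le ((le_max_right _ _).trans hT)
  have hnear : ∀ a : Ed n, ‖a‖ ≤ T → ∃ p ∈ t, ‖a - T • p‖ ≤ T * e := fun a ha => by
    have : T⁻¹ • a ∈ closedBall (0 : Ed n) 1 := by
      rw [mem_closedBall_zero_iff, norm_smul, norm_inv, Real.norm_of_nonneg hT0.le,
        inv_mul_le_iff₀ hT0]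
      linarith
    obtain ⟨p, hp, hpa⟩ := mem_iUnion₂.1 (ht this)
    refine ⟨p, hp, ?_⟩
    rw [mem_ball, dist_eq_norm] at hpa
    have : a - T • p = T • (T⁻¹ • a - p) := by rw [smul_sub, smul_inv_smul₀ hT0.ne']
    rw [this, norm_smul, Real.norm_of_nonneg hT0.le]
    gcongr
  obtain ⟨p, hp, hpa⟩ := hnear a ha
  obtain ⟨q, hq, hqb⟩ := hnear b hb
  have h2 := (abs_le.1 (hT₁ T ((le_max_left _ _).trans hT) p hp q hq)).1
  have h3 := lip (T • p) a (T • q)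
  have h4 := lip' a (T • q) b
  have h5 := h.map_sub_le lip (a - b) (T • (p - q))
  rw [h.map_smul hT0] at h5
  have h6 : ‖a - b - T • (p - q)‖ ≤ T * e + T * e := by
    have : a - b - T • (p - q) = (a - T • p) - (b - T • q) := by rw [smul_sub]; abel
    rw [this]
    exact (norm_sub_le _ _).trans (add_le_add hpa hqb)
  rw [norm_sub_rev] at h3 h4
  have k3 := mul_le_mul_of_nonneg_left hpa hj
  have k4 := mul_le_mul_of_nonneg_left hqb hj
  have k5 := mul_le_mul_of_nonneg_left h6 hj
  have k6 := mul_le_mul_of_nonneg_right hje hT0.le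
  nlinarith

end Homogenized

section Correctors

variable {n : ℕ} {G : Ed n → Ed n → ℝ} {μ j : ℝ} {p : Ed n} {w : Ed n → ℝ}

theorem IsSub.mono {ν : ℝ} (hw : IsSub G ν w) (h : ν ≤ μ) : IsSub G μ w :=
  ⟨hw.1, hw.2.mono fun _ hy => hy.trans h⟩

theorem IsSub.sub_inner (hw : IsSub G μ w) (p : Ed n) :
    IsSub (fun q y => G (p + q) y) μ fun y => w y - inner ℝ p y := by
  obtain ⟨⟨K, hK⟩, hae⟩ := hw
  have hp : LipschitzWith (Real.toNNReal ‖p‖) fun y : Ed n => inner ℝ p y :=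
    lipschitz_of_le_norm (norm_nonneg p) fun y x => by
      rw [← inner_sub_right]; exact real_inner_le_norm _ _
  refine ⟨⟨_, hK.sub hp⟩, ?_⟩
  filter_upwards [hae, hK.ae_differentiableAt] with y h1 h2
  rw [gradient_sub_inner h2, add_sub_cancel]
  exact h1

theorem IsSub.add_inner (hw : IsSub (fun q y => G (p + q) y) μ w) :
    IsSub G μ fun y => w y + inner ℝ p y := by
  simpa using hw.sub_inner (-p)

theorem tendsto_div_norm (h : ∀ η > (0 : ℝ), ∃ C, ∀ y, |w y| ≤ C + η * ‖y‖) :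
    Tendsto (fun y : Ed n => w y / ‖y‖) (cocompact (Ed n)) (nhds 0) := by
  refine Metric.tendsto_nhds.2 fun η hη => ?_
  obtain ⟨C, hC⟩ := h (η / 2) (by positivity)
  filter_upwards [tendsto_norm_cocompact_atTop.eventually_gt_atTop (max 0 (C / (η / 2)))] with y hy
  have hy0 := (le_max_left _ _).trans_lt hy
  have hy1 := (le_max_right _ _).trans_lt hy
  rw [div_lt_iff₀ (by positivity)] at hy1
  rw [Real.dist_eq, sub_zero, abs_div, abs_norm, div_lt_iff₀ hy0]
  linarith [hC y]

theorem tendsto_smul_div (h : Tendsto (fun y : Ed n => w y / ‖y‖) (cocompact (Ed n)) (nhds 0))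
    (v : Ed n) : Tendsto (fun t : ℝ => t⁻¹ * w (t • v)) atTop (nhds 0) := by
  by_cases hv : v = 0
  · simpa [hv] using tendsto_inv_atTop_zero.mul_const (w 0)
  · have hv' : 0 < ‖v‖ := norm_pos_iff.2 hv
    have h1 : Tendsto (fun t : ℝ => t • v) atTop (cocompact (Ed n)) := by
      rw [← Metric.cobounded_eq_cocompact, ← tendsto_norm_atTop_iff_cobounded]
      simp only [norm_smul]
      exact tendsto_norm_atTop_atTop.atTop_mul_const hv'
    have h2 := (h.comp h1).mul_const ‖v‖
    rw [zero_mul] at h2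
    refine h2.congr' ?_
    filter_upwards [eventually_gt_atTop 0] with t ht
    simp only [Function.comp, norm_smul, Real.norm_of_nonneg ht.le]
    field_simp

theorem Corr.exists_isSub (h : Corr G p μ) : ∃ W, IsSub G μ W ∧
    ∀ v, Tendsto (fun t : ℝ => t⁻¹ * (W (t • v) - W 0)) atTop (nhds (inner ℝ p v)) := by
  obtain ⟨w, hw, hlim⟩ := h
  refine ⟨_, hw.add_inner, fun v => ?_⟩
  have h1 := tendsto_smul_div hlim v
  have h2 := tendsto_inv_atTop_zero.mul_const (w 0)
  have h3 := (h1.sub h2).add_const (inner ℝ p v)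
  simp only [zero_mul, sub_zero, zero_add] at h3
  refine h3.congr' ?_
  filter_upwards [eventually_gt_atTop 0] with t ht
  rw [inner_smul_right, inner_zero_right]
  field_simp
  ring

theorem Corr.inner_le (h : Corr G p μ) {M : Ed n → ℝ} (hG : Reg G μ j)
    (hM : Homogenizes (met G μ) M) (v : Ed n) : inner ℝ p v ≤ M v := by
  obtain ⟨W, hW, hlim⟩ := h.exists_isSub
  refine le_of_tendsto_of_tendsto (hlim v) (hM.tendsto 0 v) ?_
  filter_upwards [eventually_gt_atTop 0] with t ht
  refine mul_le_mul_of_nonneg_left ?_ (inv_nonneg.2 ht.le)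
  simpa using hW.le_met hG (t • v) 0

theorem Corr.norm_le (h : Corr G p μ) (hG : Reg G μ j) : ‖p‖ ≤ j := by
  obtain ⟨W, hW, hlim⟩ := h.exists_isSub
  have h1 : inner ℝ p p ≤ j * ‖p‖ := by
    refine le_of_tendsto (hlim p) ?_
    filter_upwards [eventually_gt_atTop 0] with t ht
    rw [inv_mul_le_iff₀ ht]
    have := hW.le_norm hG (t • p) 0
    rw [sub_zero, norm_smul, Real.norm_of_nonneg ht.le] at this
    linarith
  rw [real_inner_self_eq_norm_sq] at h1
  have hj := hG.nonneg
  by_contra! hlt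
  nlinarith [norm_nonneg p]

theorem Corr.mono {ν : ℝ} (h : Corr G p ν) (hν : ν ≤ μ) : Corr G p μ :=
  let ⟨w, hw, h'⟩ := h
  ⟨w, hw.mono hν, h'⟩

theorem corr_of_le (hG : Reg G μ j) (hne : ∃ w, IsSub G μ w) {M : Ed n → ℝ}
    (hM : Homogenizes (met G μ) M) {θ : ℝ} (hθ : 0 < θ)
    (h : ∀ v, inner ℝ p v + θ * ‖v‖ ≤ M v) : Corr G p μ := by
  have lip : ∀ y y' x, met G μ y x - met G μ y' x ≤ j * ‖y - y'‖ := fun y y' x => by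
    linarith [met_triangle hG hne y y' x, met_le_norm hG hne y y']
  have lip' : ∀ y x x', met G μ y x - met G μ y x' ≤ j * ‖x - x'‖ := fun y x x' => by
    have := met_le_norm hG hne x' x
    rw [norm_sub_rev] at this
    linarith [met_triangle hG hne y x' x]
  have key : ∀ η > (0 : ℝ), η ≤ θ → ∃ C, ∀ y z, inner ℝ p y - (C + 2 * η * ‖y‖) ≤
      met G μ y z + inner ℝ p z := by
    intro η hη hηθ
    obtain ⟨T₀, hT₀, hT⟩ := hM.uniform hG.nonneg lip lip' hη
    refine ⟨η * T₀, fun y z => ?_⟩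
    have h1 := hT (T₀ + ‖y‖ + ‖z‖) (by linarith [norm_nonneg y, norm_nonneg z]) y z
      (by linarith [norm_nonneg z]) (by linarith [norm_nonneg y])
    have h2 := h (y - z)
    rw [inner_sub_right] at h2
    have h3 : ‖z‖ ≤ ‖y‖ + ‖y - z‖ := by
      have := norm_sub_le y (y - z)
      rwa [sub_sub_cancel] at this
    have h4 := mul_le_mul_of_nonneg_left h3 hη.le
    have h5 := mul_le_mul_of_nonneg_right hηθ (norm_nonneg (y - z))
    nlinarith
  have hbdd : ∀ y, BddBelow (range fun z => met G μ y z + inner ℝ p z) := fun y => by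
    obtain ⟨C, hC⟩ := key θ hθ le_rfl
    exact ⟨_, by rintro _ ⟨z, rfl⟩; exact hC y z⟩
  set W : Ed n → ℝ := fun y => ⨅ z, (met G μ y z + inner ℝ p z) with hW
  have hWs : IsSub G μ W := isSub_of_le_met hG hne fun y y' => by
    have : W y - met G μ y y' ≤ W y' := le_ciInf fun z => by
      have h1 : W y ≤ _ := ciInf_le (hbdd y) z
      linarith [met_triangle hG hne y y' z]
    linarith
  refine ⟨_, hWs.sub_inner p, tendsto_div_norm fun η hη => ?_⟩
  obtain ⟨C, hC⟩ := key (min (η / 2) θ) (by positivity) (min_le_right _ _)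
  refine ⟨|C|, fun y => ?_⟩
  have h1 : W y ≤ inner ℝ p y := by
    refine (ciInf_le (hbdd y) y).trans_eq ?_
    rw [met_self hne, zero_add]
  have h2 : inner ℝ p y - (C + 2 * min (η / 2) θ * ‖y‖) ≤ W y := le_ciInf (hC y)
  have h3 := mul_le_mul_of_nonneg_right (min_le_left (η / 2) θ) (norm_nonneg y)
  have h4 := le_abs_self C
  have h5 := abs_nonneg C
  have h6 : 0 ≤ η * ‖y‖ := by positivity
  rw [abs_le]
  constructor <;> nlinarith

end Correctors

section Identification

variable {n : ℕ} {G : Ed n → Ed n → ℝ} {μ j : ℝ} {Hb : Ed n → ℝ} {M : Ed n → ℝ}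

theorem exists_inner_eq (h1 : ∀ c : ℝ, 0 < c → ∀ x, M (c • x) = c * M x)
    (h2 : ∀ x y, M (x + y) ≤ M x + M y) (v : Ed n) :
    ∃ p : Ed n, inner ℝ p v = M v ∧ ∀ x, inner ℝ p x ≤ M x := by
  have h0 : M 0 = 0 := by
    have := h1 2 two_pos 0
    rw [smul_zero] at this
    linarith
  have hneg : ∀ x, -M (-x) ≤ M x := fun x => by
    have := h2 x (-x)
    rw [add_neg_cancel, h0] at this
    linarith
  have hle : ∀ (c : ℝ) (x : Ed n), c * M x ≤ M (c • x) := fun c x => by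
    rcases lt_trichotomy c 0 with hc | rfl | hc
    · have := h1 (-c) (neg_pos.2 hc) x
      have h3 := hneg (c • x)
      rw [← neg_smul, this] at h3
      linarith
    · simp [h0]
    · exact (h1 c hc x).ge
  have hw : ∀ c : ℝ, c • v = 0 → c • M v = 0 := fun c hc => by
    rcases smul_eq_zero.1 hc with rfl | rfl
    · simp
    · simp [h0]
  obtain ⟨g, hg1, hg2⟩ := exists_extension_of_le_sublinear
    (LinearPMap.mkSpanSingleton' v (M v) hw) M h1 h2 (by
      rintro ⟨x, hx⟩
      obtain ⟨c, rfl⟩ := Submodule.mem_span_singleton.1 hx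
      rw [LinearPMap.mkSpanSingleton'_apply]
      exact hle c v)
  have hg : ∀ x, inner ℝ ((InnerProductSpace.toDual ℝ (Ed n)).symm (LinearMap.toContinuousLinearMap g)) x
      = g x := fun x => by
    rw [InnerProductSpace.toDual_symm_apply]
    rfl
  refine ⟨_, ?_, fun x => (hg x).trans_le (hg2 x)⟩
  rw [hg]
  have := hg1 ⟨(1 : ℝ) • v, Submodule.smul_mem _ _ (Submodule.mem_span_singleton_self v)⟩
  rw [LinearPMap.mkSpanSingleton'_apply] at this
  simpa using this

theorem Homogenizes.eq_supp (hM : Homogenizes (met G μ) M) (hG : Reg G μ j)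
    (hH : Eff Hb) (h1 : ∀ p ν, Hb p < ν → Corr G p ν) (h2 : ∀ p ν, Corr G p ν → Hb p ≤ ν)
    (hμ : ∃ p, Hb p < μ) (v : Ed n) : M v = supp Hb μ v := by
  obtain ⟨p₁, hp₁⟩ := hμ
  have hne : ∃ w, IsSub G μ w :=
    let ⟨W, hW, _⟩ := (h1 p₁ μ hp₁).exists_isSub
    ⟨W, hW⟩
  obtain ⟨R, hR⟩ := hH.coer μ
  have hcont := hH.cont
  -- a limiting argument along segments towards `p₁`
  have hseg : ∀ p : Ed n, Tendsto (fun s : ℝ => p + s • (p₁ - p)) (nhdsWithin 0 (Ioo 0 1)) (nhds p) :=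
    fun p => by
      have : Continuous fun s : ℝ => p + s • (p₁ - p) := by fun_prop
      simpa using (this.tendsto 0).mono_left nhdsWithin_le_nhds
  have hbot : (nhdsWithin (0 : ℝ) (Ioo 0 1)).NeBot := by
    rw [nhdsWithin_Ioo_eq_nhdsGT one_pos]; infer_instance
  refine le_antisymm ?_ (supp_le ⟨p₁, hp₁.le⟩ fun p hp => ?_)
  · obtain ⟨p, hpv, hpM⟩ := exists_inner_eq (fun c hc x => hM.map_smul hc x)
      (hM.map_add_le (met_triangle hG hne)) v
    rw [← hpv]
    refine le_supp hR ?_ v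
    obtain ⟨θ, hθ, hball⟩ : ∃ θ > (0 : ℝ), ∀ q, ‖q‖ ≤ θ → Hb (p₁ + q) < μ := by
      have h3 : ∀ᶠ q in nhds p₁, Hb q < μ := hcont.continuousAt.eventually (gt_mem_nhds hp₁)
      obtain ⟨θ, hθ, h4⟩ := Metric.eventually_nhds_iff.1 h3
      refine ⟨θ / 2, by positivity, fun q hq => h4 ?_⟩
      rw [dist_eq_norm, add_sub_cancel_left]
      linarith
    have hstrict : ∀ x, inner ℝ p₁ x + θ * ‖x‖ ≤ M x := fun x => by
      by_cases hx : x = 0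
      · have := (h1 p₁ μ hp₁).inner_le hG hM x
        simpa [hx] using this
      · have hx' : 0 < ‖x‖ := norm_pos_iff.2 hx
        have h3 := hball ((θ * ‖x‖⁻¹) • x) (by
          rw [norm_smul, norm_mul, norm_inv, norm_norm, Real.norm_of_nonneg hθ.le,
            inv_mul_cancel_right₀ hx'.ne'])
        have h4 := (h1 _ μ h3).inner_le hG hM x
        rw [inner_add_left, real_inner_smul_left, real_inner_self_eq_norm_sq] at h4
        have : θ * ‖x‖⁻¹ * ‖x‖ ^ 2 = θ * ‖x‖ := by field_simp
        linarith
    refine le_of_tendsto ((hcont.tendsto p).comp (hseg p)) ?_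
    filter_upwards [self_mem_nhdsWithin] with s hs
    refine h2 _ _ (corr_of_le hG hne hM (mul_pos hs.1 hθ) fun x => ?_)
    have h3 := mul_le_mul_of_nonneg_left (hstrict x) hs.1.le
    have h4 := mul_le_mul_of_nonneg_left (hpM x) (sub_nonneg.2 hs.2.le)
    rw [inner_add_left, real_inner_smul_left, inner_sub_left]
    linarith
  · have h3 : Tendsto (fun s : ℝ => (inner ℝ (p + s • (p₁ - p)) v : ℝ)) (nhdsWithin 0 (Ioo 0 1))
        (nhds (inner ℝ p v)) := (hseg p).inner tendsto_const_nhds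
    refine le_of_tendsto h3 ?_
    filter_upwards [self_mem_nhdsWithin] with s hs
    refine (h1 _ μ ?_).inner_le hG hM v
    have h4 := hH.conv.2 (mem_univ p) (mem_univ p₁) (sub_nonneg.2 hs.2.le) hs.1.le (by ring)
    have e : p + s • (p₁ - p) = (1 - s) • p + s • p₁ := by module
    rw [e]
    refine h4.trans_lt ?_
    simp only [smul_eq_mul]
    have h5 := mul_le_mul_of_nonneg_left hp (sub_nonneg.2 hs.2.le)
    have h6 := mul_lt_mul_of_pos_left hp₁ hs.1
    linarith

end Identification

section Effective

variable {n : ℕ} {G : Ed n → Ed n → ℝ} {Hb : Ed n → ℝ}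

theorem Corr.convex_comb (hconv : ∀ y, ConvexOn ℝ univ fun p => G p y) {p q : Ed n} {μ ν : ℝ}
    (hp : Corr G p μ) (hq : Corr G q ν) {a b : ℝ} (ha : 0 ≤ a) (hb : 0 ≤ b) (hab : a + b = 1) :
    Corr G (a • p + b • q) (a * μ + b * ν) := by
  obtain ⟨w, ⟨⟨K, hK⟩, hw⟩, hwl⟩ := hp
  obtain ⟨w', ⟨⟨K', hK'⟩, hw'⟩, hwl'⟩ := hq
  refine ⟨fun y => a * w y + b * w' y, ⟨⟨_, ((lipschitzWith_smul a).comp hK).add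
    ((lipschitzWith_smul b).comp hK')⟩, ?_⟩, ?_⟩
  · filter_upwards [hw, hw', hK.ae_differentiableAt, hK'.ae_differentiableAt] with y h1 h2 h3 h4
    have h5 : gradient (fun y => a * w y + b * w' y) y = a • gradient w y + b • gradient w' y := by
      rw [gradient, ((h3.hasFDerivAt.const_mul a).fun_add (h4.hasFDerivAt.const_mul b)).fderiv]
      simp [gradient]
    have h6 := (hconv y).2 (mem_univ (p + gradient w y)) (mem_univ (q + gradient w' y)) ha hb hab
    have h7 : a • p + b • q + (a • gradient w y + b • gradient w' y) =
        a • (p + gradient w y) + b • (q + gradient w' y) := by module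
    rw [h5, h7]
    refine h6.trans ?_
    simp only [smul_eq_mul]
    gcongr
  · have := (hwl.const_mul a).add (hwl'.const_mul b)
    simp only [mul_zero, add_zero] at this
    refine this.congr fun y => ?_
    ring

theorem corr_zero {p : Ed n} {C : ℝ} (h : ∀ y, G p y ≤ C) : Corr G p C := by
  refine ⟨fun _ => 0, ⟨⟨0, LipschitzWith.const 0⟩, Eventually.of_forall fun y => ?_⟩, by
    simpa using tendsto_const_nhds⟩
  have : gradient (fun _ : Ed n => (0 : ℝ)) y = 0 := by simp [gradient]
  simpa only [this, add_zero] using h y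

theorem Corr.le {p : Ed n} {μ B : ℝ} (h : Corr G p μ) (hB : ∀ p y, B ≤ G p y) : B ≤ μ := by
  obtain ⟨w, ⟨_, hw⟩, _⟩ := h
  obtain ⟨y, hy⟩ := hw.exists
  exact (hB _ y).trans hy

/-- The level sets of correctors determine the effective Hamiltonian. -/
theorem corr_iff_lt (hup : ∀ p, ∃ C, ∀ y, G p y ≤ C) {B : ℝ} (hB : ∀ p y, B ≤ G p y)
    (hHb : ∀ p, sInf {μ | Corr G p μ} = Hb p) :
    (∀ p ν, Hb p < ν → Corr G p ν) ∧ ∀ p ν, Corr G p ν → Hb p ≤ ν := by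
  refine ⟨fun p ν h => ?_, fun p ν h => ?_⟩
  · obtain ⟨C, hC⟩ := hup p
    rw [← hHb p] at h
    obtain ⟨μ, hμ, hμν⟩ := exists_lt_of_csInf_lt ⟨C, corr_zero hC⟩ h
    exact hμ.mono hμν.le
  · rw [← hHb p]
    exact csInf_le ⟨B, fun _ h => h.le hB⟩ h

theorem eff_of_corr (hconv : ∀ y, ConvexOn ℝ univ fun p => G p y)
    (hreg : ∀ μ, ∃ j, Reg G μ j)
    (h1 : ∀ p ν, Hb p < ν → Corr G p ν) (h2 : ∀ p ν, Corr G p ν → Hb p ≤ ν)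
    (hflat : interior {p | ∀ q, Hb p ≤ Hb q} = ∅) : Eff Hb where
  conv := by
    refine ⟨convex_univ, fun p _ q _ a b ha hb hab => le_of_forall_pos_le_add fun e he => ?_⟩
    refine (h2 _ _ ((h1 p (Hb p + e) (by linarith)).convex_comb hconv
      (h1 q (Hb q + e) (by linarith)) ha hb hab)).trans_eq ?_
    simp only [smul_eq_mul]
    linear_combination e * hab
  coer C := by
    obtain ⟨j, hj⟩ := hreg (C + 1)
    exact ⟨j, fun p hp => (h1 p (C + 1) (by linarith)).norm_le hj⟩
  flat := hflat

variable {U : Set (Ed n)} {μ j : ℝ} {M : Ed n → ℝ} {f : ℝ → Ed n → ℝ}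

/-- Rescaled intrinsic distances compare with absolute minimizers and converge. -/
theorem exists_rescaled_met (hG : Reg G μ j) (hne : ∃ w, IsSub G μ w)
    (hM : Homogenizes (met G μ) M)
    (hf : ∀ ε > (0 : ℝ), AbsMin (fun p x => G p (ε⁻¹ • x)) U (f ε)) :
    ∃ m : ℝ → Ed n → Ed n → ℝ,
      (∀ ε > 0, CompCones (m ε) U (f ε) ∧ CompCones (fun y x => m ε x y) U (fun x => -f ε x)) ∧
      (∀ ε > 0, ∀ y z x, m ε y x - m ε z x ≤ j * ‖y - z‖ ∧ m ε x y - m ε x z ≤ j * ‖y - z‖) ∧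
      ∀ y x, Tendsto (fun ε => m ε y x) (nhdsWithin 0 (Ioi 0)) (nhds (M (y - x))) := by
  have e : ∀ ε : ℝ, (fun p (x : Ed n) => G p (ε⁻¹ • x)) = fun p x => G p (ε⁻¹ • x + 0) :=
    fun ε => by simp only [add_zero]
  have hR : ∀ ε > (0 : ℝ), Reg (fun p x => G p (ε⁻¹ • x)) μ j := fun ε hε => by
    rw [e]; exact hG.affine (inv_pos.2 hε) 0
  have hN : ∀ ε > (0 : ℝ), ∃ w, IsSub (fun p x => G p (ε⁻¹ • x)) μ w := fun ε hε => by
    rw [e]; exact exists_isSub_affine hne (inv_pos.2 hε) 0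
  refine ⟨fun ε => met (fun p x => G p (ε⁻¹ • x)) μ, fun ε hε => ⟨?_, ?_⟩, fun ε hε y z x =>
    ⟨?_, ?_⟩, fun y x => ?_⟩
  · exact (hf ε hε).1.compCones (hR ε hε) (hN ε hε)
  · have h1 := (hf ε hε).2.neg.compCones (hR ε hε).reflect (by
      obtain ⟨w, hw⟩ := hN ε hε
      refine ⟨fun y => -w y, (isSub_reflect (G := fun p x => G p (ε⁻¹ • x))).2 ?_⟩
      simpa only [neg_neg] using hw)
    have h2 : met (fun p (x : Ed n) => G (-p) (ε⁻¹ • x)) μ =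
        fun y x => met (fun p x => G p (ε⁻¹ • x)) μ x y := by
      funext y x
      exact met_reflect (fun p x => G p (ε⁻¹ • x)) μ y x
    rwa [h2] at h1
  · linarith [met_triangle (hR ε hε) (hN ε hε) y z x, met_le_norm (hR ε hε) (hN ε hε) y z]
  · have := met_le_norm (hR ε hε) (hN ε hε) z y
    rw [norm_sub_rev] at this
    linarith [met_triangle (hR ε hε) (hN ε hε) x z y]
  · refine ((hM.tendsto x (y - x)).comp tendsto_inv_nhdsGT_zero).congr' ?_
    filter_upwards [self_mem_nhdsWithin] with ε hε
    rw [e, met_affine G μ (inv_pos.2 hε) 0 y x]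
    simp only [Function.comp, add_sub_cancel, add_zero]

end Effective

theorem effHR_eq {n : ℕ} {Ω : Type*} (H : Ed n → Ed n → Ω → ℝ) (ω : Ω) (p : Ed n) :
    effHR H ω p = sInf {μ | Corr (fun p y => H p y ω) p μ} := by
  unfold effHR effSetR Corr IsSub
  congr 1
  ext μ
  refine exists_congr fun w => ?_
  tauto

section Environment

variable {n : ℕ} {Ω : Type*} [MeasurableSpace Ω] {P : Measure Ω} {τ : Ed n → Ω → Ω}
  {H : Ed n → Ed n → Ω → ℝ} {Hbar : Ed n → ℝ}

theorem Env.exists_reg (hE : Env P τ H) (ω : Ω) (μ : ℝ) :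
    ∃ j, Reg (fun p y => H p y ω) μ j := by
  obtain ⟨R, hR⟩ := hE.coer ω (μ + 1)
  exact ⟨max R 0, hE.reg (le_max_right _ _)
    fun p y h => hR p y ((le_max_left _ _).trans h.le)⟩

theorem Env.exists_lower_bound (hE : Env P τ H) (ω : Ω) : ∃ B, ∀ p y, B ≤ H p y ω := by
  obtain ⟨R, hR⟩ := hE.coer ω 0
  obtain ⟨C, hC⟩ := hE.bdd (|R| + 1) (by positivity)
  refine ⟨-|C|, fun p y => ?_⟩
  by_cases h : R ≤ ‖p‖
  · exact (neg_nonpos.2 (abs_nonneg C)).trans (hR p y h)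
  · have := (abs_le.1 (hC ω p y (by linarith [le_abs_self R]))).1
    linarith [le_abs_self C]

theorem Env.exists_upper_bound (hE : Env P τ H) (ω : Ω) (p : Ed n) : ∃ C, ∀ y, H p y ω ≤ C := by
  obtain ⟨C, hC⟩ := hE.bdd (‖p‖ + 1) (by positivity)
  exact ⟨C, fun y => (abs_le.1 (hC ω p y (by linarith))).2⟩

theorem Env.corr_iff_lt (hE : Env P τ H) {ω : Ω} (h : ∀ p, effHR H ω p = Hbar p) :
    (∀ p ν, Hbar p < ν → Corr (fun p y => H p y ω) p ν) ∧
      ∀ p ν, Corr (fun p y => H p y ω) p ν → Hbar p ≤ ν := by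
  obtain ⟨B, hB⟩ := hE.exists_lower_bound ω
  exact _root_.corr_iff_lt (hE.exists_upper_bound ω) hB fun p => by rw [← h p, effHR_eq]

theorem Env.exists_homogenizes [IsProbabilityMeasure P] (hE : Env P τ H) (hH : Eff Hbar)
    (hHbar : ∀ᵐ ω ∂P, ∀ p, effHR H ω p = Hbar p) {μ : ℝ} (hμ : ∃ p, Hbar p < μ) :
    ∃ j, ∀ᵐ ω ∂P, Reg (fun p y => H p y ω) μ j ∧ (∃ w, IsSub (fun p y => H p y ω) μ w) ∧
      Homogenizes (met (fun p y => H p y ω) μ) (supp Hbar μ) := by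
  obtain ⟨j, hj, hcoer⟩ := hE.exists_coer μ
  obtain ⟨M, hM⟩ := (hE.cocycle (μ := μ) hj).exists_homogenized hE.act
  refine ⟨j, ?_⟩
  filter_upwards [hcoer, hM, hHbar] with ω h1 h2 h3
  have hR := hE.reg hj h1
  obtain ⟨h4, h5⟩ := hE.corr_iff_lt h3
  have hne : ∃ w, IsSub (fun p y => H p y ω) μ w := by
    obtain ⟨p, hp⟩ := hμ
    obtain ⟨W, hW, _⟩ := (h4 p μ hp).exists_isSub
    exact ⟨W, hW⟩
  have h6 : Homogenizes (met (fun p y => H p y ω) μ) M := fun x v η hη => by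
    simpa only [rmet_eq h1 hne] using h2 x v η hη
  have h7 : M = supp Hbar μ := funext fun v => h6.eq_supp hR hH h4 h5 hμ v
  exact ⟨hR, hne, h7 ▸ h6⟩

end Environment

/-- Homogenization with boundary data: if `argmin H̄` has empty interior, `U` is bounded,
open, with smooth boundary, and `u^ε(·,ω)` are absolute minimizers for `H^ε` with boundary
data `g`, uniformly bounded and equicontinuous, then there is a unique absolute minimizer
`u` for `H̄` in `U` with `u = g` on `∂U`, and almost surely `u^ε(·,ω) → u` uniformly on
`closure U`. -/
theorem stmt_4
    (n : ℕ) (hn : 1 ≤ n)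
    {Ω : Type*} [MeasurableSpace Ω] (P : Measure Ω) [IsProbabilityMeasure P]
    (τ : Ed n → Ω → Ω)
    (hτmeas : ∀ y, Measurable (τ y))
    (hτmp : ∀ y, MeasurePreserving (τ y) P P)
    (hτgrp : ∀ y z, τ (y + z) = τ y ∘ τ z) (hτ0 : τ 0 = id)
    (herg : ∀ D : Set Ω, MeasurableSet D → (∀ z, τ z ⁻¹' D = D) → P D = 0 ∨ P D = 1)
    (H : Ed n → Ed n → Ω → ℝ)
    (hHmeas : ∀ p, Measurable (fun q : Ed n × Ω => H p q.1 q.2))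
    (hHstat : ∀ p y z ω, H p y (τ z ω) = H p (y + z) ω)
    (hHconv : ∀ y ω, ConvexOn ℝ Set.univ (fun p => H p y ω))
    (hHcoer : ∀ ω, ∀ C : ℝ, ∃ R : ℝ, ∀ p y, R ≤ ‖p‖ → C ≤ H p y ω)
    (hHbdd : ∀ R > (0 : ℝ), ∃ C : ℝ, ∀ ω p y, ‖p‖ < R → |H p y ω| ≤ C)
    (hHequi : ∀ R > (0 : ℝ), ∀ ε > (0 : ℝ), ∃ δ > (0 : ℝ), ∀ (ω : Ω) (p₁ p₂ y₁ y₂ : Ed n),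
      ‖p₁‖ < R → ‖p₂‖ < R → dist p₁ p₂ < δ → dist y₁ y₂ < δ →
      |H p₁ y₁ ω - H p₂ y₂ ω| ≤ ε)
    (Hbar : Ed n → ℝ)
    (hHbar : ∀ᵐ ω ∂P, ∀ p : Ed n, effHR H ω p = Hbar p)
    -- `argmin H̄` has empty interior
    (hflat : interior {p : Ed n | ∀ q, Hbar p ≤ Hbar q} = ∅)
    -- `U` is a bounded open set with smooth boundary
    (U : Set (Ed n)) (hU : IsOpen U) (hUbd : Bornology.IsBounded U)
    (hUsmooth : ∃ f : Ed n → ℝ, ContDiff ℝ (⊤ : ℕ∞) f ∧ U = {x | f x < 0} ∧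
      frontier U = {x | f x = 0} ∧ ∀ x ∈ frontier U, fderiv ℝ f x ≠ 0)
    (g : Ed n → ℝ) (hg : ContinuousOn g (frontier U))
    (u : ℝ → Ed n → Ω → ℝ)
    (humin : ∀ ω : Ω, ∀ ε > (0 : ℝ),
      ContinuousOn (fun x => u ε x ω) (closure U) ∧
      AbsMin (fun p x => H p (ε⁻¹ • x) ω) U (fun x => u ε x ω) ∧
      ∀ x ∈ frontier U, u ε x ω = g x)
    (hubdd : ∀ ω : Ω, ∃ C : ℝ, ∀ ε > (0 : ℝ), ∀ x ∈ closure U, |u ε x ω| ≤ C)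
    (huequi : ∀ ω : Ω, ∀ η > (0 : ℝ), ∃ δ > (0 : ℝ), ∀ ε > (0 : ℝ),
      ∀ x ∈ closure U, ∀ y ∈ closure U, dist x y < δ → |u ε x ω - u ε y ω| ≤ η) :
    ∃ ub : Ed n → ℝ,
      (ContinuousOn ub (closure U) ∧ AbsMin (fun p _ => Hbar p) U ub ∧
        ∀ x ∈ frontier U, ub x = g x) ∧
      (∀ ub' : Ed n → ℝ,
        (ContinuousOn ub' (closure U) ∧ AbsMin (fun p _ => Hbar p) U ub' ∧
          ∀ x ∈ frontier U, ub' x = g x) → ∀ x ∈ closure U, ub' x = ub x) ∧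
      ∀ᵐ ω ∂P, TendstoUniformlyOn (fun ε x => u ε x ω) ub
        (nhdsWithin 0 (Set.Ioi 0)) (closure U) := by
  have hE : Env P τ H := ⟨⟨hτmp, fun y z ω => congrFun (hτgrp y z) ω, fun ω => congrFun hτ0 ω, herg⟩,
    hHmeas, hHstat, hHconv, hHcoer, hHbdd, hHequi⟩
  have hH : Eff Hbar := by
    obtain ⟨ω, hω⟩ := hHbar.exists
    obtain ⟨h1, h2⟩ := hE.corr_iff_lt hω
    exact eff_of_corr (fun y => hHconv y ω) (hE.exists_reg ω) h1 h2 hflat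
  have hlim : ∀ᵐ ω ∂P, ∃ ub : Ed n → ℝ, ContinuousOn ub (closure U) ∧
      AbsMin (fun p _ => Hbar p) U ub ∧ (∀ x ∈ frontier U, ub x = g x) ∧
      TendstoUniformlyOn (fun ε x => u ε x ω) ub (nhdsWithin 0 (Set.Ioi 0)) (closure U) := by
    have h1 : ∀ μ : ℚ, ∀ᵐ ω ∂P, (∃ p, Hbar p < μ) → ∃ j, Reg (fun p y => H p y ω) μ j ∧
        (∃ w, IsSub (fun p y => H p y ω) μ w) ∧
        Homogenizes (met (fun p y => H p y ω) μ) (supp Hbar μ) := fun μ => by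
      by_cases hμ : ∃ p, Hbar p < μ
      · obtain ⟨j, hj⟩ := hE.exists_homogenizes hH hHbar hμ
        exact hj.mono fun ω hω _ => ⟨j, hω⟩
      · exact Eventually.of_forall fun ω h => absurd h hμ
    filter_upwards [ae_all_iff.2 h1] with ω hω
    obtain ⟨B, hB⟩ := hubdd ω
    refine hH.limit hU hUbd hB (huequi ω) (fun ε hε => (humin ω ε hε).2.2) fun μ hμ => ?_
    obtain ⟨j, hR, hne, hM⟩ := hω μ hμ
    exact ⟨j, exists_rescaled_met hR hne hM fun ε hε => (humin ω ε hε).2.1⟩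
  obtain ⟨ω₀, ub, h1, h2, h3, -⟩ := hlim.exists
  have huniq : ∀ ub' : Ed n → ℝ, (ContinuousOn ub' (closure U) ∧
      AbsMin (fun p _ => Hbar p) U ub' ∧ ∀ x ∈ frontier U, ub' x = g x) →
      ∀ x ∈ closure U, ub' x = ub x := fun ub' ⟨a, b, c⟩ =>
    hH.unique hU hUbd a h1 b h2 fun x hx => (c x hx).trans (h3 x hx).symm
  refine ⟨ub, ⟨h1, h2, h3⟩, huniq, hlim.mono fun ω ⟨ub', a, b, c, d⟩ => ?_⟩
  exact d.congr_right fun x hx => huniq ub' ⟨a, b, c⟩ x hx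

end
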